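/- Let λ/μ be a skew shape with λ, μ partitions with at most n parts. Then the refined dual stable Grothendieck polynomial satisfies g̃_{λ/μ}(x; t) = Σ_{R ∈ ℝ(λ/μ)} wt_{λ/μ}(R) · RG_{sh(R)}(x; 1), an identity in ℤ[t_1,…,t_n][x_1,…,x_n] in which all but finitely many summands vanish; here ℝ(λ/μ) is the set of reverse plane partitions of partition shape whose reading word is Knuth equivalent to an element of 𝕋(λ/μ), and wt_{λ/μ}(R) = t^{ceq(rect(w(R)))}. -/

import Mathlib

/-!
Common combinatorial framework for flagged refined stable Grothendieck polynomials
of skew shapes: skew shapes, semistandard set-valued tableaux, the signature-rule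
crystal operators, reading words, Knuth equivalence, the Burge correspondence and
the Chan–Pflueger skew set-valued row insertion (as interfaces), Demazure crystals
and key polynomials.
-/

open Classical

attribute [local instance 2000] Classical.propDecidable

noncomputable section

namespace SkewG

/-! ### Cells and shapes -/

/-- A cell `(i, j)`: row `i`, column `j` (both 0-indexed). -/
abbrev Cell : Type := ℕ × ℕ

/-- A finite set of cells is the Young diagram of a partition iff it is a lower set. -/
def IsPartitionShape (s : Finset Cell) : Prop :=
  ∀ i j i' j', (i, j) ∈ s → i' ≤ i → j' ≤ j → (i', j') ∈ s

/-- The shape has at most `n` parts (rows `0, …, n-1`). -/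
def AtMostRows (s : Finset Cell) (n : ℕ) : Prop := ∀ c ∈ s, c.1 < n

/-- Two cells share a side. -/
def Adj (c d : Cell) : Prop :=
  (c.1 = d.1 ∧ (c.2 = d.2 + 1 ∨ d.2 = c.2 + 1)) ∨
  (c.2 = d.2 ∧ (c.1 = d.1 + 1 ∨ d.1 = c.1 + 1))

/-- Any two boxes of `s` are linked by a path inside `s`. -/
def ConnectedShape (s : Finset Cell) : Prop :=
  ∀ c ∈ s, ∀ d ∈ s,
    Relation.ReflTransGen (fun a b => a ∈ s ∧ b ∈ s ∧ Adj a b) c d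

/-- `s` is a skew shape `λ/μ`. -/
def IsSkewShape (s : Finset Cell) : Prop :=
  ∃ lam mu : Finset Cell, IsPartitionShape lam ∧ IsPartitionShape mu ∧
    mu ⊆ lam ∧ s = lam \ mu

/-! ### Tableaux -/

/-- A semistandard set-valued tableau on the cell set `s`, with entries in `{1, …, n}`:
nonempty sets on `s`, empty outside, rows weakly increasing, columns strictly increasing. -/
def IsSVTOn (n : ℕ) (s : Finset Cell) (T : Cell → Finset ℕ) : Prop :=
  (∀ c ∈ s, (T c).Nonempty) ∧
  (∀ c, c ∉ s → T c = ∅) ∧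
  (∀ c, ∀ x ∈ T c, 1 ≤ x ∧ x ≤ n) ∧
  (∀ i j, (i, j) ∈ s → (i, j + 1) ∈ s →
    ∀ x ∈ T (i, j), ∀ y ∈ T (i, j + 1), x ≤ y) ∧
  (∀ i j, (i, j) ∈ s → (i + 1, j) ∈ s →
    ∀ x ∈ T (i, j), ∀ y ∈ T (i + 1, j), x < y)

/-- An ordinary (single-valued) semistandard Young tableau on `s`; `0` outside `s`. -/
def IsSSYTOn (s : Finset Cell) (T : Cell → ℕ) : Prop :=
  (∀ c ∈ s, 1 ≤ T c) ∧
  (∀ c, c ∉ s → T c = 0) ∧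
  (∀ i j, (i, j) ∈ s → (i, j + 1) ∈ s → T (i, j) ≤ T (i, j + 1)) ∧
  (∀ i j, (i, j) ∈ s → (i + 1, j) ∈ s → T (i, j) < T (i + 1, j))

/-- A reverse row-strict tableau: rows strictly decreasing, columns weakly decreasing. -/
def IsRevRowStrictOn (s : Finset Cell) (T : Cell → ℕ) : Prop :=
  (∀ c ∈ s, 1 ≤ T c) ∧
  (∀ c, c ∉ s → T c = 0) ∧
  (∀ i j, (i, j) ∈ s → (i, j + 1) ∈ s → T (i, j + 1) < T (i, j)) ∧
  (∀ i j, (i, j) ∈ s → (i + 1, j) ∈ s → T (i + 1, j) ≤ T (i, j))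

/-- Row bounded: entries in (0-indexed) row `i` — i.e. row `i+1` — are `< i+1`. -/
def IsRowBounded (s : Finset Cell) (T : Cell → ℕ) : Prop :=
  ∀ c ∈ s, T c ≤ c.1

/-- Row weakly bounded: entries in row `i+1` (1-indexed) are `≤ i+1`. -/
def IsRowWeaklyBounded (s : Finset Cell) (T : Cell → ℕ) : Prop :=
  ∀ c ∈ s, T c ≤ c.1 + 1

/-- Number of occurrences of the letter `v` in a set-valued tableau. -/
def wtOn (s : Finset Cell) (T : Cell → Finset ℕ) (v : ℕ) : ℕ :=
  ∑ c ∈ s, if v ∈ T c then 1 else 0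

/-- Number of occurrences of the letter `v` in a single-valued tableau. -/
def wtS (s : Finset Cell) (T : Cell → ℕ) (v : ℕ) : ℕ :=
  ∑ c ∈ s, if T c = v then 1 else 0

/-- Excess in (0-indexed) row `i`: number of entries minus number of boxes. -/
def exRow (s : Finset Cell) (T : Cell → Finset ℕ) (i : ℕ) : ℕ :=
  (∑ c ∈ s.filter (fun c => c.1 = i), (T c).card) - (s.filter (fun c => c.1 = i)).card

/-- Total excess `|ex(T)|`. -/
def exTotal (s : Finset Cell) (T : Cell → Finset ℕ) : ℕ :=
  (∑ c ∈ s, (T c).card) - s.card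

/-- A flag (0-indexed): weakly increasing on rows `0, …, n-1`, positive, with `Φ (n-1) = n`. -/
def IsFlag (n : ℕ) (Φ : ℕ → ℕ) : Prop :=
  (∀ i j, i ≤ j → j < n → Φ i ≤ Φ j) ∧ (∀ i, i < n → 1 ≤ Φ i) ∧ Φ (n - 1) = n

/-- A set-valued tableau respects the flag `Φ`: entries of row `i` are at most `Φ i`. -/
def RespectsFlag (Φ : ℕ → ℕ) (T : Cell → Finset ℕ) : Prop :=
  ∀ i j, ∀ x ∈ T (i, j), x ≤ Φ i

/-- A single-valued tableau on `s` respects the flag `Φ`. -/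
def RespectsFlagS (s : Finset Cell) (Φ : ℕ → ℕ) (T : Cell → ℕ) : Prop :=
  ∀ c ∈ s, T c ≤ Φ c.1

/-- View a single-valued tableau as a set-valued one. -/
def svtOf (T : Cell → ℕ) : Cell → Finset ℕ := fun c => if T c = 0 then ∅ else {T c}

/-! ### The signature-rule crystal operators on set-valued fillings -/

def colHas (T : Cell → Finset ℕ) (v j : ℕ) : Prop := ∃ i, v ∈ T (i, j)

/-- Column `j` gets a `+` for the letter `v`: it contains `v` but not `v+1`. -/
def IsPlusCol (T : Cell → Finset ℕ) (v j : ℕ) : Prop := colHas T v j ∧ ¬ colHas T (v + 1) j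

/-- Column `j` gets a `-` for the letter `v`: it contains `v+1` but not `v`. -/
def IsMinusCol (T : Cell → Finset ℕ) (v j : ℕ) : Prop := colHas T (v + 1) j ∧ ¬ colHas T v j

def plusCount (T : Cell → Finset ℕ) (v a b : ℕ) : ℕ :=
  ((Finset.Ico a b).filter (fun j => IsPlusCol T v j)).card

def minusCount (T : Cell → Finset ℕ) (v a b : ℕ) : ℕ :=
  ((Finset.Ico a b).filter (fun j => IsMinusCol T v j)).card

/-- The `+` above column `j` survives the successive cancellation of `(-,+)` pairs. -/
def UnmatchedPlus (T : Cell → Finset ℕ) (v j : ℕ) : Prop :=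
  IsPlusCol T v j ∧ minusCount T v 0 j < plusCount T v 0 (j + 1)

/-- The `-` above column `j` survives the successive cancellation of `(-,+)` pairs. -/
def UnmatchedMinus (T : Cell → Finset ℕ) (v j : ℕ) : Prop :=
  IsMinusCol T v j ∧ ∀ b, plusCount T v (j + 1) b ≤ minusCount T v (j + 1) b

/-- The lowering operator `f_v` on raw set-valued fillings (`none` encodes `0`). -/
def fFill (v : ℕ) (T : Cell → Finset ℕ) : Option (Cell → Finset ℕ) :=
  if h : ∃ j, UnmatchedPlus T v j then
    letI j := sSup {j | UnmatchedPlus T v j}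
    if hr : ∃ i, v ∈ T (i, j) then
      letI r := Classical.choose hr
      if v ∈ T (r, j + 1) then
        some (fun c =>
          if c = (r, j + 1) then (T c).erase v
          else if c = (r, j) then insert (v + 1) (T c)
          else T c)
      else
        some (fun c => if c = (r, j) then insert (v + 1) ((T c).erase v) else T c)
    else none
  else none

/-- The raising operator `e_v` on raw set-valued fillings (`none` encodes `0`). -/
def eFill (v : ℕ) (T : Cell → Finset ℕ) : Option (Cell → Finset ℕ) :=
  if h : ∃ j, UnmatchedMinus T v j then
    letI j := sInf {j | UnmatchedMinus T v j}
    if hr : ∃ i, (v + 1) ∈ T (i, j) then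
      letI r := Classical.choose hr
      if 1 ≤ j ∧ (v + 1) ∈ T (r, j - 1) then
        some (fun c =>
          if c = (r, j - 1) then (T c).erase (v + 1)
          else if c = (r, j) then insert v (T c)
          else T c)
      else
        some (fun c => if c = (r, j) then insert v ((T c).erase (v + 1)) else T c)
    else none
  else none

def fIter (v : ℕ) : ℕ → (Cell → Finset ℕ) → Option (Cell → Finset ℕ)
  | 0, T => some T
  | k + 1, T => (fIter v k T).bind (fFill v)

def eIter (v : ℕ) : ℕ → (Cell → Finset ℕ) → Option (Cell → Finset ℕ)
  | 0, T => some T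
  | k + 1, T => (eIter v k T).bind (eFill v)

/-- `φ_v(T) = max {k | f_v^k T ≠ 0}`. -/
def phiOp (v : ℕ) (T : Cell → Finset ℕ) : ℕ := sSup {k | (fIter v k T).isSome}

/-- `ε_v(T) = max {k | e_v^k T ≠ 0}`. -/
def epsOp (v : ℕ) (T : Cell → Finset ℕ) : ℕ := sSup {k | (eIter v k T).isSome}

/-- A highest weight element: killed by all raising operators. -/
def HighestWeight (n : ℕ) (T : Cell → Finset ℕ) : Prop :=
  ∀ v, 1 ≤ v → v + 1 ≤ n → eFill v T = none

/-- One step of the crystal graph (in either direction). -/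
def CrystRel (n : ℕ) (T U : Cell → Finset ℕ) : Prop :=
  ∃ v, 1 ≤ v ∧ v + 1 ≤ n ∧ (fFill v T = some U ∨ fFill v U = some T)

/-- The connected component of `S'` inside a subset `X` of a crystal. -/
def ComponentOf (n : ℕ) (X : Set (Cell → Finset ℕ)) (S' : Cell → Finset ℕ) :
    Set (Cell → Finset ℕ) :=
  {T | T ∈ X ∧ Relation.ReflTransGen (fun a b => a ∈ X ∧ b ∈ X ∧ CrystRel n a b) S' T}

/-! ### Words -/

/-- Columns of row `i` of `s`, listed from left to right. -/
def rowList (s : Finset Cell) (i : ℕ) : List ℕ :=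
  (List.range (s.sup Prod.snd + 1)).filter (fun j => decide ((i, j) ∈ s))

def rowLenOf (s : Finset Cell) (i : ℕ) : ℕ := (rowList s i).length

def rowWordOn (s : Finset Cell) (T : Cell → ℕ) (i : ℕ) : List ℕ :=
  (rowList s i).map (fun j => T (i, j))

/-- The row reading word: rows bottom to top, each row left to right. -/
def readingWordOn (s : Finset Cell) (T : Cell → ℕ) : List ℕ :=
  ((List.range (s.sup Prod.fst + 1)).reverse.map (rowWordOn s T)).flatten

/-- The word `b(s)`: `(row length of row i)` copies of the letter `i+1`,
rows listed from the bottom up. -/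
def bwordOn (s : Finset Cell) : List ℕ :=
  ((List.range (s.sup Prod.fst + 1)).reverse.map
    (fun i => List.replicate (rowList s i).length (i + 1))).flatten

/-- The word `b(α)` of a composition: `α i` copies of the letter `i+1`, decreasing letters. -/
def bwordComp (n : ℕ) (α : ℕ → ℕ) : List ℕ :=
  ((List.range n).reverse.map (fun i => List.replicate (α i) (i + 1))).flatten

/-- Elementary Knuth moves. -/
inductive KnuthStep : List ℕ → List ℕ → Prop
  | kxzy (u w : List ℕ) (x y z : ℕ) (h1 : x ≤ y) (h2 : y < z) :
      KnuthStep (u ++ x :: z :: y :: w) (u ++ z :: x :: y :: w)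
  | kyxz (u w : List ℕ) (x y z : ℕ) (h1 : x < y) (h2 : y ≤ z) :
      KnuthStep (u ++ y :: x :: z :: w) (u ++ y :: z :: x :: w)

/-- Knuth (plactic) equivalence of words. -/
def KnuthEquiv : List ℕ → List ℕ → Prop := Relation.EqvGen KnuthStep

/-- Yamanouchi word: in every suffix, `v+1` occurs at least as often as `v+2`. -/
def IsYamanouchi (w : List ℕ) : Prop :=
  ∀ k v, (w.drop k).count (v + 2) ≤ (w.drop k).count (v + 1)

/-- The biword conditions (columns listed left to right with weakly decreasing top row,
strictly decreasing the top whenever the bottom strictly decreases). -/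
def IsBiword (top bot : List ℕ) : Prop :=
  top.length = bot.length ∧
  (∀ x ∈ top, 1 ≤ x) ∧ (∀ x ∈ bot, 1 ≤ x) ∧
  ∀ p, p + 1 < top.length →
    top.getD (p + 1) 0 ≤ top.getD p 0 ∧
    (bot.getD (p + 1) 0 < bot.getD p 0 → top.getD (p + 1) 0 < top.getD p 0)

/-! ### Sorting, Demazure crystals -/

/-- The `i`-th largest value (0-indexed) among `α 0, …, α (n-1)`: the decreasing
rearrangement `α†`. -/
def dsort (n : ℕ) (α : ℕ → ℕ) (i : ℕ) : ℕ :=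
  sSup {m | i < ((Finset.range n).filter (fun k => m ≤ α k)).card}

/-- The Young diagram of a weakly decreasing function. -/
def diagOf (n : ℕ) (f : ℕ → ℕ) : Finset Cell :=
  (Finset.product (Finset.range n) (Finset.range (f 0))).filter (fun c => c.2 < f c.1)

/-- product of simple transpositions `s_{i} = (i, i+1)` (0-indexed coordinates). -/
def permOfWord (is : List ℕ) : Equiv.Perm ℕ :=
  (is.map (fun i => Equiv.swap i (i + 1))).prod

def IsReducedWord (τ : Equiv.Perm ℕ) (is : List ℕ) : Prop :=
  permOfWord is = τ ∧ ∀ js : List ℕ, permOfWord js = τ → is.length ≤ js.length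

/-- `τ • α` with `(τ • α) (τ i) = α i`. -/
def permuteComp (τ : Equiv.Perm ℕ) (f : ℕ → ℕ) : ℕ → ℕ := fun i => f (τ.symm i)

/-- The unique SSYT of partition shape `sh` whose weight equals its shape
(`i+1`'s in row `i`). -/
def highestTabOf (sh : Finset Cell) : Cell → ℕ := fun c => if c ∈ sh then c.1 + 1 else 0

/-- Apply `f_{i₁}^{k₁} ∘ ⋯ ∘ f_{i_p}^{k_p}` (rightmost factor first); the letters of the
first list are crystal indices. -/
def applyF : List ℕ → List ℕ → (Cell → Finset ℕ) → Option (Cell → Finset ℕ)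
  | [], _, T => some T
  | _ :: _, [], T => some T
  | i :: is, k :: ks, T => (applyF is ks T).bind (fIter i k)

/-- The Demazure crystal `B_w(sh)` (as a set of set-valued fillings all of whose
values are singletons), for a given word for `w`; the word is a list of crystal
indices `i` (acting on the letters `i, i+1`). -/
def DemazureSet (sh : Finset Cell) (word : List ℕ) : Set (Cell → Finset ℕ) :=
  {T | ∃ ks : List ℕ, ks.length = word.length ∧
        applyF word ks (svtOf (highestTabOf sh)) = some T}

/-! ### Key polynomials via Demazure operators -/

/-- `T_i` applied to a monomial `x^a` (the exact quotient
`(x_i x^a - x_{i+1} s_i x^a)/(x_i - x_{i+1})`), written as an explicit sum. -/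
def demMono (n : ℕ) (i : ℕ) (h : i + 1 < n) (a : Fin n →₀ ℕ) : MvPolynomial (Fin n) ℤ :=
  letI i0 : Fin n := ⟨i, Nat.lt_of_succ_lt h⟩
  letI i1 : Fin n := ⟨i + 1, h⟩
  letI p := a i0
  letI q := a i1
  if q ≤ p then
    ∑ m ∈ Finset.Icc q p,
      MvPolynomial.monomial ((a.update i0 m).update i1 (p + q - m)) (1 : ℤ)
  else
    - ∑ m ∈ Finset.Ico (p + 1) q,
      MvPolynomial.monomial ((a.update i0 m).update i1 (p + q - m)) (1 : ℤ)

/-- The Demazure operator `T_i` (0-indexed: acts on the variables `x_i, x_{i+1}`). -/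
def demOp (n : ℕ) (i : ℕ) (f : MvPolynomial (Fin n) ℤ) : MvPolynomial (Fin n) ℤ :=
  if h : i + 1 < n then
    ∑ a ∈ f.support, MvPolynomial.C (MvPolynomial.coeff a f) * demMono n i h a
  else f

/-- `T_w` along a word (leftmost letter applied last). -/
def demWord (n : ℕ) : List ℕ → MvPolynomial (Fin n) ℤ → MvPolynomial (Fin n) ℤ
  | [], f => f
  | i :: is, f => demOp n i (demWord n is f)

/-- The monomial `x^α` (coordinate `i` of `Fin n` carries `α i`). -/
def xMono (n : ℕ) (α : ℕ → ℕ) : MvPolynomial (Fin n) ℤ :=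
  ∏ i : Fin n, MvPolynomial.X i ^ α (i : ℕ)

/-- The key polynomial `κ_α = T_w x^{α†}` for (any) reduced word of a permutation `w`
with `w • α† = α`. -/
def keyPoly (n : ℕ) (α : ℕ → ℕ) : MvPolynomial (Fin n) ℤ :=
  if h : ∃ is : List ℕ, IsReducedWord (permOfWord is) is ∧
      (∀ i, i < n → permuteComp (permOfWord is) (dsort n α) i = α i)
  then demWord n h.choose (xMono n (dsort n α))
  else 0

/-! ### Generating polynomials -/

abbrev XPoly (n : ℕ) := MvPolynomial (Fin n) ℤ
abbrev XTPoly (n : ℕ) := MvPolynomial (Fin n) (MvPolynomial (Fin n) ℤ)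

/-- Embed an `x`-polynomial into the ring `ℤ[t][x]`. -/
def liftX (n : ℕ) (f : XPoly n) : XTPoly n :=
  MvPolynomial.map (MvPolynomial.C : ℤ →+* MvPolynomial (Fin n) ℤ) f

/-- The monomial `t^α` inside `ℤ[t][x]` (as a constant in the `x`-variables). -/
def tMono (n : ℕ) (α : ℕ → ℕ) : XTPoly n :=
  MvPolynomial.C (∏ i : Fin n, MvPolynomial.X i ^ α (i : ℕ))

/-- The monomial `x^{wt T}` for a set-valued tableau, inside `ℤ[t][x]`. -/
def xWt (n : ℕ) (s : Finset Cell) (T : Cell → Finset ℕ) : XTPoly n :=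
  ∏ i : Fin n, MvPolynomial.X i ^ wtOn s T ((i : ℕ) + 1)

/-- extend a `Fin n`-indexed composition by zero. -/
def extendf (n : ℕ) (α : Fin n → ℕ) : ℕ → ℕ :=
  fun r => if h : r < n then α ⟨r, h⟩ else 0

/-- The flagged refined skew stable Grothendieck polynomial
`G_{λ/μ}(X_Φ; t) = Σ_T (-1)^{|ex T|} t^{ex T} x^{wt T}`. -/
def Gflagged (n : ℕ) (s : Finset Cell) (Φ : ℕ → ℕ) : XTPoly n :=
  ∑ᶠ T : {T : Cell → Finset ℕ // IsSVTOn n s T ∧ RespectsFlag Φ T},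
    ((-1 : XTPoly n) ^ exTotal s T.1) * tMono n (exRow s T.1) * xWt n s T.1

/-- The flagged skew Schur polynomial `s_{λ/μ}(X_Φ)`. -/
def sFlagged (n : ℕ) (s : Finset Cell) (Φ : ℕ → ℕ) : XPoly n :=
  ∑ᶠ U : {U : Cell → ℕ // IsSSYTOn s U ∧ (∀ c ∈ s, U c ≤ n) ∧ RespectsFlagS s Φ U},
    ∏ i : Fin n, MvPolynomial.X i ^ wtS s U.1 ((i : ℕ) + 1)

/-- The Schur polynomial `s_ν(x_1, …, x_n)` of a partition shape. -/
def schurOf (n : ℕ) (sh : Finset Cell) : XPoly n :=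
  ∑ᶠ U : {U : Cell → ℕ // IsSSYTOn sh U ∧ ∀ c ∈ sh, U c ≤ n},
    ∏ i : Fin n, MvPolynomial.X i ^ wtS sh U.1 ((i : ℕ) + 1)

/-- The stable Grothendieck polynomial `G_ν(x_1,…,x_n) = RG_ν(x; 1)`. -/
def RGone (n : ℕ) (sh : Finset Cell) : XPoly n :=
  ∑ᶠ T : {T : Cell → Finset ℕ // IsSVTOn n sh T},
    ((-1 : XPoly n) ^ exTotal sh T.1) *
      ∏ i : Fin n, MvPolynomial.X i ^ wtOn sh T.1 ((i : ℕ) + 1)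

/-! ### Reverse plane partitions -/

/-- A reverse plane partition on `s` (weakly increasing rows and columns, `0` outside). -/
def IsRPPOn (s : Finset Cell) (R : Cell → ℕ) : Prop :=
  (∀ c ∈ s, 1 ≤ R c) ∧ (∀ c, c ∉ s → R c = 0) ∧
  (∀ i j, (i, j) ∈ s → (i, j + 1) ∈ s → R (i, j) ≤ R (i, j + 1)) ∧
  (∀ i j, (i, j) ∈ s → (i + 1, j) ∈ s → R (i, j) ≤ R (i + 1, j))

/-- `wt(R) v` = number of columns of `R` containing `v`. -/
def wtRPP (s : Finset Cell) (R : Cell → ℕ) (v : ℕ) : ℕ :=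
  ((Finset.range (s.sup Prod.snd + 1)).filter
    (fun j => ∃ i, (i, j) ∈ s ∧ R (i, j) = v)).card

/-- `ceq(R) i` = number of boxes of row `i` whose entry equals the entry just below. -/
def ceqOn (s : Finset Cell) (R : Cell → ℕ) (i : ℕ) : ℕ :=
  (s.filter (fun c => c.1 = i ∧ (c.1 + 1, c.2) ∈ s ∧ R c = R (c.1 + 1, c.2))).card

/-- The dual stable Grothendieck polynomial `g_ν(x_1,…,x_n)`. -/
def gDual (n : ℕ) (sh : Finset Cell) : XPoly n :=
  ∑ᶠ R : {R : Cell → ℕ // IsRPPOn sh R ∧ ∀ c ∈ sh, R c ≤ n},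
    ∏ i : Fin n, MvPolynomial.X i ^ wtRPP sh R.1 ((i : ℕ) + 1)

/-- The flagged refined dual stable Grothendieck polynomial
`g_{λ/μ}(X_Φ; t) = Σ_R t^{ceq R} x^{wt R}`. -/
def gFlagged (n : ℕ) (s : Finset Cell) (Φ : ℕ → ℕ) : XTPoly n :=
  ∑ᶠ R : {R : Cell → ℕ // IsRPPOn s R ∧ RespectsFlagS s Φ R},
    tMono n (ceqOn s R.1) * ∏ i : Fin n, MvPolynomial.X i ^ wtRPP s R.1 ((i : ℕ) + 1)

/-- A cell is circled in an RPP: topmost occurrence of its letter in its column. -/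
def rppCircled (s : Finset Cell) (R : Cell → ℕ) (c : Cell) : Prop :=
  c ∈ s ∧ (c.1 = 0 ∨ (c.1 - 1, c.2) ∉ s ∨ R (c.1 - 1, c.2) ≠ R c)

/-- The reading word `w(R)` of an RPP: circled entries, bottom row up, left to right. -/
def rppReadingWord (s : Finset Cell) (R : Cell → ℕ) : List ℕ :=
  ((List.range (s.sup Prod.fst + 1)).reverse.map (fun i =>
    ((rowList s i).filter (fun j => decide (rppCircled s R (i, j)))).map
      (fun j => R (i, j)))).flatten

/-- The row reading word `r_T` of an RPP: omit entries equal to the entry just below,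
read rows bottom to top, left to right. -/
def rppRowWord (s : Finset Cell) (R : Cell → ℕ) : List ℕ :=
  ((List.range (s.sup Prod.fst + 1)).reverse.map (fun i =>
    ((rowList s i).filter (fun j => decide ((i + 1, j) ∉ s ∨ R (i + 1, j) ≠ R (i, j)))).map
      (fun j => R (i, j)))).flatten

/-- The height word `h(T)`: the (1-indexed) row numbers of the letters of `r_T`. -/
def rppHeights (s : Finset Cell) (R : Cell → ℕ) : List ℕ :=
  ((List.range (s.sup Prod.fst + 1)).reverse.map (fun i =>
    ((rowList s i).filter (fun j => decide ((i + 1, j) ∉ s ∨ R (i + 1, j) ≠ R (i, j)))).map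
      (fun _ => i + 1))).flatten

/-- minimum entry of a box. -/
def boxMin (A : Finset ℕ) : ℕ := sInf (A : Set ℕ)

/-- non-minimal entries of a box, largest first. -/
def boxExtras (A : Finset ℕ) : List ℕ :=
  ((List.range (A.sup id + 1)).filter (fun x => decide (x ∈ A ∧ x ≠ boxMin A))).reverse

/-- The reading word `w(S)` of a set-valued tableau: rows bottom to top; in each row
first the non-minimal entries, boxes right to left (largest to smallest within a box),
then the minimal entries, boxes left to right. -/
def svtReadingWord (s : Finset Cell) (T : Cell → Finset ℕ) : List ℕ :=
  ((List.range (s.sup Prod.fst + 1)).reverse.map (fun i =>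
    (((rowList s i).reverse.map (fun j => boxExtras (T (i, j)))).flatten) ++
      ((rowList s i).map (fun j => boxMin (T (i, j)))))).flatten

/-! ### The `*`-composition of shapes and tableaux -/

def minRowOf (s : Finset Cell) : ℕ := sInf (Prod.fst '' (s : Set Cell))
def minColOf (s : Finset Cell) : ℕ := sInf (Prod.snd '' (s : Set Cell))

def rowSpan (s : Finset Cell) : ℕ := if s = ∅ then 0 else s.sup Prod.fst + 1 - minRowOf s
def colSpan (s : Finset Cell) : ℕ := if s = ∅ then 0 else s.sup Prod.snd + 1 - minColOf s

def rowOffset (shapes : List (Finset Cell)) (i : ℕ) : ℕ := ((shapes.take i).map rowSpan).sum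
def colOffset (shapes : List (Finset Cell)) (i : ℕ) : ℕ :=
  ((shapes.drop (i + 1)).map colSpan).sum

def embedCell (shapes : List (Finset Cell)) (i : ℕ) (c : Cell) : Cell :=
  (rowOffset shapes i + (c.1 - minRowOf (shapes.getD i ∅)),
   colOffset shapes i + (c.2 - minColOf (shapes.getD i ∅)))

def unembedCell (shapes : List (Finset Cell)) (i : ℕ) (c : Cell) : Cell :=
  (c.1 - rowOffset shapes i + minRowOf (shapes.getD i ∅),
   c.2 - colOffset shapes i + minColOf (shapes.getD i ∅))

/-- `θ_k * ⋯ * θ_1` (the list is ordered from the top component down). -/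
def compositeShape (shapes : List (Finset Cell)) : Finset Cell :=
  (Finset.range shapes.length).biUnion (fun i => (shapes.getD i ∅).image (embedCell shapes i))

/-- `T_k * ⋯ * T_1`. -/
def compositeTab (shapes : List (Finset Cell)) (Ts : List (Cell → ℕ)) : Cell → ℕ :=
  fun c => ∑ i ∈ Finset.range shapes.length,
    if unembedCell shapes i c ∈ shapes.getD i ∅ ∧
        embedCell shapes i (unembedCell shapes i c) = c
    then Ts.getD i (fun _ => 0) (unembedCell shapes i c) else 0

/-- `φ_1 * ⋯ * φ_k`: concatenation of flags along the row blocks of the components. -/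
def compositeFlag (shapes : List (Finset Cell)) (flags : List (ℕ → ℕ)) : ℕ → ℕ :=
  fun r => ∑ i ∈ Finset.range shapes.length,
    if rowOffset shapes i ≤ r ∧ r < rowOffset shapes i + rowSpan (shapes.getD i ∅)
    then flags.getD i (fun _ => 0) (r - rowOffset shapes i) else 0

/-- `comps` is the list of connected components of `s`, from the top down. -/
def IsComponents (s : Finset Cell) (comps : List (Finset Cell)) : Prop :=
  (∀ c, c ∈ s ↔ ∃ i < comps.length, c ∈ comps.getD i ∅) ∧
  (∀ i, i < comps.length → (comps.getD i ∅).Nonempty) ∧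
  (∀ i, i < comps.length → ConnectedShape (comps.getD i ∅)) ∧
  (∀ i j, i < j → j < comps.length →
    ∀ c ∈ comps.getD i ∅, ∀ d ∈ comps.getD j ∅, c.1 < d.1) ∧
  (∀ i j, i < comps.length → j < comps.length → i ≠ j →
    ∀ c ∈ comps.getD i ∅, ∀ d ∈ comps.getD j ∅, ¬ Adj c d)

/-- Restrict a filling to a sub-shape. -/
def restrict (u : Finset Cell) (T : Cell → Finset ℕ) : Cell → Finset ℕ :=
  fun c => if c ∈ u then T c else ∅

/-! ### The Burge correspondence (interface) -/

structure BurgeOut where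
  sh : Finset Cell
  P : Cell → ℕ
  Q : Cell → ℕ

/-- The Burge correspondence: a bijection between biwords and pairs of semistandard
Young tableaux of the same partition shape, the insertion tableau `P` being Knuth
equivalent to the bottom word and the recording tableau `Q` having the content of the
top word. -/
structure BurgeData where
  out : List ℕ → List ℕ → BurgeOut
  shape_part : ∀ top bot, IsBiword top bot → IsPartitionShape (out top bot).sh
  ssytP : ∀ top bot, IsBiword top bot → IsSSYTOn (out top bot).sh (out top bot).P
  ssytQ : ∀ top bot, IsBiword top bot → IsSSYTOn (out top bot).sh (out top bot).Q
  knuthP : ∀ top bot, IsBiword top bot →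
    KnuthEquiv (readingWordOn (out top bot).sh (out top bot).P) bot
  contentP : ∀ top bot, IsBiword top bot →
    ∀ v, wtS (out top bot).sh (out top bot).P v = bot.count v
  contentQ : ∀ top bot, IsBiword top bot →
    ∀ v, wtS (out top bot).sh (out top bot).Q v = top.count v
  inj : ∀ top bot top' bot', IsBiword top bot → IsBiword top' bot' →
    out top bot = out top' bot' → top = top' ∧ bot = bot'
  surj : ∀ (sh : Finset Cell) (P Q : Cell → ℕ), IsPartitionShape sh →
    IsSSYTOn sh P → IsSSYTOn sh Q →
    ∃ top bot, IsBiword top bot ∧ out top bot = ⟨sh, P, Q⟩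

/-! ### The Chan–Pflueger skew set-valued row insertion (interface) -/

structure CPOut where
  sTil : Finset Cell
  Q : Cell → ℕ
  Til : Cell → ℕ

/-- The conditions satisfied by the output `(θ̃, Q'', T̃)` of the Chan–Pflueger
insertion applied to a set-valued tableau of connected skew shape `s` with excess `e`. -/
def CPTarget (n : ℕ) (s : Finset Cell) (e : ℕ → ℕ) (o : CPOut) : Prop :=
  s ⊆ o.sTil ∧ IsSkewShape o.sTil ∧ ConnectedShape o.sTil ∧
  (∀ c ∈ o.sTil, ∃ r, (r, c.2) ∈ s) ∧
  (∀ c ∈ o.sTil, c ∉ s → ∃ r, r < c.1 ∧ (r, c.2) ∈ s) ∧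
  IsRevRowStrictOn (o.sTil \ s) o.Q ∧ IsRowBounded (o.sTil \ s) o.Q ∧
  (∀ r, wtS (o.sTil \ s) o.Q (r + 1) = e r) ∧
  IsSSYTOn o.sTil o.Til ∧ (∀ c ∈ o.sTil, o.Til c ≤ n)

/-- Interface for the Chan–Pflueger skew set-valued row insertion (Algorithm 3.12 of
Chan–Pflueger): for each set-valued tableau `T` of connected skew shape `s` it
produces the final output `out s T = (θ̃, Q'', T̃)` together with the full sequence of
intermediate set-valued tableaux `steps s T`, each step adding one box. -/
structure CPData (n : ℕ) where
  out : Finset Cell → (Cell → Finset ℕ) → CPOut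
  steps : Finset Cell → (Cell → Finset ℕ) → List (Finset Cell × (Cell → Finset ℕ))
  valid : ∀ s T, IsSkewShape s → ConnectedShape s → IsSVTOn n s T →
    CPTarget n s (exRow s T) (out s T) ∧
    (∀ v, wtS (out s T).sTil (out s T).Til v = wtOn s T v)
  steps_first : ∀ s T, IsSkewShape s → ConnectedShape s → IsSVTOn n s T →
    (steps s T).head? = some (s, T)
  steps_last : ∀ s T, IsSkewShape s → ConnectedShape s → IsSVTOn n s T →
    (steps s T).getLast? = some ((out s T).sTil, svtOf (out s T).Til)
  steps_svt : ∀ s T, IsSkewShape s → ConnectedShape s → IsSVTOn n s T →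
    ∀ p ∈ steps s T, IsSVTOn n p.1 p.2
  steps_len : ∀ s T, IsSkewShape s → ConnectedShape s → IsSVTOn n s T →
    (steps s T).length = exTotal s T + 1
  steps_add : ∀ s T, IsSkewShape s → ConnectedShape s → IsSVTOn n s T →
    ∀ j, j + 1 < (steps s T).length →
      ((steps s T).getD j (∅, fun _ => ∅)).1 ⊆ ((steps s T).getD (j + 1) (∅, fun _ => ∅)).1 ∧
      (((steps s T).getD (j + 1) (∅, fun _ => ∅)).1 \
        ((steps s T).getD j (∅, fun _ => ∅)).1).card = 1
  bij : ∀ s, IsSkewShape s → ConnectedShape s → ∀ (e : ℕ → ℕ) (o : CPOut),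
    CPTarget n s e o →
    ∃! T : {T : Cell → Finset ℕ // IsSVTOn n s T ∧ ∀ r, exRow s T r = e r}, out s T.1 = o

/-- The rows (0-indexed) of the boxes added at the successive steps of the insertion. -/
def addedRows (n : ℕ) (cp : CPData n) (s : Finset Cell) (T : Cell → Finset ℕ) : List ℕ :=
  (List.range ((cp.steps s T).length - 1)).map (fun j =>
    ((((cp.steps s T).getD (j + 1) (∅, fun _ => ∅)).1 \
      (((cp.steps s T).getD j (∅, fun _ => ∅)).1)).sup Prod.fst))

/-- The sequence of flags `Φ^{(j)}`: when a box is added in (0-indexed) row `r`, the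
flag value of row `r` is replaced by the flag value of row `r - 1`. -/
def flagSeq (Φ : ℕ → ℕ) (ks : List ℕ) : ℕ → (ℕ → ℕ)
  | 0 => Φ
  | j + 1 => fun r => if r = ks.getD j 0 then flagSeq Φ ks j (r - 1) else flagSeq Φ ks j r

/-- The flag `Φ̃` induced by the insertion of `T`. -/
def inducedFlag (n : ℕ) (cp : CPData n) (s : Finset Cell) (T : Cell → Finset ℕ)
    (Φ : ℕ → ℕ) : ℕ → ℕ :=
  flagSeq Φ (addedRows n cp s T) (addedRows n cp s T).length

/-! ### Compatible tableaux for SVT -/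

def compTilShapes (n : ℕ) (cp : CPData n) (comps : List (Finset Cell))
    (T : Cell → Finset ℕ) : List (Finset Cell) :=
  comps.map (fun θ => (cp.out θ (restrict θ T)).sTil)

def compTilQs (n : ℕ) (cp : CPData n) (comps : List (Finset Cell))
    (T : Cell → Finset ℕ) : List (Cell → ℕ) :=
  comps.map (fun θ => (cp.out θ (restrict θ T)).Q)

def compTilTabs (n : ℕ) (cp : CPData n) (comps : List (Finset Cell))
    (T : Cell → Finset ℕ) : List (Cell → ℕ) :=
  comps.map (fun θ => (cp.out θ (restrict θ T)).Til)

/-- The composite shape `σ = σ_k * ⋯ * σ_1` of the insertion outputs. -/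
def insShape (n : ℕ) (cp : CPData n) (comps : List (Finset Cell))
    (T : Cell → Finset ℕ) : Finset Cell :=
  compositeShape (compTilShapes n cp comps T)

/-- The composite tableau `T̃ = T̃_k * ⋯ * T̃_1` of the insertion outputs. -/
def insTab (n : ℕ) (cp : CPData n) (comps : List (Finset Cell))
    (T : Cell → Finset ℕ) : Cell → ℕ :=
  compositeTab (compTilShapes n cp comps T) (compTilTabs n cp comps T)

/-- The restriction of a global flag to the row block of the `i`-th component. -/
def componentFlag (comps : List (Finset Cell)) (Φ : ℕ → ℕ) (i : ℕ) : ℕ → ℕ :=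
  fun r => Φ (rowOffset comps i + (r - minRowOf (comps.getD i ∅)))

/-- The composite induced flag `Φ̃ = Φ̃_1 * ⋯ * Φ̃_k`. -/
def insFlag (n : ℕ) (cp : CPData n) (comps : List (Finset Cell))
    (T : Cell → Finset ℕ) (Φ : ℕ → ℕ) : ℕ → ℕ :=
  compositeFlag (compTilShapes n cp comps T)
    ((List.range comps.length).map (fun i => fun p =>
      inducedFlag n cp (comps.getD i ∅) (restrict (comps.getD i ∅) T)
        (componentFlag comps Φ i) (minRowOf (comps.getD i ∅) + p)))

/-- The Burge correspondence applied to `⌊b(σ); r_{T̃}⌋`. -/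
def insBurge (n : ℕ) (B : BurgeData) (cp : CPData n) (comps : List (Finset Cell))
    (T : Cell → Finset ℕ) : BurgeOut :=
  B.out (bwordOn (insShape n cp comps T))
    (readingWordOn (insShape n cp comps T) (insTab n cp comps T))

/-- `p = (sh, rect(P̃), R)` arises from a highest weight element `P` of
`SVT(λ/μ, Φ)` of excess `e`; `R = p.Q` is then a `(λ/μ, Φ)`-compatible tableau
for SVT with `ex(R) = e`. -/
def IsCompatibleSVT (n : ℕ) (B : BurgeData) (cp : CPData n) (s : Finset Cell)
    (comps : List (Finset Cell)) (Φ : ℕ → ℕ) (e : ℕ → ℕ) (p : BurgeOut) : Prop :=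
  ∃ P : Cell → Finset ℕ, IsSVTOn n s P ∧ RespectsFlag Φ P ∧ HighestWeight n P ∧
    (∀ r, exRow s P r = e r) ∧ insBurge n B cp comps P = p

/-- Compatible of arbitrary excess. -/
def IsCompatibleSVT' (n : ℕ) (B : BurgeData) (cp : CPData n) (s : Finset Cell)
    (comps : List (Finset Cell)) (Φ : ℕ → ℕ) (p : BurgeOut) : Prop :=
  ∃ P : Cell → Finset ℕ, IsSVTOn n s P ∧ RespectsFlag Φ P ∧ HighestWeight n P ∧
    insBurge n B cp comps P = p

/-- The set `SVT_e(θ, Φ; θ̃, Q'')`. -/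
def PieceSet (n : ℕ) (cp : CPData n) (s : Finset Cell) (comps : List (Finset Cell))
    (Φ e : ℕ → ℕ) (tilShapes : List (Finset Cell)) (Qs : List (Cell → ℕ)) :
    Set (Cell → Finset ℕ) :=
  {T | IsSVTOn n s T ∧ RespectsFlag Φ T ∧ (∀ r, exRow s T r = e r) ∧
       compTilShapes n cp comps T = tilShapes ∧ compTilQs n cp comps T = Qs}

/-- The set `A(R, ν, Ψ)` of flagged tableaux of shape `ν` whose Burge pair is
`(rect(T), R)`. -/
def ASet (n : ℕ) (B : BurgeData) (sTil : Finset Cell) (Ψflag : ℕ → ℕ) (R : BurgeOut) :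
    Set (Cell → ℕ) :=
  {U | IsSSYTOn sTil U ∧ (∀ c ∈ sTil, U c ≤ n) ∧ RespectsFlagS sTil Ψflag U ∧
       (B.out (bwordOn sTil) (readingWordOn sTil U)).sh = R.sh ∧
       (B.out (bwordOn sTil) (readingWordOn sTil U)).Q = R.Q}

/-! ### Left keys and the Reiner–Shimozono flag compression (interfaces) -/

def colSetOf (sh : Finset Cell) (K : Cell → ℕ) (j : ℕ) : Set ℕ :=
  {v | ∃ i, (i, j) ∈ sh ∧ K (i, j) = v}

/-- A key tableau: the entries of each column contain those of the next column. -/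
def IsKeyTab (sh : Finset Cell) (K : Cell → ℕ) : Prop :=
  IsSSYTOn sh K ∧ ∀ j, colSetOf sh K (j + 1) ⊆ colSetOf sh K j

/-- Interface providing the left key `K₋(R)` of a semistandard Young tableau. -/
structure LeftKeyData where
  lk : Finset Cell → (Cell → ℕ) → (Cell → ℕ)
  key : ∀ sh R, IsPartitionShape sh → IsSSYTOn sh R → IsKeyTab sh (lk sh R)
  knuth : ∀ sh R, IsPartitionShape sh → IsSSYTOn sh R →
    ∀ v, wtS sh (lk sh R) v ≤ wtS sh R v + wtS sh R v + 1  -- (weakly specified)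

/-- `β(R)`: the weight of the left key of the recording tableau `R = p.Q`. -/
def betaOf (L : LeftKeyData) (p : BurgeOut) : ℕ → ℕ :=
  fun r => wtS p.sh (L.lk p.sh p.Q) (r + 1)

/-- concatenation of the factors `v^{(n)} ⋯ v^{(1)}` (factor `n-1` first, 0-indexed). -/
def wordOfFactors (n : ℕ) (v : ℕ → List ℕ) : List ℕ :=
  ((List.range n).reverse.map v).flatten

/-- The set `𝒲(α, Φ)` of Reiner–Shimozono: words `v = v^{(n)} ⋯ v^{(1)}` into maximal
row words of lengths `α_i`, letters of `v^{(i)}` at most `Φ_i`, whose Burge recording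
tableau for the biword `⌊b(α); v⌋` is `key(α)` (the unique SSYT of shape `α†` and
weight `α`). -/
def WSet (n : ℕ) (B : BurgeData) (α : ℕ → ℕ) (Φ : ℕ → ℕ) : Set (ℕ → List ℕ) :=
  {v | (∀ i, n ≤ i → v i = []) ∧
       (∀ i, (v i).length = α i) ∧
       (∀ i, (v i).Chain' (· ≤ ·)) ∧
       (∀ i, ∀ x ∈ v i, 1 ≤ x ∧ x ≤ Φ i) ∧
       (∀ i i', i' < i → v i ≠ [] → v i' ≠ [] →
          (∀ m, i' < m → m < i → v m = []) → (v i').headI < (v i).getLastD 0) ∧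
       (∀ r, rowLenOf (B.out (bwordComp n α) (wordOfFactors n v)).sh r = dsort n α r) ∧
       (∀ u, wtS (B.out (bwordComp n α) (wordOfFactors n v)).sh
               (B.out (bwordComp n α) (wordOfFactors n v)).Q u =
             if 1 ≤ u ∧ u ≤ n then α (u - 1) else 0)}

/-- Interface for the Reiner–Shimozono flag compression `β ↦ β̂` (relative to a flag):
`β̂† = β†` and there is a Knuth-equivalence-preserving bijection
`ζ : 𝒲(β, Φ) → 𝒲(β̂, Φ₀)`. -/
structure RSHatData (n : ℕ) (B : BurgeData) where
  hat : (ℕ → ℕ) → (ℕ → ℕ) → (ℕ → ℕ)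
  sorted : ∀ α Φ, IsFlag n Φ → ∀ i, dsort n (hat α Φ) i = dsort n α i
  zeta : ∀ α Φ, IsFlag n Φ → (WSet n B α Φ).Nonempty →
    ∃ ζ : (ℕ → List ℕ) → (ℕ → List ℕ),
      Set.BijOn ζ (WSet n B α Φ) (WSet n B (hat α Φ) (fun i => i + 1)) ∧
      ∀ v ∈ WSet n B α Φ, KnuthEquiv (wordOfFactors n v) (wordOfFactors n (ζ v))

/-! ### Compatible tableaux for RPP -/

/-- `(q, T')` witnesses that `q.Q` is a `(λ/μ, Φ)`-compatible tableau for RPP: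
`T'` is the unique flagged RPP of shape `s` with Yamanouchi row reading word whose
Burge recording tableau (for the biword `⌊h(T'); r_{T'}⌋`) is `q.Q`; and
`ceq(q.Q) := ceq(T')`. -/
def IsCompatibleRPP (n : ℕ) (B : BurgeData) (s : Finset Cell) (Φ : ℕ → ℕ)
    (q : BurgeOut) (T' : Cell → ℕ) : Prop :=
  (IsRPPOn s T' ∧ RespectsFlagS s Φ T' ∧ IsYamanouchi (rppRowWord s T') ∧
    B.out (rppHeights s T') (rppRowWord s T') = q) ∧
  (∀ T'' : Cell → ℕ,
    (IsRPPOn s T'' ∧ RespectsFlagS s Φ T'' ∧ IsYamanouchi (rppRowWord s T'') ∧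
      (B.out (rppHeights s T'') (rppRowWord s T'')).Q = q.Q) → T'' = T')

section Part1
attribute [-instance] Classical.propDecidable
section Alg

/-- bialternant-type numerator. -/
def DD {A : Type*} [CommRing A] (β : A) (n : ℕ) (l : Fin n → ℕ) (x : Fin n → A) : A :=
  Matrix.det (Matrix.of fun i j : Fin n =>
    x j ^ (l i + (Fin.rev i : ℕ)) * (1 - β * x j) ^ (i : ℕ))

def VV {A : Type*} [CommRing A] (n : ℕ) (x : Fin n → A) : A :=
  ∏ i : Fin n, ∏ j ∈ Finset.Ioi i, (x i - x j)

variable {A : Type*} [CommRing A]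

theorem VV_cons (n : ℕ) (c : A) (x : Fin n → A) :
    VV (n+1) (Fin.cons c x) = (∏ l, (c - x l)) * VV n x := by
  unfold VV
  rw [Fin.prod_univ_succ]
  congr 1
  · rw [Fin.Ioi_zero_eq_map, Finset.prod_map]
    simp
  · refine Finset.prod_congr rfl fun i _ => ?_
    rw [← Fin.map_succEmb_Ioi, Finset.prod_map]
    simp

theorem VV_snoc (n : ℕ) (x : Fin n → A) (y : A) :
    VV (n+1) (Fin.snoc x y) = (∏ l, (x l - y)) * VV n x := by
  unfold VV
  rw [Fin.prod_univ_castSucc]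
  have : Finset.Ioi (Fin.last n) = ∅ := by
    ext a; simp [Fin.le_last]
  rw [this, Finset.prod_empty, mul_one, ← Finset.prod_mul_distrib]
  refine Finset.prod_congr rfl fun i _ => ?_
  have h2 : Finset.Ioi (Fin.castSucc i) = insert (Fin.last n) ((Finset.Ioi i).map Fin.castSuccEmb) := by
    ext a
    refine Fin.lastCases ?_ (fun b => ?_) a
    · simp [Fin.castSucc_lt_last]
    · simp [Fin.le_last]
  rw [h2, Finset.prod_insert, Finset.prod_map]
  · simp
  · simp

/-- 1d -/
theorem DD_laplace (n : ℕ) (l : Fin (n+1) → ℕ) (x : Fin (n+1) → A) :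
    DD 1 (n+1) l x = ∑ j : Fin (n+1), (-1)^(j:ℕ) * x j ^ (l 0 + n) *
      (∏ k : Fin n, (1 - x (j.succAbove k))) * DD 1 n (fun i => l i.succ) (fun k => x (j.succAbove k)) := by
  unfold DD
  rw [Matrix.det_succ_row_zero]
  refine Finset.sum_congr rfl fun j _ => ?_
  simp only [Matrix.of_apply, Fin.val_zero, pow_zero, mul_one, Fin.rev_zero, Fin.val_last]
  rw [mul_assoc, mul_assoc ((-1)^(j:ℕ) * _), ← Matrix.det_mul_row, ← mul_assoc]
  congr 2
  ext i k
  simp only [Matrix.submatrix_apply, Matrix.of_apply, Fin.rev_succ, Fin.val_castSucc, Fin.val_succ]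
  ring

/-- 1e -/
theorem DD_one_cons (n : ℕ) (l : Fin (n+1) → ℕ) (x : Fin (n+1) → A) :
    ∑ j : Fin (n+1), (-1)^(j:ℕ) * x j ^ (l 0 + n) *
      DD 0 (n+1) l (Fin.cons 1 (fun k => x (j.succAbove k))) = DD 0 (n+1) l x := by
  let M : Matrix (Fin (n+2)) (Fin (n+2)) A := Matrix.of
    (Fin.cons (Fin.cons 0 (fun j => x j ^ (l 0 + n)))
      (fun i => Fin.cons 1 (fun j => x j ^ (l i + (Fin.rev i : ℕ)))))
  have h1 : M.det = - ∑ j : Fin (n+1), (-1)^(j:ℕ) * x j ^ (l 0 + n) *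
      DD 0 (n+1) l (Fin.cons 1 (fun k => x (j.succAbove k))) := by
    rw [Matrix.det_succ_row_zero, Fin.sum_univ_succ]
    simp only [M, Matrix.of_apply, Fin.cons_zero, mul_zero, zero_mul, zero_add, Fin.cons_succ]
    rw [← Finset.sum_neg_distrib]
    refine Finset.sum_congr rfl fun j _ => ?_
    rw [Fin.val_succ, pow_succ]
    have : (Matrix.submatrix M Fin.succ (Fin.succAbove j.succ)).det =
        DD 0 (n+1) l (Fin.cons 1 (fun k => x (j.succAbove k))) := by
      unfold DD
      congr 1
      ext i k
      refine Fin.cases ?_ (fun k => ?_) k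
      · simp [M]
      · simp [M]
    rw [← this]
    ring
  have h2 : M.det = - DD 0 (n+1) l x := by
    rw [← Matrix.det_updateRow_add_smul_self M (i := 0) (j := 1) (by simp) (-1)]
    rw [Matrix.det_succ_row_zero, Fin.sum_univ_succ, Finset.sum_eq_zero]
    · have : ((M.updateRow 0 (M 0 + (-1:A) • M 1)).submatrix Fin.succ (Fin.succAbove 0)).det =
        DD 0 (n+1) l x := by
        unfold DD
        congr 1
        ext i k
        simp [M]
      rw [this]
      have : M 1 0 = 1 := rfl
      have h0 : M 0 0 = 0 := rfl
      simp [this, h0]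
    · intro i _
      have h0 : M 0 i.succ = x i ^ (l 0 + n) := rfl
      have : M 1 i.succ = x i ^ (l 0 + n) := by
        have : M 1 i.succ = x i ^ (l 0 + (Fin.rev (0 : Fin (n+1)) : ℕ)) := rfl
        rw [this]; simp
      simp [this, h0]
  rw [h1] at h2
  exact neg_injective h2

def SS (β y t : A) (a b : ℕ) : A :=
  ∑ m ∈ Finset.Icc b a, y^(a-m) * (if b < m then 1 - β*y else 1) * t^m

theorem SS_aux (β y t : A) (b k : ℕ) :
    (t - y) * SS β y t (b+k) b = t^b * ((1-β*y)*t^(k+1) - y^(k+1)*(1-β*t)) := by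
  induction k with
  | zero => simp [SS]; ring
  | succ k ih =>
    have : SS β y t (b+(k+1)) b = y * SS β y t (b+k) b + (1-β*y)*t^(b+k+1) := by
      unfold SS
      rw [← add_assoc, ← Finset.insert_Icc_right_eq_Icc_add_one (by omega), Finset.sum_insert (by simp), Finset.mul_sum, add_comm]
      congr 1
      · refine Finset.sum_congr rfl fun m hm => ?_
        rw [Finset.mem_Icc] at hm
        rw [show b+k+1-m = (b+k-m)+1 by omega]; ring
      · simp
    rw [this, mul_add, mul_left_comm, ih]; ring

theorem DD_branch_aux (β : A) (n : ℕ) (l : Fin (n+1) → ℕ) (hl : ∀ i : Fin n, l i.succ ≤ l i.castSucc)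
    (x : Fin n → A) (y : A) :
    (1-β*y)^n * DD β (n+1) l (Fin.snoc x y) = (1-β*y)^n * ((∏ j, (x j - y)) * y^(l (Fin.last n)) *
      ∑ m ∈ Fintype.piFinset (fun i : Fin n => Finset.Icc (l i.succ) (l i.castSucc)),
        (∏ i, (y^(l i.castSucc - m i) * (if l i.succ < m i then 1-β*y else 1))) * DD β n m x) := by
  let F : Fin (n+1) → A → A := fun i t => t ^ (l i + (Fin.rev i : ℕ)) * (1 - β * t) ^ (i : ℕ)
  let S : Fin n → A → A := fun i t => ∑ m ∈ Finset.Icc (l i.succ) (l i.castSucc),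
    (y^(l i.castSucc - m) * (if l i.succ < m then 1-β*y else 1)) *
      (t ^ (m + (Fin.rev i : ℕ)) * (1 - β * t) ^ (i : ℕ))
  have hS : ∀ i t, (t - y) * S i t = (1-β*y) * F i.castSucc t
      - y^(l i.castSucc - l i.succ + 1) * F i.succ t := by
    intro i t
    obtain ⟨k, hk⟩ := Nat.exists_eq_add_of_le (hl i)
    have h := SS_aux β y t (l i.succ) k
    have e : S i t = SS β y t (l i.succ + k) (l i.succ) * (t ^ (Fin.rev i : ℕ) * (1 - β * t) ^ (i : ℕ)) := by
      simp only [S, SS, hk, Finset.sum_mul]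
      refine Finset.sum_congr rfl fun m hm => ?_
      ring
    rw [e, ← mul_assoc, h]
    simp only [F, hk, Fin.rev_castSucc, Fin.rev_succ, Fin.val_succ, Fin.val_castSucc]
    rw [show l i.succ + k - l i.succ = k by omega]
    ring
  let L : Matrix (Fin (n+1)) (Fin (n+1)) A := Matrix.of fun i j =>
    Fin.lastCases (motive := fun _ => A) (if j = Fin.last n then 1 else 0)
      (fun i => if j = i.castSucc then (1-β*y) else if j = i.succ then
        - y^(l i.castSucc - l i.succ + 1) else 0) i
  let M : Matrix (Fin (n+1)) (Fin (n+1)) A := Matrix.of fun i j => F i ((Fin.snoc x y : Fin (n+1) → A) j)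
  have hM : M.det = DD β (n+1) l (Fin.snoc x y) := rfl
  have hL : L.det = (1-β*y)^n := by
    rw [Matrix.det_of_isUpperTriangular]
    · rw [Fin.prod_univ_castSucc]; simp [L]
    · intro i j hij
      simp only [id] at hij
      revert hij
      refine Fin.lastCases ?_ (fun i => ?_) i
      · intro h; simp only [L, Matrix.of_apply, Fin.lastCases_last]; rw [if_neg h.ne]
      · intro h
        simp only [L, Matrix.of_apply, Fin.lastCases_castSucc]
        have h2 : j < i.succ := lt_trans h Fin.castSucc_lt_succ
        rw [if_neg h.ne, if_neg h2.ne]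
  have hrow : ∀ (i : Fin n) j, (L * M) i.castSucc j =
      ((Fin.snoc x y : Fin (n+1) → A) j - y) * S i ((Fin.snoc x y : Fin (n+1) → A) j) := by
    intro i j
    rw [hS, Matrix.mul_apply]
    have : ∀ k, L i.castSucc k * M k j = (if k = i.castSucc then (1-β*y) * M k j else 0) +
      (if k = i.succ then - y^(l i.castSucc - l i.succ + 1) * M k j else 0) := by
      intro k
      simp only [L, Matrix.of_apply, Fin.lastCases_castSucc]
      by_cases h1 : k = i.castSucc
      · have : k ≠ i.succ := by rw [h1]; exact (Fin.castSucc_lt_succ).ne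
        rw [if_pos h1, if_pos h1, if_neg this, add_zero]
      · rw [if_neg h1, if_neg h1]; split_ifs <;> simp
    simp only [this, Finset.sum_add_distrib, Finset.sum_ite_eq', Finset.mem_univ, if_true]
    simp only [M, Matrix.of_apply]
    ring
  have hlast : ∀ j, (L * M) (Fin.last n) j = F (Fin.last n) ((Fin.snoc x y : Fin (n+1) → A) j) := by
    intro j
    rw [Matrix.mul_apply]
    simp [L, M]
  have hdet : (L*M).det = F (Fin.last n) y * ((∏ j, (x j - y)) *
      Matrix.det (Matrix.of fun i j : Fin n => S i (x j))) := by
    rw [Matrix.det_succ_column _ (Fin.last n), Fin.sum_univ_castSucc, Finset.sum_eq_zero, zero_add]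
    · rw [hlast, Fin.snoc_last, ← Matrix.det_mul_row]
      have : (-1:A) ^ ((Fin.last n : ℕ) + (Fin.last n : ℕ)) = 1 := by
        rw [← two_mul, pow_mul]; simp
      rw [this, one_mul]
      congr 2
      ext i j
      simp only [Matrix.submatrix_apply, Fin.succAbove_last, hrow, Fin.snoc_castSucc, Matrix.of_apply]
    · intro i _
      rw [hrow]; simp
  rw [Matrix.det_mul, hL, hM] at hdet
  rw [hdet]
  have hexp : Matrix.det (Matrix.of fun i j : Fin n => S i (x j)) =
      ∑ m ∈ Fintype.piFinset (fun i : Fin n => Finset.Icc (l i.succ) (l i.castSucc)),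
        (∏ i, (y^(l i.castSucc - m i) * (if l i.succ < m i then 1-β*y else 1))) * DD β n m x := by
    have := (Matrix.detRowAlternating (n := Fin n) (R := A)).toMultilinearMap.map_sum_finset
      (fun (i : Fin n) (m : ℕ) => (fun j : Fin n => (y^(l i.castSucc - m) * (if l i.succ < m then 1-β*y else 1)) *
      (x j ^ (m + (Fin.rev i : ℕ)) * (1 - β * x j) ^ (i : ℕ)))) (fun i : Fin n => Finset.Icc (l i.succ) (l i.castSucc))
    have e : (fun i : Fin n => ∑ m ∈ Finset.Icc (l i.succ) (l i.castSucc), (fun j : Fin n => (y^(l i.castSucc - m) * (if l i.succ < m then 1-β*y else 1)) *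
      (x j ^ (m + (Fin.rev i : ℕ)) * (1 - β * x j) ^ (i : ℕ)))) = fun i j => S i (x j) := by
      funext i j
      simp only [S, Finset.sum_apply]
    rw [e] at this
    refine Eq.trans this ?_
    refine Finset.sum_congr rfl fun m _ => ?_
    unfold DD
    rw [← Matrix.det_mul_column]
    rfl
  rw [hexp]
  simp only [F, Fin.rev_last, Fin.val_zero, add_zero, Fin.val_last]
  ring

theorem DD_branch [IsDomain A] (β : A) (n : ℕ) (l : Fin (n+1) → ℕ) (hl : ∀ i : Fin n, l i.succ ≤ l i.castSucc)
    (x : Fin n → A) (y : A) (hy : 1 - β*y ≠ 0) :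
    DD β (n+1) l (Fin.snoc x y) = (∏ j, (x j - y)) * y^(l (Fin.last n)) *
      ∑ m ∈ Fintype.piFinset (fun i : Fin n => Finset.Icc (l i.succ) (l i.castSucc)),
        (∏ i, (y^(l i.castSucc - m i) * (if l i.succ < m i then 1-β*y else 1))) * DD β n m x :=
  mul_left_cancel₀ (pow_ne_zero n hy) (DD_branch_aux β n l hl x y)

theorem DD_zero (β : A) (l : Fin 0 → ℕ) (x : Fin 0 → A) : DD β 0 l x = 1 := by simp [DD]
theorem VV_zero (x : Fin 0 → A) : VV 0 x = 1 := by simp [VV]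
theorem VV_ne_zero [IsDomain A] (n : ℕ) (x : Fin n → A) (hx : Function.Injective x) : VV n x ≠ 0 := by
  unfold VV
  refine Finset.prod_ne_zero_iff.2 fun i _ => Finset.prod_ne_zero_iff.2 fun j hj => ?_
  rw [sub_ne_zero]
  intro h
  rw [Finset.mem_Ioi] at hj
  exact hj.ne (hx h)
end Alg
end Part1

section Part2
attribute [-instance] Classical.propDecidable
attribute [local instance 10] Classical.propDecidable

theorem exists_cut (p : ℕ → Prop) (K : ℕ) (hK : ∀ j, p j → j < K) (hd : ∀ j, p (j+1) → p j) :
    ∃ M, M ≤ K ∧ ∀ j, p j ↔ j < M := by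
  induction K with
  | zero => exact ⟨0, le_rfl, fun j => ⟨fun h => hK j h, fun h => absurd h (by omega)⟩⟩
  | succ K ih =>
    by_cases hp : p K
    · refine ⟨K+1, le_rfl, fun j => ⟨hK j, fun h => ?_⟩⟩
      have hj : j ≤ K := by omega
      induction hj using Nat.decreasingInduction with
      | self => exact hp
      | of_succ k hk ih2 => exact hd k (ih2 (by omega))
    · obtain ⟨M, h1, h2⟩ := ih (fun j h => by
        have := hK j h
        rcases Nat.lt_succ_iff_lt_or_eq.1 this with h3 | h3
        · exact h3
        · subst h3; exact absurd h hp)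
      exact ⟨M, by omega, h2⟩

theorem wtOn_card (s : Finset Cell) (T : Cell → Finset ℕ) (v : ℕ) :
    wtOn s T v = (s.filter (fun c => v ∈ T c)).card := by
  rw [Finset.card_filter]; unfold wtOn; congr!
theorem wtS_card (s : Finset Cell) (T : Cell → ℕ) (v : ℕ) :
    wtS s T v = (s.filter (fun c => T c = v)).card := by
  rw [Finset.card_filter]; unfold wtS; congr!

/-- shape with given row lengths -/
def shp (n : ℕ) (l : Fin n → ℕ) : Finset Cell :=
  (Finset.univ : Finset (Fin n)).biUnion (fun i => (Finset.range (l i)).image (fun j => ((i:ℕ), j)))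

theorem extendf_fin {n : ℕ} (l : Fin n → ℕ) (i : Fin n) : extendf n l i = l i := by
  simp [extendf]
theorem extendf_lt {n : ℕ} (l : Fin n → ℕ) {i : ℕ} (h : i < n) : extendf n l i = l ⟨i, h⟩ := by
  simp [extendf, h]
theorem extendf_ge {n : ℕ} (l : Fin n → ℕ) {i : ℕ} (h : n ≤ i) : extendf n l i = 0 := by
  simp [extendf, h]

theorem mem_shp {n : ℕ} {l : Fin n → ℕ} {c : Cell} : c ∈ shp n l ↔ c.2 < extendf n l c.1 := by
  simp only [shp, Finset.mem_biUnion, Finset.mem_univ, true_and, Finset.mem_image, Finset.mem_range]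
  constructor
  · rintro ⟨i, j, h, rfl⟩
    simpa [extendf_fin] using h
  · intro h
    by_cases hc : c.1 < n
    · rw [extendf_lt l hc] at h
      exact ⟨⟨c.1, hc⟩, c.2, h, rfl⟩
    · rw [extendf_ge l (by omega)] at h; omega

theorem card_shp {n : ℕ} (l : Fin n → ℕ) : (shp n l).card = ∑ i, l i := by
  unfold shp
  rw [Finset.card_biUnion]
  · refine Finset.sum_congr rfl fun i _ => ?_
    rw [Finset.card_image_of_injective _ (fun a b h => (Prod.ext_iff.1 h).2), Finset.card_range]
  · intro i _ j _ hij
    rw [Function.onFun, Finset.disjoint_left]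
    intro c hc hc'
    simp only [Finset.mem_image, Finset.mem_range] at hc hc'
    obtain ⟨a, _, rfl⟩ := hc
    obtain ⟨b, _, hb⟩ := hc'
    exact hij (Fin.ext (Prod.ext_iff.1 hb).1.symm)

theorem svt_finite (n : ℕ) (s : Finset Cell) : {T | IsSVTOn n s T}.Finite := by
  have : Finite (↥s → ↥((Finset.Icc 1 n).powerset)) := inferInstance
  refine Set.Finite.of_injOn (f := fun T => fun c : ↥s =>
    (if h : T c ⊆ Finset.Icc 1 n then ⟨T c, Finset.mem_powerset.2 h⟩ else ⟨∅, by simp⟩ :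
      ↥((Finset.Icc 1 n).powerset))) (t := Set.univ) (fun _ _ => Set.mem_univ _) ?_ Set.finite_univ
  intro T hT T' hT' h
  have key : ∀ T, IsSVTOn n s T → ∀ c, T c ⊆ Finset.Icc 1 n := by
    intro T hT c x hx
    exact Finset.mem_Icc.2 (hT.2.2.1 c x hx)
  funext c
  by_cases hc : c ∈ s
  · have := congrFun h ⟨c, hc⟩
    simp only [dif_pos (key T hT c), dif_pos (key T' hT' c)] at this
    exact congrArg Subtype.val this
  · rw [hT.2.1 c hc, hT'.2.1 c hc]

def svtF (n : ℕ) (s : Finset Cell) : Finset (Cell → Finset ℕ) := (svt_finite n s).toFinset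

theorem mem_svtF {n : ℕ} {s : Finset Cell} {T} : T ∈ svtF n s ↔ IsSVTOn n s T := by
  simp [svtF]

def Gsum {A : Type*} [CommRing A] (β : A) (n : ℕ) (s : Finset Cell) (x : Fin n → A) : A :=
  ∑ T ∈ svtF n s, (-β)^exTotal s T * ∏ i : Fin n, x i ^ wtOn s T ((i:ℕ)+1)

theorem sum_card_eq {n : ℕ} {s : Finset Cell} {T} (h : IsSVTOn n s T) :
    ∑ c ∈ s, (T c).card = ∑ v ∈ Finset.range n, wtOn s T (v+1) := by
  simp only [wtOn_card, Finset.card_filter]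
  rw [Finset.sum_comm]
  refine Finset.sum_congr rfl fun c _ => ?_
  rw [← Finset.card_filter]
  refine (Finset.card_bij (fun v _ => v+1) ?_ ?_ ?_).symm
  · intro v hv; simpa using (Finset.mem_filter.1 hv).2
  · intro a _ b _ h; simpa using h
  · intro b hb
    have := h.2.2.1 c b hb
    refine ⟨b-1, ?_, by omega⟩
    simp only [Finset.mem_filter, Finset.mem_range]
    rw [show b-1+1 = b by omega]
    exact ⟨by omega, hb⟩

theorem exTotal_eq {n : ℕ} {s : Finset Cell} {T} (h : IsSVTOn n s T) :
    exTotal s T = (∑ v ∈ Finset.range n, wtOn s T (v+1)) - s.card := by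
  unfold exTotal
  rw [sum_card_eq h]

theorem card_le_wt {n : ℕ} {s : Finset Cell} {T} (h : IsSVTOn n s T) :
    s.card ≤ ∑ v ∈ Finset.range n, wtOn s T (v+1) := by
  rw [← sum_card_eq h, Finset.card_eq_sum_ones]
  exact Finset.sum_le_sum fun c hc => Finset.card_pos.2 (h.1 c hc)

def bld (n : ℕ) (L M : ℕ → ℕ) (T' : Cell → Finset ℕ) (A : Finset ℕ) : Cell → Finset ℕ := fun c =>
  T' c ∪ (if (c.1 ∈ A ∧ c.2 + 1 = M c.1) ∨ (M c.1 ≤ c.2 ∧ c.2 < L c.1) then {n+1} else ∅)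

theorem mem_bld {n L M T' A} {c : Cell} {v : ℕ} : v ∈ bld n L M T' A c ↔
    v ∈ T' c ∨ (v = n+1 ∧ ((c.1 ∈ A ∧ c.2 + 1 = M c.1) ∨ (M c.1 ≤ c.2 ∧ c.2 < L c.1))) := by
  unfold bld
  rw [Finset.mem_union]
  split_ifs with h <;> simp [h]

section
variable {n : ℕ} {s s' : Finset Cell} {L M : ℕ → ℕ}

theorem bld_svt (hs : ∀ c : Cell, c ∈ s ↔ c.2 < L c.1) (hs' : ∀ c : Cell, c ∈ s' ↔ c.2 < M c.1)
    (h1 : ∀ i, L (i+1) ≤ M i) (h2 : ∀ i, M i ≤ L i)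
    {T' : Cell → Finset ℕ} (hT : IsSVTOn n s' T') {A : Finset ℕ} (hA : ∀ i ∈ A, L (i+1) < M i) :
    IsSVTOn (n+1) s (bld n L M T' A) := by
  obtain ⟨a1, a2, a3, a4, a5⟩ := hT
  refine ⟨?_, ?_, ?_, ?_, ?_⟩
  · intro c hc
    rw [hs] at hc
    by_cases h : c.2 < M c.1
    · obtain ⟨x, hx⟩ := a1 c ((hs' c).2 h)
      exact ⟨x, mem_bld.2 (Or.inl hx)⟩
    · exact ⟨n+1, mem_bld.2 (Or.inr ⟨rfl, Or.inr ⟨by omega, hc⟩⟩)⟩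
  · intro c hc
    rw [hs] at hc
    rw [Finset.eq_empty_iff_forall_notMem]
    intro x hx
    rcases mem_bld.1 hx with h | ⟨_, ⟨h, h'⟩ | h⟩
    · rw [a2 c (by rw [hs']; have := h2 c.1; omega)] at h; simp at h
    · have := h2 c.1; omega
    · omega
  · intro c x hx
    rcases mem_bld.1 hx with h | ⟨h, _⟩
    · have := a3 c x h; omega
    · omega
  · intro i j hc hc' x hx y hy
    rw [hs] at hc hc'
    rcases mem_bld.1 hx with h | ⟨h, hh⟩ <;> rcases mem_bld.1 hy with h' | ⟨h', hh'⟩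
    · have : (i, j+1) ∈ s' := by by_contra hn; rw [a2 _ hn] at h'; simp at h'
      have k : (i, j) ∈ s' := by rw [hs'] at this ⊢; simp at this ⊢; omega
      exact a4 i j k this x h y h'
    · have := a3 _ x h; omega
    · have : (i, j+1) ∈ s' := by by_contra hn; rw [a2 _ hn] at h'; simp at h'
      rw [hs'] at this
      simp only at this hh
      omega
    · omega
  · intro i j hc hc' x hx y hy
    rw [hs] at hc hc'
    simp only at hc hc'
    have q1 := h1 i
    have q2 := h2 i
    have q3 := h2 (i+1)
    rcases mem_bld.1 hx with h | ⟨h, hh⟩ <;> rcases mem_bld.1 hy with h' | ⟨h', hh'⟩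
    · have : (i+1, j) ∈ s' := by by_contra hn; rw [a2 _ hn] at h'; simp at h'
      have k : (i, j) ∈ s' := by by_contra hn; rw [a2 _ hn] at h; simp at h
      exact a5 i j k this x h y h'
    · have := a3 _ x h; omega
    · simp only at hh
      rcases hh with ⟨e1, e2⟩ | e
      · have := hA i e1; omega
      · omega
    · simp only at hh hh'
      rcases hh with ⟨e1, e2⟩ | e
      · have := hA i e1; omega
      · omega

theorem bld_inj (hs' : ∀ c : Cell, c ∈ s' ↔ c.2 < M c.1) {M2 : ℕ → ℕ} {s2 : Finset Cell}
    (hs2 : ∀ c : Cell, c ∈ s2 ↔ c.2 < M2 c.1)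
    {T' T2 : Cell → Finset ℕ} (hT : IsSVTOn n s' T') (hT2 : IsSVTOn n s2 T2) {A A2 : Finset ℕ}
    (hA : ∀ i ∈ A, L (i+1) < M i) (hA2 : ∀ i ∈ A2, L (i+1) < M2 i)
    (h : bld n L M T' A = bld n L M2 T2 A2) : M = M2 ∧ T' = T2 ∧ A = A2 := by
  have hTT : T' = T2 := by
    funext c
    ext v
    have hv : v ∈ bld n L M T' A c ↔ v ∈ bld n L M2 T2 A2 c := by rw [h]
    rw [mem_bld, mem_bld] at hv
    have b1 := hT.2.2.1 c v
    have b2 := hT2.2.2.1 c v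
    constructor
    · intro q
      rcases hv.1 (Or.inl q) with r | r
      · exact r
      · have := b1 q; omega
    · intro q
      rcases hv.2 (Or.inl q) with r | r
      · exact r
      · have := b2 q; omega
  have hMM : M = M2 := by
    funext i
    have : ∀ j, j < M i ↔ j < M2 i := by
      intro j
      rw [← hs' (i,j), ← hs2 (i,j)]
      have e1 : (i,j) ∈ s' ↔ (T' (i,j)).Nonempty := ⟨hT.1 _, fun q => by
        by_contra hn; rw [hT.2.1 _ hn] at q; simp at q⟩
      have e2 : (i,j) ∈ s2 ↔ (T2 (i,j)).Nonempty := ⟨hT2.1 _, fun q => by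
        by_contra hn; rw [hT2.2.1 _ hn] at q; simp at q⟩
      rw [e1, e2, hTT]
    have a := this (M i)
    have b := this (M2 i)
    omega
  refine ⟨hMM, hTT, ?_⟩
  subst hMM hTT
  ext i
  have key : ∀ A : Finset ℕ, (∀ i ∈ A, L (i+1) < M i) → (i ∈ A ↔ 0 < M i ∧ n+1 ∈ bld n L M T' A (i, M i - 1)) := by
    intro A hA
    rw [mem_bld]
    have hn : n+1 ∉ T' (i, M i - 1) := fun q => by have := hT.2.2.1 _ _ q; omega
    simp only [hn, false_or, true_and]
    constructor
    · intro q
      have := hA i q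
      exact ⟨by omega, Or.inl ⟨q, by omega⟩⟩
    · rintro ⟨q, r | r⟩
      · exact r.1
      · omega
  rw [key A hA, key A2 hA2, h]

theorem svt_row_le (hs : ∀ c : Cell, c ∈ s ↔ c.2 < L c.1) (hL : ∀ i, L (i+1) ≤ L i) {T}
    (hT : IsSVTOn n s T) : ∀ i j, ∀ x ∈ T (i,j), i + 1 ≤ x := by
  intro i
  induction i with
  | zero => intro j x hx; have := hT.2.2.1 _ _ hx; omega
  | succ i ih =>
    intro j x hx
    have h1 : (i+1, j) ∈ s := by by_contra hn; rw [hT.2.1 _ hn] at hx; simp at hx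
    have h2 : (i, j) ∈ s := by rw [hs] at h1 ⊢; have := hL i; simp at h1 ⊢; omega
    obtain ⟨y, hy⟩ := hT.1 _ h2
    have := hT.2.2.2.2 i j h2 h1 y hy x hx
    have := ih j y hy
    omega

theorem bld_surj (hs : ∀ c : Cell, c ∈ s ↔ c.2 < L c.1) (hL : ∀ i, L (i+1) ≤ L i) {T}
    (hT : IsSVTOn (n+1) s T) : ∃ (M : ℕ → ℕ) (T' : Cell → Finset ℕ) (A : Finset ℕ),
    (∀ i, n ≤ i → M i = 0) ∧ (∀ i, L (i+1) ≤ M i) ∧ (∀ i, M i ≤ L i) ∧ (∀ i ∈ A, L (i+1) < M i) ∧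
    (∀ s', (∀ c : Cell, c ∈ s' ↔ c.2 < M c.1) → IsSVTOn n s' T') ∧ bld n L M T' A = T := by
  have a6 := svt_row_le hs hL hT
  obtain ⟨a1, a2, a3, a4, a5⟩ := hT
  have ins : ∀ c x, x ∈ T c → c ∈ s := fun c x hx => by by_contra hn; rw [a2 _ hn] at hx; simp at hx
  have hcut : ∀ i, ∃ M, M ≤ L i ∧ ∀ j, (∃ x ∈ T (i,j), x ≤ n) ↔ j < M := by
    intro i
    apply exists_cut
    · rintro j ⟨x, hx, _⟩
      exact (hs _).1 (ins _ _ hx)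
    · rintro j ⟨x, hx, hxn⟩
      have h1 := ins _ _ hx
      have h2 : (i, j) ∈ s := by rw [hs] at h1 ⊢; simp at h1 ⊢; omega
      obtain ⟨y, hy⟩ := a1 _ h2
      exact ⟨y, hy, (a4 i j h2 h1 y hy x hx).trans hxn⟩
  choose M hM1 hM2 using hcut
  have h1 : ∀ i, L (i+1) ≤ M i := by
    intro i
    by_contra hlt
    have hh : (i+1, M i) ∈ s := (hs _).2 (by simp; omega)
    have hh' : (i, M i) ∈ s := (hs _).2 (by have := hL i; simp; omega)
    obtain ⟨x, hx⟩ := a1 _ hh'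
    obtain ⟨y, hy⟩ := a1 _ hh
    have := a5 i (M i) hh' hh x hx y hy
    have := a3 _ _ hy
    have := (hM2 i (M i)).1 ⟨x, hx, by omega⟩
    omega
  have h0 : ∀ i, n ≤ i → M i = 0 := by
    intro i hi
    by_contra hne
    obtain ⟨x, hx, hxn⟩ := (hM2 i 0).2 (by omega)
    have := a6 _ _ _ hx
    omega
  refine ⟨M, fun c => (T c).erase (n+1), (Finset.range n).filter (fun i => n+1 ∈ T (i, M i - 1) ∧ 0 < M i),
    h0, h1, hM1, ?_, ?_, ?_⟩
  · intro i hi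
    obtain ⟨_, hi, hpos⟩ := Finset.mem_filter.1 hi
    by_contra hle
    have hh : (i+1, M i - 1) ∈ s := (hs _).2 (by have := h1 i; simp; omega)
    obtain ⟨y, hy⟩ := a1 _ hh
    have := a5 i _ (ins _ _ hi) hh _ hi y hy
    have := a3 _ _ hy
    omega
  · intro s' hs'
    have sub : ∀ c, c ∈ s' → c ∈ s := by
      intro c hc; rw [hs'] at hc; rw [hs]; have := hM1 c.1; omega
    refine ⟨?_, ?_, ?_, ?_, ?_⟩
    · intro c hc
      obtain ⟨x, hx, hxn⟩ := (hM2 c.1 c.2).2 ((hs' c).1 hc)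
      exact ⟨x, Finset.mem_erase.2 ⟨by omega, hx⟩⟩
    · intro c hc
      rw [Finset.eq_empty_iff_forall_notMem]
      intro x hx
      rw [Finset.mem_erase] at hx
      have := a3 _ _ hx.2
      exact hc ((hs' c).2 ((hM2 c.1 c.2).1 ⟨x, hx.2, by omega⟩))
    · intro c x hx
      rw [Finset.mem_erase] at hx
      have := a3 _ _ hx.2
      omega
    · intro i j hc hc' x hx y hy
      exact a4 i j (sub _ hc) (sub _ hc') x (Finset.mem_of_mem_erase hx) y (Finset.mem_of_mem_erase hy)
    · intro i j hc hc' x hx y hy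
      exact a5 i j (sub _ hc) (sub _ hc') x (Finset.mem_of_mem_erase hx) y (Finset.mem_of_mem_erase hy)
  · funext c
    ext v
    rw [mem_bld, Finset.mem_erase, Finset.mem_filter, Finset.mem_range]
    constructor
    · rintro (h | ⟨rfl, ⟨⟨_, h, _⟩, h'⟩ | ⟨h, h'⟩⟩)
      · exact h.2
      · have : c = (c.1, M c.1 - 1) := Prod.ext rfl (by simp; omega)
        rw [this]; exact h
      · obtain ⟨x, hx⟩ := a1 c ((hs c).2 h')
        have b := a3 _ _ hx
        have hx' : x = n+1 := by
          by_contra hne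
          have := (hM2 c.1 c.2).1 ⟨x, hx, by omega⟩
          omega
        rwa [hx'] at hx
    · intro hv
      by_cases hvn : v = n+1
      · right
        subst hvn
        refine ⟨rfl, ?_⟩
        have hcs := (hs c).1 (ins _ _ hv)
        by_cases hcM : c.2 < M c.1
        · left
          have e : c.2 + 1 = M c.1 := by
            by_contra hne
            obtain ⟨y, hy, hyn⟩ := (hM2 c.1 (c.2+1)).2 (by omega)
            have := a4 c.1 c.2 (ins _ _ hv) (ins _ _ hy) _ hv y hy
            omega
          refine ⟨⟨?_, ?_, by omega⟩, e⟩
          · by_contra hge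
            have := h0 c.1 (by omega)
            omega
          · have : (c.1, M c.1 - 1) = c := Prod.ext rfl (by simp; omega)
            rw [this]; exact hv
        · exact Or.inr ⟨by omega, hcs⟩
      · exact Or.inl ⟨hvn, hv⟩

theorem wt_bld_lt (hs : ∀ c : Cell, c ∈ s ↔ c.2 < L c.1) (hs' : ∀ c : Cell, c ∈ s' ↔ c.2 < M c.1)
    (h2 : ∀ i, M i ≤ L i) {T' : Cell → Finset ℕ} (hT : IsSVTOn n s' T') (A : Finset ℕ)
    {v : ℕ} (hv : v ≠ n+1) : wtOn s (bld n L M T' A) v = wtOn s' T' v := by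
  unfold wtOn
  symm
  refine Finset.sum_subset_zero_on_sdiff ?_ ?_ ?_
  · intro c hc; rw [hs'] at hc; rw [hs]; have := h2 c.1; omega
  · intro c hc
    rw [if_neg]
    rw [mem_bld]
    simp [hv, hT.2.1 c (Finset.mem_sdiff.1 hc).2]
  · intro c hc
    simp [mem_bld, hv]

theorem wt_bld_eq (hs : ∀ c : Cell, c ∈ s ↔ c.2 < L c.1) (hs' : ∀ c : Cell, c ∈ s' ↔ c.2 < M c.1)
    (h2 : ∀ i, M i ≤ L i) {T' : Cell → Finset ℕ} (hT : IsSVTOn n s' T') {A : Finset ℕ}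
    (hA : ∀ i ∈ A, L (i+1) < M i) : 
    wtOn s (bld n L M T' A) (n+1) + s'.card = s.card + A.card := by
  have hsub : s' ⊆ s := by
    intro c hc; rw [hs'] at hc; rw [hs]; have := h2 c.1; omega
  have : wtOn s (bld n L M T' A) (n+1) = ((s \ s') ∪ A.image (fun i => (i, M i - 1))).card := by
    rw [wtOn_card]
    congr 1
    ext c
    have hn : n+1 ∉ T' c := fun q => by have := hT.2.2.1 _ _ q; omega
    simp only [Finset.mem_filter, mem_bld, hn, false_or, true_and, Finset.mem_union, Finset.mem_sdiff,
      Finset.mem_image]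
    rw [hs, hs']
    constructor
    · rintro ⟨h, ⟨h3, h4⟩ | h3⟩
      · exact Or.inr ⟨c.1, h3, Prod.ext rfl (by simp; omega)⟩
      · exact Or.inl ⟨h, by omega⟩
    · rintro (h | ⟨i, hi, rfl⟩)
      · exact ⟨h.1, Or.inr ⟨by omega, h.1⟩⟩
      · have := hA i hi
        have := h2 i
        exact ⟨by simp; omega, Or.inl ⟨hi, by simp; omega⟩⟩
  rw [this, Finset.card_union_of_disjoint, Finset.card_image_of_injective _ (fun a b h => (Prod.ext_iff.1 h).1)]
  · have := Finset.card_sdiff_add_card_eq_card hsub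
    omega
  · rw [Finset.disjoint_left]
    intro c hc hc'
    obtain ⟨i, hi, rfl⟩ := Finset.mem_image.1 hc'
    have := hA i hi
    exact (Finset.mem_sdiff.1 hc).2 ((hs' _).2 (by simp; omega))
end

theorem Gsum_branch {A : Type*} [CommRing A] (β : A) (n : ℕ) (l : Fin (n+1) → ℕ)
    (hl : ∀ i : Fin n, l i.succ ≤ l i.castSucc) (x : Fin n → A) (y : A) :
    Gsum β (n+1) (shp (n+1) l) (Fin.snoc x y) = y^(l (Fin.last n)) *
      ∑ m ∈ Fintype.piFinset (fun i : Fin n => Finset.Icc (l i.succ) (l i.castSucc)),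
        (∏ i, (y^(l i.castSucc - m i) * (if l i.succ < m i then 1-β*y else 1))) * Gsum β n (shp n m) x := by
  set L := extendf (n+1) l with hLdef
  have hs : ∀ c : Cell, c ∈ shp (n+1) l ↔ c.2 < L c.1 := fun c => mem_shp
  have hL0 : ∀ i : Fin n, L i = l i.castSucc := fun i => by
    rw [hLdef, extendf_lt l (by omega : (i:ℕ) < n+1)]; rfl
  have hL1 : ∀ i : Fin n, L (i+1) = l i.succ := fun i => by
    rw [hLdef, extendf_lt l (by omega : (i:ℕ)+1 < n+1)]; rfl
  have hLz : ∀ i, n + 1 ≤ i → L i = 0 := fun i hi => extendf_ge l hi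
  have hL : ∀ i, L (i+1) ≤ L i := by
    intro i
    by_cases h : i < n
    · have := hl ⟨i, h⟩
      rw [← hL0, ← hL1] at this; exact this
    · rw [hLz (i+1) (by omega)]; omega
  let Aset : (Fin n → ℕ) → Finset ℕ := fun m => (Finset.range n).filter (fun i => L (i+1) < extendf n m i)
  have hint : ∀ m, m ∈ Fintype.piFinset (fun i : Fin n => Finset.Icc (l i.succ) (l i.castSucc)) ↔
      ∀ i, L (i+1) ≤ extendf n m i ∧ extendf n m i ≤ L i := by
    intro m
    rw [Fintype.mem_piFinset]
    constructor
    · intro h i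
      by_cases hi : i < n
      · have := h ⟨i, hi⟩
        rw [Finset.mem_Icc, ← hL0, ← hL1] at this
        rw [extendf_lt m hi]; exact this
      · rw [extendf_ge m (by omega), hLz (i+1) (by omega)]; omega
    · intro h i
      have := h i
      rw [extendf_fin] at this
      rw [Finset.mem_Icc, ← hL0, ← hL1]; exact this
  have hmA : ∀ m B, B ∈ (Aset m).powerset ↔ ∀ i ∈ B, L (i+1) < extendf n m i := by
    intro m B
    rw [Finset.mem_powerset]
    constructor
    · intro h i hi; exact (Finset.mem_filter.1 (h hi)).2
    · intro h i hi
      have := h i hi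
      refine Finset.mem_filter.2 ⟨?_, this⟩
      rw [Finset.mem_range]
      by_contra hn
      rw [extendf_ge m (by omega)] at this; omega
  have key : ∀ m ∈ Fintype.piFinset (fun i : Fin n => Finset.Icc (l i.succ) (l i.castSucc)),
      y^(l (Fin.last n)) * ((∏ i, (y^(l i.castSucc - m i) * (if l i.succ < m i then 1-β*y else 1))) * Gsum β n (shp n m) x) =
      ∑ p ∈ (svtF n (shp n m)) ×ˢ (Aset m).powerset,
        ((-β)^exTotal (shp (n+1) l) (bld n L (extendf n m) p.1 p.2) *
        ∏ i : Fin (n+1), (Fin.snoc x y : Fin (n+1) → A) i ^ wtOn (shp (n+1) l) (bld n L (extendf n m) p.1 p.2) ((i:ℕ)+1)) := by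
    intro m hm
    have hm' := (hint m).1 hm
    have e1 : ∏ i : Fin n, (if l i.succ < m i then 1-β*y else 1) = ∑ B ∈ (Aset m).powerset, (-β*y)^B.card := by
      have : ∏ i : Fin n, (if l i.succ < m i then 1-β*y else 1) = ∏ i ∈ Aset m, (1 + (-β*y)) := by
        rw [Finset.prod_filter, Finset.prod_range]
        refine Finset.prod_congr rfl fun i _ => ?_
        rw [hL1, extendf_fin]
        congr 1; ring
      rw [this, Finset.prod_one_add]
      simp
    rw [Finset.prod_mul_distrib, e1, Finset.prod_pow_eq_pow_sum, Gsum, Finset.sum_product, mul_assoc, ← mul_assoc,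
      ← pow_add, Finset.sum_mul_sum, Finset.sum_comm, Finset.mul_sum]
    refine Finset.sum_congr rfl fun T hT => ?_
    rw [Finset.mul_sum]
    refine Finset.sum_congr rfl fun B hB => ?_
    rw [mem_svtF] at hT
    have hB' := (hmA m B).1 hB
    have hs' : ∀ c : Cell, c ∈ shp n m ↔ c.2 < extendf n m c.1 := fun c => mem_shp
    have w2 := wt_bld_eq hs hs' (fun i => (hm' i).2) hT hB'
    have wl : ∀ v, v < n → wtOn (shp (n+1) l) (bld n L (extendf n m) T B) (v+1) = wtOn (shp n m) T (v+1) :=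
      fun v hv => wt_bld_lt hs hs' (fun i => (hm' i).2) hT B (by omega)
    have hbs := bld_svt hs hs' (fun i => (hm' i).1) (fun i => (hm' i).2) hT hB'
    have ce := card_le_wt hT
    have ex : exTotal (shp (n+1) l) (bld n L (extendf n m) T B) = exTotal (shp n m) T + B.card := by
      rw [exTotal_eq hbs, exTotal_eq hT, Finset.sum_range_succ]
      rw [Finset.sum_congr rfl (fun v hv => wl v (Finset.mem_range.1 hv))]
      omega
    have wn : wtOn (shp (n+1) l) (bld n L (extendf n m) T B) (n+1) =
        (l (Fin.last n) + ∑ i : Fin n, (l i.castSucc - m i)) + B.card := by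
      have c1 : ∑ i : Fin n, (l i.castSucc - m i) + ∑ i, m i = ∑ i : Fin n, l i.castSucc := by
        rw [← Finset.sum_add_distrib]
        refine Finset.sum_congr rfl fun i _ => ?_
        have := (hm' i).2
        rw [hL0, extendf_fin] at this
        omega
      rw [card_shp, card_shp, Fin.sum_univ_castSucc] at w2
      omega
    rw [ex, Fin.prod_univ_castSucc]
    simp only [Fin.snoc_castSucc, Fin.snoc_last, Fin.val_castSucc, Fin.val_last]
    have wl2 : ∏ i : Fin n, x i ^ wtOn (shp (n+1) l) (bld n L (extendf n m) T B) ((i:ℕ)+1) =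
        ∏ i : Fin n, x i ^ wtOn (shp n m) T ((i:ℕ)+1) :=
      Finset.prod_congr rfl (fun (i : Fin n) _ => by rw [wl i i.2])
    rw [wn, wl2]
    ring
  rw [Finset.mul_sum, Finset.sum_congr rfl key, Finset.sum_sigma', Gsum]
  symm
  refine Finset.sum_bij (fun p _ => bld n L (extendf n p.1) p.2.1 p.2.2) ?_ ?_ ?_ ?_
  · rintro ⟨m, T, B⟩ hp
    rw [Finset.mem_sigma, Finset.mem_product] at hp
    have hm' := (hint m).1 hp.1
    exact mem_svtF.2 (bld_svt hs (fun c => mem_shp) (fun i => (hm' i).1) (fun i => (hm' i).2)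
      (mem_svtF.1 hp.2.1) ((hmA m B).1 hp.2.2))
  · rintro ⟨m, T, B⟩ hp ⟨m2, T2, B2⟩ hp2 h
    rw [Finset.mem_sigma, Finset.mem_product] at hp hp2
    obtain ⟨q1, q2, q3⟩ := bld_inj (fun c => mem_shp) (fun c => mem_shp) (mem_svtF.1 hp.2.1)
      (mem_svtF.1 hp2.2.1) ((hmA m B).1 hp.2.2) ((hmA m2 B2).1 hp2.2.2) h
    have : m = m2 := by
      funext i
      rw [← extendf_fin m, ← extendf_fin m2, q1]
    simp only at q2 q3
    subst this q2 q3
    rfl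
  · intro T hT
    obtain ⟨M, T', B, h0, h1, h2, h3, h4, h5⟩ := bld_surj hs hL (mem_svtF.1 hT)
    have hM : extendf n (fun i : Fin n => M i) = M := by
      funext i
      by_cases hi : i < n
      · rw [extendf_lt _ hi]
      · rw [extendf_ge _ (by omega), h0 i (by omega)]
    refine ⟨⟨fun i => M i, T', B⟩, ?_, ?_⟩
    · rw [Finset.mem_sigma, Finset.mem_product]
      refine ⟨(hint _).2 fun i => ?_, mem_svtF.2 (h4 _ fun c => ?_), (hmA _ _).2 ?_⟩
      · rw [hM]; exact ⟨h1 i, h2 i⟩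
      · rw [mem_shp, hM]
      · simp only [hM]; exact h3
    · simp only [hM]; exact h5
  · intro p hp; rfl

theorem Gsum_zero {A : Type*} [CommRing A] (β : A) (x : Fin 0 → A) (l : Fin 0 → ℕ) :
    Gsum β 0 (shp 0 l) x = 1 := by
  have : svtF 0 (shp 0 l) = {fun _ => ∅} := by
    ext T
    rw [mem_svtF, Finset.mem_singleton]
    have he : shp 0 l = ∅ := by simp [shp]
    rw [he]
    constructor
    · intro h; funext c; exact h.2.1 c (by simp)
    · rintro rfl; simp [IsSVTOn]
  unfold Gsum
  rw [this]
  simp [exTotal, shp]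

theorem bialternant {A : Type*} [CommRing A] [IsDomain A] (β : A) (n : ℕ) (l : Fin n → ℕ) (hl : Antitone l)
    (x : Fin n → A) (hx : ∀ i, 1 - β * x i ≠ 0) :
    VV n x * Gsum β n (shp n l) x = DD β n l x := by
  induction n with
  | zero => rw [VV_zero, Gsum_zero, DD_zero, one_mul]
  | succ n ih =>
    obtain ⟨x', y, rfl⟩ : ∃ (x' : Fin n → A) (y : A), x = Fin.snoc x' y :=
      ⟨fun i => x i.castSucc, x (Fin.last n), (Fin.snoc_init_self x).symm⟩
    have hl' : ∀ i : Fin n, l i.succ ≤ l i.castSucc := fun i => hl Fin.castSucc_lt_succ.le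
    have hy : 1 - β * y ≠ 0 := by simpa using hx (Fin.last n)
    have hx' : ∀ i, 1 - β * x' i ≠ 0 := fun i => by simpa using hx i.castSucc
    rw [DD_branch β n l hl' x' y hy, VV_snoc, Gsum_branch β n l hl' x' y]
    rw [mul_assoc (∏ j, (x' j - y)), mul_assoc (∏ j, (x' j - y)), mul_left_comm (VV n x')]
    congr 2
    rw [Finset.mul_sum]
    refine Finset.sum_congr (by congr!) fun m hm => ?_
    rw [Fintype.mem_piFinset] at hm
    have hmanti : Antitone m := by
      intro i j hij
      rcases hij.eq_or_lt with rfl | hlt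
      · exact le_rfl
      · have h1 := (Finset.mem_Icc.1 (hm i)).1
        have h2 := (Finset.mem_Icc.1 (hm j)).2
        exact h2.trans ((hl (by
          rw [Fin.le_def, Fin.val_succ, Fin.val_castSucc]; exact hlt : i.succ ≤ j.castSucc)).trans h1)
    rw [mul_left_comm, ih m hmanti x' hx']

/-- vanishing when the shape has too many rows -/
theorem svtF_empty_of_rows {n : ℕ} {s : Finset Cell} (hs : IsPartitionShape s) {c : Cell} (hc : c ∈ s)
    (hn : n ≤ c.1) : ∀ T, ¬ IsSVTOn n s T := by
  intro T hT
  have : ∀ i j, (i,j) ∈ s → ∀ x ∈ T (i,j), i + 1 ≤ x := by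
    intro i
    induction i with
    | zero => intro j _ x hx; have := hT.2.2.1 _ _ hx; omega
    | succ i ih =>
      intro j h1 x hx
      have h2 : (i, j) ∈ s := hs _ _ _ _ h1 (by omega) le_rfl
      obtain ⟨y, hy⟩ := hT.1 _ h2
      have := hT.2.2.2.2 i j h2 h1 y hy x hx
      have := ih j h2 y hy
      omega
  obtain ⟨x, hx⟩ := hT.1 c hc
  have h1 := this c.1 c.2 hc x hx
  have h2 := hT.2.2.1 _ _ hx
  omega

theorem RGone_eq (n : ℕ) (s : Finset Cell) : RGone n s = Gsum 1 n s (fun i => MvPolynomial.X i) := by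
  unfold RGone Gsum
  have := finsum_subtype_eq_finsum_cond (fun T => IsSVTOn n s T) (f := fun T => ((-1 : XPoly n) ^ exTotal s T) *
      ∏ i : Fin n, MvPolynomial.X i ^ wtOn s T ((i : ℕ) + 1))
  rw [this, ← finsum_mem_finset_eq_sum]
  refine finsum_congr fun T => ?_
  rw [mem_svtF]

theorem RGone_zero {n : ℕ} {s : Finset Cell} (hs : IsPartitionShape s) (h : ¬ AtMostRows s n) :
    RGone n s = 0 := by
  unfold AtMostRows at h
  push Not at h
  obtain ⟨c, hc, hn⟩ := h
  rw [RGone_eq, Gsum, Finset.sum_eq_zero]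
  intro T hT
  exact absurd (mem_svtF.1 hT) (svtF_empty_of_rows hs hc hn T)
end Part2

section Part3
attribute [-instance] Classical.propDecidable
attribute [local instance 10] Classical.propDecidable

theorem KnuthEquiv.refl (w : List ℕ) : KnuthEquiv w w := Relation.EqvGen.refl w
theorem KnuthEquiv.symm {u v : List ℕ} (h : KnuthEquiv u v) : KnuthEquiv v u := Relation.EqvGen.symm _ _ h
theorem KnuthEquiv.trans {u v w : List ℕ} (h : KnuthEquiv u v) (h' : KnuthEquiv v w) : KnuthEquiv u w :=
  Relation.EqvGen.trans _ _ _ h h'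

/-- induction principle for functions that are invariant -/
theorem KnuthEquiv.inv {α : Sort*} (F : List ℕ → α) (hF : ∀ u v, KnuthStep u v → F u = F v) {u v : List ℕ}
    (h : KnuthEquiv u v) : F u = F v := by
  induction h with
  | rel _ _ h => exact hF _ _ h
  | refl _ => rfl
  | symm _ _ _ ih => exact ih.symm
  | trans _ _ _ _ _ ih1 ih2 => exact ih1.trans ih2

theorem KnuthEquiv.append_left (p : List ℕ) {u v : List ℕ} (h : KnuthEquiv u v) :
    KnuthEquiv (p ++ u) (p ++ v) := by
  induction h with
  | rel _ _ h =>
    apply Relation.EqvGen.rel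
    cases h with
    | kxzy u w x y z h1 h2 => rw [← List.append_assoc, ← List.append_assoc]; exact KnuthStep.kxzy _ _ _ _ _ h1 h2
    | kyxz u w x y z h1 h2 => rw [← List.append_assoc, ← List.append_assoc]; exact KnuthStep.kyxz _ _ _ _ _ h1 h2
  | refl _ => exact KnuthEquiv.refl _
  | symm _ _ _ ih => exact ih.symm
  | trans _ _ _ _ _ ih1 ih2 => exact ih1.trans ih2

theorem KnuthEquiv.append_right (p : List ℕ) {u v : List ℕ} (h : KnuthEquiv u v) :
    KnuthEquiv (u ++ p) (v ++ p) := by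
  induction h with
  | rel _ _ h =>
    apply Relation.EqvGen.rel
    cases h with
    | kxzy u w x y z h1 h2 => simpa using KnuthStep.kxzy u (w ++ p) _ _ _ h1 h2
    | kyxz u w x y z h1 h2 => simpa using KnuthStep.kyxz u (w ++ p) _ _ _ h1 h2
  | refl _ => exact KnuthEquiv.refl _
  | symm _ _ _ ih => exact ih.symm
  | trans _ _ _ _ _ ih1 ih2 => exact ih1.trans ih2

theorem KnuthEquiv.count_eq {u v : List ℕ} (h : KnuthEquiv u v) (a : ℕ) : u.count a = v.count a := by
  refine KnuthEquiv.inv (fun u => u.count a) ?_ h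
  intro u v h
  cases h <;> simp [List.count_cons] <;> omega

theorem KnuthEquiv.perm {u v : List ℕ} (h : KnuthEquiv u v) : u.Perm v :=
  List.perm_iff_count.2 h.count_eq

/-! Yamanouchi -/

theorem count_inst (i j : DecidableEq ℕ) (a : ℕ) (w : List ℕ) :
    @List.count ℕ (@instBEqOfDecidableEq ℕ i) a w = @List.count ℕ (@instBEqOfDecidableEq ℕ j) a w := by
  rw [Subsingleton.elim i j]

theorem yam_iff (w : List ℕ) : IsYamanouchi w ↔ ∀ k v, (w.drop k).count (v+2) ≤ (w.drop k).count (v+1) := by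
  unfold IsYamanouchi
  refine forall_congr' fun k => forall_congr' fun v => ?_
  refine iff_of_eq (congrArg₂ _ ?_ ?_) <;> exact count_inst _ _ _ _

theorem yam_nil : IsYamanouchi [] := by rw [yam_iff]; intro k v; simp

theorem yam_cons (a : ℕ) (w : List ℕ) : IsYamanouchi (a :: w) ↔
    (∀ v, (a :: w).count (v+2) ≤ (a :: w).count (v+1)) ∧ IsYamanouchi w := by
  rw [yam_iff, yam_iff]
  constructor
  · intro h
    exact ⟨fun v => h 0 v, fun k v => h (k+1) v⟩
  · rintro ⟨h1, h2⟩ k v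
    cases k with
    | zero => exact h1 v
    | succ k => exact h2 k v

theorem yam_append (p : List ℕ) (u v : List ℕ) (hp : u.Perm v) (h : IsYamanouchi u ↔ IsYamanouchi v) :
    IsYamanouchi (p ++ u) ↔ IsYamanouchi (p ++ v) := by
  induction p with
  | nil => exact h
  | cons a p ih =>
    rw [List.cons_append, List.cons_append, yam_cons, yam_cons, ih]
    have : ∀ x, (a :: (p ++ u)).count x = (a :: (p ++ v)).count x := fun x =>
      List.Perm.count_eq ((hp.append_left p).cons a) x
    simp only [this]

theorem yam_suffix {w s : List ℕ} (h : IsYamanouchi w) (hs : s <:+ w) (v : ℕ) :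
    s.count (v+2) ≤ s.count (v+1) := by
  obtain ⟨p, rfl⟩ := hs
  have := (yam_iff _).1 h p.length v
  simpa using this

theorem KnuthEquiv.yam {u v : List ℕ} (h : KnuthEquiv u v) : IsYamanouchi u ↔ IsYamanouchi v := by
  have := KnuthEquiv.inv (fun u => IsYamanouchi u) ?_ h
  · rw [this]
  intro u v h
  apply propext
  have key : ∀ (w : List ℕ), IsYamanouchi w → ∀ v, w.count (v+2) ≤ w.count (v+1) := fun w hw v =>
    yam_suffix hw List.suffix_rfl v
  cases h with
  | kxzy u w x y z h1 h2 =>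
    apply yam_append
    · exact List.Perm.swap _ _ _
    · simp only [yam_cons, List.count_cons, beq_iff_eq]
      constructor
      · rintro ⟨a1, a2, a3, a4⟩
        refine ⟨fun v => by have := a1 v; omega, fun v => ?_, a3, a4⟩
        replace a1 := a1 v; replace a2 := a2 v; replace a3 := a3 v
        replace a4 := key _ a4 v
        clear key
        generalize List.count (v+2) w = p at *
        generalize List.count (v+1) w = q at *
        grind
      · rintro ⟨a1, a2, a3, a4⟩
        refine ⟨fun v => by have := a1 v; omega, fun v => ?_, a3, a4⟩
        replace a1 := a1 v; replace a2 := a2 v; replace a3 := a3 v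
        replace a4 := key _ a4 v
        clear key
        generalize List.count (v+2) w = p at *
        generalize List.count (v+1) w = q at *
        grind
  | kyxz u w x y z h1 h2 =>
    apply yam_append
    · exact (List.Perm.swap _ _ _).cons _
    · simp only [yam_cons, List.count_cons, beq_iff_eq]
      constructor
      · rintro ⟨a1, a2, a3, a4⟩
        have a5 := key _ a4
        refine ⟨fun v => by have := a1 v; omega, fun v => by have := a2 v; omega, fun v => ?_, a4⟩
        replace a1 := a1 v; replace a2 := a2 v; replace a3 := a3 v; replace a5 := a5 v
        clear key
        generalize List.count (v+2) w = p at *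
        generalize List.count (v+1) w = q at *
        grind
      · rintro ⟨a1, a2, a3, a4⟩
        have a5 := key _ a4
        refine ⟨fun v => by have := a1 v; omega, fun v => by have := a2 v; omega, fun v => ?_, a4⟩
        replace a1 := a1 v; replace a2 := a2 v; replace a3 := a3 v; replace a5 := a5 v
        clear key
        generalize List.count (v+2) w = p at *
        generalize List.count (v+1) w = q at *
        grind

/-! Row insertion and the two-row lemma -/

theorem ins_right (a b : ℕ) (Bs : List ℕ) (hab : a < b) (hs : (b :: Bs).Pairwise (· ≤ ·)) :
    KnuthEquiv (b :: Bs ++ [a]) (b :: a :: Bs) := by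
  induction Bs generalizing b with
  | nil => exact KnuthEquiv.refl _
  | cons c Bs ih =>
    have hbc : b ≤ c := (List.pairwise_cons.1 hs).1 c (by simp)
    have h1 := (ih c (by omega) (List.pairwise_cons.1 hs).2).append_left [b]
    refine h1.trans ?_
    exact (Relation.EqvGen.rel _ _ (KnuthStep.kyxz [] Bs a b c hab hbc)).symm

theorem ins_left (a b : ℕ) (s : List ℕ) (Bs : List ℕ) (hab : a < b) (hs : (s ++ [a]).Pairwise (· ≤ ·)) :
    KnuthEquiv (s ++ b :: a :: Bs) (b :: (s ++ a :: Bs)) := by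
  induction s with
  | nil => exact KnuthEquiv.refl _
  | cons x s ih =>
    rw [List.cons_append, List.pairwise_cons] at hs
    have h1 := (ih hs.2).append_left [x]
    refine h1.trans ?_
    cases s with
    | nil => exact Relation.EqvGen.rel _ _ (KnuthStep.kxzy [] Bs x a b (hs.1 a (by simp)) hab)
    | cons y s =>
      refine Relation.EqvGen.rel _ _ (KnuthStep.kxzy [] (s ++ a :: Bs) x y b (hs.1 y (by simp)) ?_)
      have : y ≤ a := (List.pairwise_cons.1 hs.2).1 a (by simp)
      omega

theorem ins_row (a b : ℕ) (s Bs : List ℕ) (hab : a < b) (hs : (s ++ [a]).Pairwise (· ≤ ·))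
    (hB : (b :: Bs).Pairwise (· ≤ ·)) :
    KnuthEquiv (s ++ (b :: Bs ++ [a])) (b :: (s ++ a :: Bs)) :=
  ((ins_right a b Bs hab hB).append_left s).trans (ins_left a b s Bs hab hs)

theorem two_row (ps : List (ℕ × ℕ)) (s : List ℕ) (hle : ∀ p ∈ ps, p.1 ≤ p.2)
    (ha : (s ++ ps.map Prod.fst).Pairwise (· ≤ ·)) (hb : (ps.map Prod.snd).Pairwise (· ≤ ·)) :
    KnuthEquiv (s ++ (ps.map Prod.snd ++ (ps.filter (fun p => decide (p.2 ≠ p.1))).map Prod.fst))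
      ((ps.filter (fun p => decide (p.1 ≠ p.2))).map Prod.snd ++ (s ++ ps.map Prod.fst)) := by
  induction ps generalizing s with
  | nil => simpa using KnuthEquiv.refl _
  | cons p ps ih =>
    obtain ⟨a, b⟩ := p
    have hab : a ≤ b := hle (a,b) (by simp)
    have ha' : ((s ++ [a]) ++ ps.map Prod.fst).Pairwise (· ≤ ·) := by simpa using ha
    have hb' := (List.pairwise_cons.1 hb).2
    have h1 := ih (s ++ [a]) (fun p hp => hle p (List.mem_cons_of_mem _ hp)) ha' hb'
    rcases hab.eq_or_lt with rfl | hlt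
    · simpa using h1
    · have hne : b ≠ a := by omega
      have hne' : a ≠ b := by omega
      have h2 := (ins_row a b s (ps.map Prod.snd) hlt
        (ha'.sublist (List.sublist_append_left _ _)) hb).append_right
          ((ps.filter (fun p => decide (p.2 ≠ p.1))).map Prod.fst)
      have h3 := h1.append_left [b]
      simp only [List.map_cons, List.filter_cons, hne, hne', ne_eq, not_false_eq_true, decide_true, if_true]
      simp only [List.append_assoc, List.cons_append, List.nil_append, ne_eq] at h2 h3 ⊢
      exact h2.trans h3

/-! Greene-type invariants -/

def GR (k : ℕ) (a b : ℕ × ℕ) : Prop := a.2 = b.2 → a.2 < k → a.1 ≤ b.1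

def Gre (k v : ℕ) (w : List ℕ) (m : ℕ) : Prop :=
  ∃ L : List (ℕ × ℕ), L.map Prod.fst = w ∧ L.Pairwise (GR k) ∧ (∀ a ∈ L, a.2 < k → a.1 ≤ v) ∧
    L.countP (fun a => decide (a.2 < k)) = m

theorem split3 {L : List (ℕ × ℕ)} {u w : List ℕ} {x y z : ℕ}
    (h : L.map Prod.fst = u ++ x :: y :: z :: w) : ∃ U p q r W, L = U ++ (x,p) :: (y,q) :: (z,r) :: W ∧
      U.map Prod.fst = u ∧ W.map Prod.fst = w := by
  obtain ⟨U, W', rfl, h1, h2⟩ := List.map_eq_append_iff.1 h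
  obtain ⟨p, W2, rfl, h3, h4⟩ := List.map_eq_cons_iff.1 h2
  obtain ⟨q, W3, rfl, h5, h6⟩ := List.map_eq_cons_iff.1 h4
  obtain ⟨r, W4, rfl, h7, h8⟩ := List.map_eq_cons_iff.1 h6
  exact ⟨U, p.2, q.2, r.2, W4, by rw [← h3, ← h5, ← h7], h1, h8⟩

def swp (c d : ℕ) (a : ℕ × ℕ) : ℕ × ℕ := (a.1, if a.2 = c then d else if a.2 = d then c else a.2)

theorem swp_map (c d : ℕ) (W : List (ℕ × ℕ)) : (W.map (swp c d)).map Prod.fst = W.map Prod.fst := by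
  rw [List.map_map]; rfl

theorem swp_lt {c d k : ℕ} (hc : c < k) (hd : d < k) (a : ℕ × ℕ) : (swp c d a).2 < k ↔ a.2 < k := by
  simp only [swp]; split_ifs <;> omega

theorem swp_count {c d k : ℕ} (hc : c < k) (hd : d < k) (W : List (ℕ × ℕ)) :
    (W.map (swp c d)).countP (fun a => decide (a.2 < k)) = W.countP (fun a => decide (a.2 < k)) := by
  rw [List.countP_map]
  congr 1
  funext a
  simp [swp_lt hc hd]

theorem swp_pw {c d k : ℕ} {W : List (ℕ × ℕ)} (hc : c < k) (hd : d < k) (h : W.Pairwise (GR k)) :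
    (W.map (swp c d)).Pairwise (GR k) := by
  rw [List.pairwise_map]
  refine h.imp ?_
  intro a b hab h1 h2
  refine hab ?_ ((swp_lt hc hd a).1 h2)
  simp only [swp] at h1
  split_ifs at h1 <;> omega

theorem Gre_step {k v : ℕ} {u w : List ℕ} (h : KnuthStep u w) (m : ℕ) : Gre k v u m ↔ Gre k v w m := by
  cases h with
  | kxzy u w x y z h1 h2 =>
    constructor
    · rintro ⟨L, hL, hp, hb, hc⟩
      obtain ⟨U, p, q, r, W, rfl, hU, hW⟩ := split3 hL
      simp only [List.pairwise_append, List.pairwise_cons, List.mem_cons, forall_eq_or_imp, List.mem_append,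
        List.countP_append, List.countP_cons] at hp hb hc
      obtain ⟨pU, ⟨⟨xz, xy, xW⟩, ⟨zy, zW⟩, yW, pW⟩, pUW⟩ := hp
      by_cases hpq : p = q ∧ p < k
      · obtain ⟨rfl, hpk⟩ := hpq
        have hr : r ≠ p := by
          rintro rfl
          have := zy rfl hpk; simp at this; omega
        by_cases hrk : r < k
        · refine ⟨U ++ (z,r) :: (x,p) :: (y,p) :: W.map (swp p r), ?_, ?_, ?_, ?_⟩
          · rw [List.map_append, List.map_cons, List.map_cons, List.map_cons, swp_map, hU, hW]
          · simp only [List.pairwise_append, List.pairwise_cons, List.mem_cons, forall_eq_or_imp, List.mem_map,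
              forall_exists_index, and_imp, forall_apply_eq_imp_iff₂]
            refine ⟨pU, ⟨⟨?_, ?_, ?_⟩, ⟨?_, ?_⟩, ?_, swp_pw hpk hrk pW⟩, ?_⟩
            · intro e; exact absurd e hr
            · intro e; exact absurd e hr
            · intro a ha e _
              have := zW a ha; have := yW a ha
              simp only [GR, swp] at *
              split_ifs at * <;> omega
            · intro _ _; exact h1
            · intro a ha e _
              have := zW a ha; have := yW a ha
              simp only [GR, swp] at *
              split_ifs at * <;> omega
            · intro a ha e _
              have := zW a ha; have := yW a ha
              simp only [GR, swp] at *
              split_ifs at * <;> omega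
            · intro a ha
              obtain ⟨q1, q2, q3, q4⟩ := pUW a ha
              refine ⟨?_, ?_, ?_, ?_⟩
              · simp only [GR] at *; omega
              · simp only [GR] at *; omega
              · simp only [GR] at *; omega
              · intro b hbW
                have := q4 b hbW
                have := zW b hbW; have := yW b hbW
                simp only [GR, swp] at *
                split_ifs at * <;> omega
          · intro a ha hak
            simp only [List.mem_append, List.mem_cons, List.mem_map] at ha
            have bx := hb (x,p) (by simp) hpk
            have bz := hb (z,p) (by simp) hpk
            simp only at bx bz
            rcases ha with ha | rfl | rfl | rfl | ⟨b, hbW, rfl⟩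
            · exact hb a (Or.inl ha) hak
            · exact bz
            · exact bx
            · simp only; omega
            · exact hb b (by simp [hbW]) ((swp_lt hpk hrk b).1 hak)
          · simp only [List.countP_append, List.countP_cons, swp_count hpk hrk]
            simp [hpk, hrk] at hc ⊢; omega
        · refine ⟨U ++ (z,r) :: (x,p) :: (y,p) :: W, ?_, ?_, ?_, ?_⟩
          · rw [List.map_append, List.map_cons, List.map_cons, List.map_cons, hU, hW]
          · simp only [List.pairwise_append, List.pairwise_cons, List.mem_cons, forall_eq_or_imp]
            refine ⟨pU, ⟨⟨?_, ?_, ?_⟩, ⟨?_, ?_⟩, ?_, pW⟩, ?_⟩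
            · intro e; exact absurd e hr
            · intro e; exact absurd e hr
            · intro a ha e e2; exact absurd e2 hrk
            · intro _ _; exact h1
            · exact xW
            · intro a ha
              have := zW a ha
              simp only [GR] at *; omega
            · intro a ha
              obtain ⟨q1, q2, q3, q4⟩ := pUW a ha
              refine ⟨?_, ?_, ?_, q4⟩
              · simp only [GR] at *; omega
              · simp only [GR] at *; omega
              · simp only [GR] at *; omega
          · intro a ha hak
            simp only [List.mem_append, List.mem_cons] at ha
            have bx := hb (x,p) (by simp) hpk
            have bz := hb (z,p) (by simp) hpk
            simp only at bx bz
            rcases ha with ha | rfl | rfl | rfl | ha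
            · exact hb a (Or.inl ha) hak
            · exact bz
            · exact bx
            · simp only; omega
            · exact hb a (by simp [ha]) hak
          · simp only [List.countP_append, List.countP_cons]
            simp [hpk, hrk] at hc ⊢; omega
      · refine ⟨U ++ (z,q) :: (x,p) :: (y,r) :: W, by simp [hU, hW], ?_, ?_, ?_⟩
        · simp only [List.pairwise_append, List.pairwise_cons, List.mem_cons, forall_eq_or_imp]
          refine ⟨pU, ⟨⟨?_, zy, zW⟩, ⟨xy, xW⟩, yW, pW⟩, fun a ha => ?_⟩
          · simp only [GR]; omega
          · obtain ⟨q1, q2, q3, q4⟩ := pUW a ha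
            exact ⟨q2, q1, q3, q4⟩
        · intro a ha
          apply hb
          simp only [List.mem_append, List.mem_cons] at ha ⊢; tauto
        · simp only [List.countP_append, List.countP_cons]; omega
    · rintro ⟨L, hL, hp, hb, hc⟩
      obtain ⟨U, p, q, r, W, rfl, hU, hW⟩ := split3 hL
      simp only [List.pairwise_append, List.pairwise_cons, List.mem_cons, forall_eq_or_imp, List.mem_append,
        List.countP_append, List.countP_cons] at hp hb hc
      obtain ⟨pU, ⟨⟨xz, xy, xW⟩, ⟨zy, zW⟩, yW, pW⟩, pUW⟩ := hp
      refine ⟨U ++ (x,q) :: (z,p) :: (y,r) :: W, by simp [hU, hW], ?_, ?_, ?_⟩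
      · simp only [List.pairwise_append, List.pairwise_cons, List.mem_cons, forall_eq_or_imp]
        refine ⟨pU, ⟨⟨?_, zy, zW⟩, ⟨xy, xW⟩, yW, pW⟩, fun a ha => ?_⟩
        · simp only [GR]; omega
        · obtain ⟨q1, q2, q3, q4⟩ := pUW a ha
          exact ⟨q2, q1, q3, q4⟩
      · intro a ha
        apply hb
        simp only [List.mem_append, List.mem_cons] at ha ⊢; tauto
      · simp only [List.countP_append, List.countP_cons]; omega
  | kyxz u w x y z h1 h2 =>
    constructor
    · rintro ⟨L, hL, hp, hb, hc⟩
      obtain ⟨U, p, q, r, W, rfl, hU, hW⟩ := split3 hL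
      simp only [List.pairwise_append, List.pairwise_cons, List.mem_cons, forall_eq_or_imp, List.mem_append,
        List.countP_append, List.countP_cons] at hp hb hc
      obtain ⟨pU, ⟨⟨yx, yz, yW⟩, ⟨xz, xW⟩, zW, pW⟩, pUW⟩ := hp
      by_cases hqr : q = r ∧ q < k
      · obtain ⟨rfl, hqk⟩ := hqr
        have hpq : p ≠ q := by
          rintro rfl
          have := yx rfl hqk; simp at this; omega
        by_cases hpk : p < k
        · refine ⟨U ++ (y,p) :: (z,p) :: (x,q) :: W.map (swp q p), ?_, ?_, ?_, ?_⟩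
          · rw [List.map_append, List.map_cons, List.map_cons, List.map_cons, swp_map, hU, hW]
          · simp only [List.pairwise_append, List.pairwise_cons, List.mem_cons, forall_eq_or_imp, List.mem_map,
              forall_exists_index, and_imp, forall_apply_eq_imp_iff₂]
            refine ⟨pU, ⟨⟨?_, ?_, ?_⟩, ⟨?_, ?_⟩, ?_, swp_pw hqk hpk pW⟩, ?_⟩
            · intro _ _; exact h2
            · intro e; exact absurd e hpq
            · intro a ha e _
              have := zW a ha; have := yW a ha
              simp only [GR, swp] at *
              split_ifs at * <;> omega
            · intro e; exact absurd e hpq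
            · intro a ha e _
              have := zW a ha; have := yW a ha
              simp only [GR, swp] at *
              split_ifs at * <;> omega
            · intro a ha e _
              have := zW a ha; have := yW a ha
              simp only [GR, swp] at *
              split_ifs at * <;> omega
            · intro a ha
              obtain ⟨q1, q2, q3, q4⟩ := pUW a ha
              refine ⟨?_, ?_, ?_, ?_⟩
              · simp only [GR] at *; omega
              · simp only [GR] at *; omega
              · simp only [GR] at *; omega
              · intro b hbW
                have := q4 b hbW
                have := zW b hbW; have := yW b hbW
                simp only [GR, swp] at *
                split_ifs at * <;> omega
          · intro a ha hak
            simp only [List.mem_append, List.mem_cons, List.mem_map] at ha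
            have bx := hb (x,q) (by simp) hqk
            have bz := hb (z,q) (by simp) hqk
            simp only at bx bz
            rcases ha with ha | rfl | rfl | rfl | ⟨b, hbW, rfl⟩
            · exact hb a (Or.inl ha) hak
            · simp only; omega
            · exact bz
            · exact bx
            · exact hb b (by simp [hbW]) ((swp_lt hqk hpk b).1 hak)
          · simp only [List.countP_append, List.countP_cons, swp_count hqk hpk]
            simp [hpk, hqk] at hc ⊢; omega
        · refine ⟨U ++ (y,q) :: (z,q) :: (x,p) :: W, ?_, ?_, ?_, ?_⟩
          · rw [List.map_append, List.map_cons, List.map_cons, List.map_cons, hU, hW]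
          · simp only [List.pairwise_append, List.pairwise_cons, List.mem_cons, forall_eq_or_imp]
            refine ⟨pU, ⟨⟨?_, ?_, ?_⟩, ⟨?_, ?_⟩, ?_, pW⟩, ?_⟩
            · intro _ _; exact h2
            · intro e; exact absurd e.symm hpq
            · intro a ha
              have := zW a ha
              simp only [GR] at *; omega
            · intro e; exact absurd e.symm hpq
            · exact zW
            · intro a ha e e2; exact absurd e2 hpk
            · intro a ha
              obtain ⟨q1, q2, q3, q4⟩ := pUW a ha
              refine ⟨?_, ?_, ?_, q4⟩
              · simp only [GR] at *; omega
              · simp only [GR] at *; omega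
              · simp only [GR] at *; omega
          · intro a ha hak
            simp only [List.mem_append, List.mem_cons] at ha
            have bx := hb (x,q) (by simp) hqk
            have bz := hb (z,q) (by simp) hqk
            simp only at bx bz
            rcases ha with ha | rfl | rfl | rfl | ha
            · exact hb a (Or.inl ha) hak
            · simp only; omega
            · exact bz
            · exact absurd hak hpk
            · exact hb a (by simp [ha]) hak
          · simp only [List.countP_append, List.countP_cons]
            simp [hpk, hqk] at hc ⊢; omega
      · refine ⟨U ++ (y,p) :: (z,r) :: (x,q) :: W, by simp [hU, hW], ?_, ?_, ?_⟩
        · simp only [List.pairwise_append, List.pairwise_cons, List.mem_cons, forall_eq_or_imp]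
          refine ⟨pU, ⟨⟨yz, yx, yW⟩, ⟨?_, zW⟩, xW, pW⟩, fun a ha => ?_⟩
          · simp only [GR]; omega
          · obtain ⟨q1, q2, q3, q4⟩ := pUW a ha
            exact ⟨q1, q3, q2, q4⟩
        · intro a ha
          apply hb
          simp only [List.mem_append, List.mem_cons] at ha ⊢; tauto
        · simp only [List.countP_append, List.countP_cons]; omega
    · rintro ⟨L, hL, hp, hb, hc⟩
      obtain ⟨U, p, q, r, W, rfl, hU, hW⟩ := split3 hL
      simp only [List.pairwise_append, List.pairwise_cons, List.mem_cons, forall_eq_or_imp, List.mem_append,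
        List.countP_append, List.countP_cons] at hp hb hc
      obtain ⟨pU, ⟨⟨yx, yz, yW⟩, ⟨xz, xW⟩, zW, pW⟩, pUW⟩ := hp
      refine ⟨U ++ (y,p) :: (x,r) :: (z,q) :: W, by simp [hU, hW], ?_, ?_, ?_⟩
      · simp only [List.pairwise_append, List.pairwise_cons, List.mem_cons, forall_eq_or_imp]
        refine ⟨pU, ⟨⟨yz, yx, yW⟩, ⟨?_, zW⟩, xW, pW⟩, fun a ha => ?_⟩
        · simp only [GR]; omega
        · obtain ⟨q1, q2, q3, q4⟩ := pUW a ha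
          exact ⟨q1, q3, q2, q4⟩
      · intro a ha
        apply hb
        simp only [List.mem_append, List.mem_cons] at ha ⊢; tauto
      · simp only [List.countP_append, List.countP_cons]; omega

theorem KnuthEquiv.gre {u w : List ℕ} (h : KnuthEquiv u w) (k v m : ℕ) : Gre k v u m ↔ Gre k v w m := by
  have := KnuthEquiv.inv (fun u => Gre k v u m) (fun _ _ h => propext (Gre_step h m)) h
  rw [this]
end Part3

section Part4
attribute [-instance] Classical.propDecidable
attribute [local instance 10] Classical.propDecidable

/-- concatenation of rows `n-1, …, 0` -/
def RW {α : Type*} (n : ℕ) (F : ℕ → List α) : List α := ((List.range n).reverse.map F).flatten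

theorem RW_zero {α : Type*} (F : ℕ → List α) : RW 0 F = [] := rfl
theorem RW_succ {α : Type*} (n : ℕ) (F : ℕ → List α) : RW (n+1) F = F n ++ RW n F := by
  simp [RW, List.range_succ]
theorem RW_shift {α : Type*} (n : ℕ) (F : ℕ → List α) : RW (n+1) F = RW n (fun i => F (i+1)) ++ F 0 := by
  induction n with
  | zero => simp [RW]
  | succ n ih => rw [RW_succ, ih, RW_succ, List.append_assoc]
theorem RW_ext {α : Type*} {n m : ℕ} (F : ℕ → List α) (hnm : n ≤ m) (h : ∀ i, n ≤ i → F i = []) : RW m F = RW n F := by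
  induction m, hnm using Nat.le_induction with
  | base => rfl
  | succ m hm ih => rw [RW_succ, h m hm, ih, List.nil_append]
theorem RW_eq {α : Type*} {n m : ℕ} (F : ℕ → List α) (h : ∀ i, n ≤ i → F i = []) (h' : ∀ i, m ≤ i → F i = []) :
    RW m F = RW n F := by
  rcases le_total n m with hh | hh
  · exact RW_ext F hh h
  · exact (RW_ext F hh h').symm
theorem RW_congr {α : Type*} {n : ℕ} {F G : ℕ → List α} (h : ∀ i, i < n → F i = G i) : RW n F = RW n G := by
  induction n with
  | zero => rfl
  | succ n ih => rw [RW_succ, RW_succ, h n (by omega), ih (fun i hi => h i (by omega))]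
theorem RW_split {α : Type*} {n i : ℕ} (F : ℕ → List α) (h : i < n) : ∃ p, RW n F = p ++ F i ++ RW i F := by
  induction n with
  | zero => omega
  | succ n ih =>
    rcases Nat.lt_succ_iff_lt_or_eq.1 h with h | rfl
    · obtain ⟨p, hp⟩ := ih h
      exact ⟨F n ++ p, by rw [RW_succ, hp]; simp⟩
    · exact ⟨[], by rw [RW_succ]; rfl⟩
theorem mem_RW {α : Type*} {n : ℕ} {F : ℕ → List α} {a : α} : a ∈ RW n F ↔ ∃ i < n, a ∈ F i := by
  simp [RW]
theorem RW_map {α β : Type*} (f : α → β) (n : ℕ) (F : ℕ → List α) : (RW n F).map f = RW n (fun i => (F i).map f) := by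
  induction n with
  | zero => rfl
  | succ n ih => rw [RW_succ, RW_succ, List.map_append, ih]
theorem RW_count {n : ℕ} (F : ℕ → List ℕ) (a : ℕ) : (RW n F).count a = ∑ i ∈ Finset.range n, (F i).count a := by
  induction n with
  | zero => rfl
  | succ n ih => rw [RW_succ, List.count_append, ih, Finset.sum_range_succ, add_comm]
theorem RW_length {α : Type*} {n : ℕ} (F : ℕ → List α) : (RW n F).length = ∑ i ∈ Finset.range n, (F i).length := by
  induction n with
  | zero => rfl
  | succ n ih => rw [RW_succ, List.length_append, ih, Finset.sum_range_succ, add_comm]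

/-! rows -/
theorem mem_rowList {s : Finset Cell} {i j : ℕ} : j ∈ rowList s i ↔ (i,j) ∈ s := by
  unfold rowList
  rw [List.mem_filter]
  simp only [List.mem_range, decide_eq_true_eq, and_iff_right_iff_imp]
  intro h
  exact Nat.lt_succ_of_le (Finset.le_sup (f := Prod.snd) h)

theorem rowList_sorted (s : Finset Cell) (i : ℕ) : (rowList s i).Pairwise (· < ·) := by
  unfold rowList
  exact List.Pairwise.filter _ List.pairwise_lt_range

theorem sorted_ext {l l' : List ℕ} (h : l.Pairwise (· < ·)) (h' : l'.Pairwise (· < ·)) (hm : ∀ a, a ∈ l ↔ a ∈ l') :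
    l = l' := by
  refine List.Perm.eq_of_pairwise (le := (· < ·)) ?_ h h' ?_
  · intro a b _ _ h1 h2; omega
  · exact (List.perm_ext_iff_of_nodup (h.imp (fun h => by omega)) (h'.imp (fun h => by omega))).2 hm

theorem rowList_nil {s : Finset Cell} {n i : ℕ} (h : AtMostRows s n) (hi : n ≤ i) : rowList s i = [] := by
  rw [List.eq_nil_iff_forall_not_mem]
  intro j hj
  have := h _ (mem_rowList.1 hj)
  simp only at this; omega

theorem amr_sup (s : Finset Cell) : AtMostRows s (s.sup Prod.fst + 1) := fun _ hc =>
  Nat.lt_succ_of_le (Finset.le_sup (f := Prod.fst) hc)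

/-- row length -/
def rl (s : Finset Cell) (i : ℕ) : ℕ := (rowList s i).length

theorem rl_card (s : Finset Cell) (i : ℕ) : rl s i = (s.filter (fun c => c.1 = i)).card := by
  unfold rl
  rw [← List.toFinset_card_of_nodup ((rowList_sorted s i).imp (fun h => by omega))]
  refine Finset.card_bij (fun j _ => (i,j)) ?_ ?_ ?_
  · intro j hj
    simp only [List.mem_toFinset, mem_rowList] at hj
    simp [hj]
  · intro a _ b _ h; exact (Prod.ext_iff.1 h).2
  · rintro ⟨a, b⟩ hb
    simp only [Finset.mem_filter] at hb
    obtain ⟨hb, rfl⟩ := hb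
    exact ⟨b, by simpa [mem_rowList] using hb, rfl⟩

theorem rowList_part {s : Finset Cell} (hs : IsPartitionShape s) (i : ℕ) : rowList s i = List.range (rl s i) := by
  obtain ⟨M, _, hM⟩ := exists_cut (fun j => (i,j) ∈ s) (s.sup Prod.snd + 1)
    (fun j h => Nat.lt_succ_of_le (Finset.le_sup (f := Prod.snd) h)) (fun j h => hs _ _ _ _ h le_rfl (by omega))
  have : rowList s i = List.range M := by
    refine sorted_ext (rowList_sorted s i) List.pairwise_lt_range ?_
    intro a
    rw [mem_rowList, hM, List.mem_range]
  unfold rl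
  rw [this, List.length_range]

theorem mem_part {s : Finset Cell} (hs : IsPartitionShape s) {i j : ℕ} : (i,j) ∈ s ↔ j < rl s i := by
  rw [← mem_rowList, rowList_part hs, List.mem_range]

theorem rl_anti {s : Finset Cell} (hs : IsPartitionShape s) : Antitone (rl s) := by
  intro i j hij
  by_contra h
  push Not at h
  have := (mem_part hs).2 h
  have := (mem_part hs).1 (hs _ _ _ _ this hij le_rfl)
  omega

theorem rl_zero {s : Finset Cell} {n i : ℕ} (h : AtMostRows s n) (hi : n ≤ i) : rl s i = 0 := by
  unfold rl; rw [rowList_nil h hi]; rfl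

theorem shp_rl {s : Finset Cell} (hs : IsPartitionShape s) {n : ℕ} (h : AtMostRows s n) :
    shp n (fun i => rl s i) = s := by
  ext ⟨i, j⟩
  rw [mem_shp, mem_part hs]
  by_cases hi : i < n
  · rw [extendf_lt _ hi]
  · rw [extendf_ge _ (by omega), rl_zero h (by omega)]

theorem part_shp {n : ℕ} {l : Fin n → ℕ} (hl : Antitone l) : IsPartitionShape (shp n l) := by
  intro i j i' j' h hi hj
  rw [mem_shp] at *
  simp only at *
  by_cases hin : i < n
  · rw [extendf_lt _ hin] at h
    rw [extendf_lt _ (by omega : i' < n)]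
    have := hl (show (⟨i', by omega⟩ : Fin n) ≤ ⟨i, hin⟩ from hi)
    omega
  · rw [extendf_ge _ (by omega)] at h; omega

theorem amr_shp {n : ℕ} (l : Fin n → ℕ) : AtMostRows (shp n l) n := by
  intro c hc
  rw [mem_shp] at hc
  by_contra h
  rw [extendf_ge _ (by omega)] at hc; omega

theorem reading_eq (s : Finset Cell) (T : Cell → ℕ) {n : ℕ} (h : AtMostRows s n) :
    readingWordOn s T = RW n (rowWordOn s T) := by
  refine RW_eq _ ?_ ?_
  · intro i hi; unfold rowWordOn; rw [rowList_nil h hi]; rfl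
  · intro i hi; unfold rowWordOn; rw [rowList_nil (amr_sup s) hi]; rfl

/-! SSYT facts -/
theorem row_mono {s : Finset Cell} {T : Cell → ℕ}
    (h : ∀ i j, (i, j) ∈ s → (i, j + 1) ∈ s → T (i, j) ≤ T (i, j + 1)) (hs : ∀ i j j' j'', (i,j) ∈ s → (i,j'') ∈ s →
      j ≤ j' → j' ≤ j'' → (i,j') ∈ s) {i j j' : ℕ} (hj : (i,j) ∈ s) (hj' : (i,j') ∈ s) (hle : j ≤ j') : T (i,j) ≤ T (i,j') := by
  induction j', hle using Nat.le_induction with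
  | base => exact le_rfl
  | succ m hm ih =>
    have := hs i j m (m+1) hj hj' hm (by omega)
    exact (ih this).trans (h _ _ this hj')

theorem part_conv {s : Finset Cell} (hs : IsPartitionShape s) : ∀ i j j' j'', (i,j) ∈ s → (i,j'') ∈ s →
      j ≤ j' → j' ≤ j'' → (i,j') ∈ s := fun _ _ _ _ _ h _ h2 => hs _ _ _ _ h le_rfl h2

theorem col_mono {s : Finset Cell} {T : Cell → ℕ} (hs : IsPartitionShape s) (hT : IsSSYTOn s T)
    {i i' j : ℕ} (h : (i',j) ∈ s) (hlt : i < i') : T (i,j) + (i' - i) ≤ T (i',j) := by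
  induction i', hlt using Nat.le_induction with
  | base =>
    have := hT.2.2.2 _ _ (hs _ _ i j h (by omega) le_rfl) h
    show T (i,j) + (i+1-i) ≤ T (i+1,j)
    omega
  | succ m hm ih =>
    have hm' := hs _ _ m j h (by omega) le_rfl
    have h1 := ih hm'
    have := hT.2.2.2 _ _ hm' h
    omega

theorem ssyt_ge {s : Finset Cell} {T : Cell → ℕ} (hs : IsPartitionShape s) (hT : IsSSYTOn s T)
    {i j : ℕ} (h : (i,j) ∈ s) : i + 1 ≤ T (i,j) := by
  have h0 := hT.1 _ (hs _ _ 0 j h (by omega) le_rfl)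
  rcases Nat.eq_zero_or_pos i with rfl | hi
  · exact h0
  · have := col_mono hs hT h hi
    omega

theorem ssyt_yam {s : Finset Cell} {T : Cell → ℕ} (hs : IsPartitionShape s) (hT : IsSSYTOn s T)
    (hY : IsYamanouchi (readingWordOn s T)) : ∀ i j, (i,j) ∈ s → T (i,j) = i + 1 := by
  intro i
  induction i using Nat.strong_induction_on with
  | _ i ih =>
  intro j hj
  have hge := ssyt_ge hs hT hj
  by_contra hne
  obtain ⟨a, ha⟩ : ∃ a, T (i,j) = a + 2 := ⟨T (i,j) - 2, by omega⟩
  obtain ⟨p, hp⟩ := RW_split (rowWordOn s T) (amr_sup s _ hj)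
  obtain ⟨l1, l2, hl⟩ := List.append_of_mem (mem_rowList.2 hj)
  have hsuf : (T (i,j) :: l2.map (fun j => T (i,j))) ++ RW i (rowWordOn s T) <:+ readingWordOn s T := by
    refine ⟨p ++ l1.map (fun j => T (i,j)), ?_⟩
    rw [reading_eq s T (amr_sup s), hp]
    simp only [rowWordOn]
    rw [hl]; simp
  have := yam_suffix hY hsuf a
  have h1 : 0 < List.count (a+2) ((T (i,j) :: l2.map (fun j => T (i,j))) ++ RW i (rowWordOn s T)) := by
    rw [List.count_pos_iff]; simp [ha]
  have h2 : List.count (a+1) ((T (i,j) :: l2.map (fun j => T (i,j))) ++ RW i (rowWordOn s T)) = 0 := by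
    rw [List.count_eq_zero]
    intro hmem
    rw [List.mem_append, List.mem_cons, List.mem_map, mem_RW] at hmem
    have hsort := rowList_sorted s i
    rw [hl, List.pairwise_append, List.pairwise_cons] at hsort
    rcases hmem with (hmem | ⟨j', hj', e⟩) | ⟨i', hi', hmem⟩
    · omega
    · have hlt := hsort.2.1.1 j' hj'
      have : (i,j') ∈ s := by rw [← mem_rowList, hl]; simp [hj']
      have := row_mono hT.2.2.1 (part_conv hs) hj this hlt.le
      omega
    · simp only [rowWordOn, List.mem_map, mem_rowList] at hmem
      obtain ⟨j', hj', e⟩ := hmem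
      have := ih i' hi' j' hj'
      omega
  omega
end Part4

section Part5
attribute [-instance] Classical.propDecidable
attribute [local instance 10] Classical.propDecidable

/-! Greene invariants of tableaux -/
def cellsOf (s : Finset Cell) : List Cell := RW (s.sup Prod.fst + 1) (fun i => (rowList s i).map (fun j => (i,j)))

theorem mem_cellsOf {s : Finset Cell} {c : Cell} : c ∈ cellsOf s ↔ c ∈ s := by
  unfold cellsOf
  simp only [mem_RW, List.mem_map, mem_rowList]
  constructor
  · rintro ⟨i, _, j, h, rfl⟩; exact h
  · intro h; exact ⟨c.1, amr_sup s c h, c.2, h, rfl⟩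

theorem RW_pairwise {α : Type*} (r : α → α → Prop) (n : ℕ) (F : ℕ → List α) (h1 : ∀ i < n, (F i).Pairwise r)
    (h2 : ∀ i j, i < j → ∀ a ∈ F j, ∀ b ∈ F i, r a b) : (RW n F).Pairwise r := by
  induction n with
  | zero => exact List.Pairwise.nil
  | succ n ih =>
    rw [RW_succ, List.pairwise_append]
    refine ⟨h1 n (by omega), ih (fun i hi => h1 i (by omega)), ?_⟩
    intro a ha b hb
    obtain ⟨i, hi, hb⟩ := mem_RW.1 hb
    exact h2 i n hi a ha b hb

theorem cells_pw (s : Finset Cell) : (cellsOf s).Pairwise (fun c d => d.1 < c.1 ∨ (c.1 = d.1 ∧ c.2 < d.2)) := by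
  refine RW_pairwise _ _ _ ?_ ?_
  · intro i _
    rw [List.pairwise_map]
    exact (rowList_sorted s i).imp (fun h => Or.inr ⟨rfl, h⟩)
  · intro i j hij a ha b hb
    simp only [List.mem_map] at ha hb
    obtain ⟨_, _, rfl⟩ := ha; obtain ⟨_, _, rfl⟩ := hb
    exact Or.inl hij

theorem cells_nodup (s : Finset Cell) : (cellsOf s).Nodup := by
  refine (cells_pw s).imp ?_
  rintro ⟨a, b⟩ ⟨c, d⟩ h e
  rw [Prod.mk.injEq] at e; simp only at h; omega

theorem cells_toFinset (s : Finset Cell) : (cellsOf s).toFinset = s := by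
  ext c; rw [List.mem_toFinset, mem_cellsOf]

theorem reading_cells (s : Finset Cell) (T : Cell → ℕ) : readingWordOn s T = (cellsOf s).map T := by
  unfold cellsOf
  rw [reading_eq s T (amr_sup s), RW_map]
  refine RW_congr fun i _ => ?_
  unfold rowWordOn
  rw [List.map_map]; rfl

theorem cells_countP (s : Finset Cell) (p : Cell → Prop) [DecidablePred p] :
    (cellsOf s).countP (fun c => decide (p c)) = (s.filter p).card := by
  rw [List.countP_eq_length_filter, ← List.toFinset_card_of_nodup ((cells_nodup s).filter _), List.toFinset_filter,
    cells_toFinset]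
  congr 1
  ext c; simp

theorem lift_list {α : Type*} [DecidableEq α] (l : List α) (hl : l.Nodup) (P : α → ℕ) (L : List (ℕ × ℕ))
    (h : L.map Prod.fst = l.map P) : ∃ f : α → ℕ, L = l.map (fun c => (P c, f c)) := by
  induction l generalizing L with
  | nil => exact ⟨fun _ => 0, by simpa using h⟩
  | cons a l ih =>
    obtain ⟨p, L', rfl, hp, hL⟩ := List.map_eq_cons_iff.1 h
    obtain ⟨f, hf⟩ := ih (List.nodup_cons.1 hl).2 L' hL
    refine ⟨Function.update f a p.2, ?_⟩
    rw [List.map_cons, hf]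
    congr 1
    · simp [← hp]
    · refine List.map_congr_left fun c hc => ?_
      have : c ≠ a := fun e => (List.nodup_cons.1 hl).1 (e ▸ hc)
      simp [this]

def tgt (s : Finset Cell) (P : Cell → ℕ) (k v : ℕ) : Finset Cell := s.filter (fun c => c.1 < k ∧ P c ≤ v)

theorem gre_attain {s : Finset Cell} {P : Cell → ℕ} (hs : IsPartitionShape s) (hP : IsSSYTOn s P) (k v : ℕ) :
    Gre k v (readingWordOn s P) (tgt s P k v).card := by
  refine ⟨(cellsOf s).map (fun c => (P c, if c.1 < k ∧ P c ≤ v then c.1 else k)), ?_, ?_, ?_, ?_⟩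
  · rw [reading_cells, List.map_map]; rfl
  · rw [List.pairwise_map]
    have h1 : (cellsOf s).Pairwise (fun c d => c ∈ s ∧ d ∈ s ∧ (d.1 < c.1 ∨ (c.1 = d.1 ∧ c.2 < d.2))) := by
      refine List.Pairwise.imp_of_mem ?_ (cells_pw s)
      intro a b ha hb h
      exact ⟨mem_cellsOf.1 ha, mem_cellsOf.1 hb, h⟩
    refine h1.imp ?_
    rintro ⟨i, j⟩ ⟨i', j'⟩ ⟨hc, hd, h⟩ e hk
    simp only at h e hk ⊢
    split_ifs at e hk with g1 g2
    · subst e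
      have : j < j' := by omega
      exact row_mono hP.2.2.1 (part_conv hs) hc hd this.le
    · omega
    · omega
    · omega
  · intro a ha hk
    rw [List.mem_map] at ha
    obtain ⟨c, hc, rfl⟩ := ha
    simp only at hk ⊢
    split_ifs at hk with g
    · exact g.2
    · omega
  · rw [List.countP_map]
    have := cells_countP s (fun c => c.1 < k ∧ P c ≤ v)
    unfold tgt
    rw [← this]
    congr 1
    funext c
    simp only [Function.comp]
    congr 1
    apply propext
    split_ifs with g
    · exact ⟨fun _ => g, fun _ => g.1⟩
    · exact ⟨fun h => absurd h (lt_irrefl _), fun h => absurd h g⟩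

theorem gre_upper {s : Finset Cell} {P : Cell → ℕ} (hs : IsPartitionShape s) (hP : IsSSYTOn s P) (k v m : ℕ)
    (h : Gre k v (readingWordOn s P) m) : m ≤ (tgt s P k v).card := by
  obtain ⟨L, hL, hp, hb, hc⟩ := h
  rw [reading_cells] at hL
  obtain ⟨f, rfl⟩ := lift_list _ (cells_nodup s) P L hL
  rw [List.countP_map] at hc
  have hS := cells_countP s (fun c => f c < k)
  have : m = (s.filter (fun c => f c < k)).card := by
    rw [← hS, ← hc]; rfl
  rw [this]
  have hv : ∀ c ∈ s, f c < k → P c ≤ v := fun c hc hk =>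
    hb (P c, f c) (List.mem_map.2 ⟨c, mem_cellsOf.2 hc, rfl⟩) hk
  have hcol : ∀ i i' j, (i,j) ∈ s → (i',j) ∈ s → i < i' → f (i',j) < k → f (i',j) ≠ f (i,j) := by
    intro i i' j h1 h2 hlt hk e
    rw [List.pairwise_map] at hp
    have hmem : ∀ c d, c ∈ cellsOf s → d ∈ cellsOf s → (d.1 < c.1 ∨ (c.1 = d.1 ∧ c.2 < d.2)) →
        GR k (P c, f c) (P d, f d) := by
      intro c d hc hd hlt
      obtain ⟨l1, l2, hl⟩ := List.append_of_mem hc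
      have hpw := cells_pw s
      rw [hl] at hp hd hpw
      rw [List.pairwise_append, List.pairwise_cons] at hp hpw
      rw [List.mem_append, List.mem_cons] at hd
      rcases hd with hd | rfl | hd
      · have := hpw.2.2 d hd c (by simp)
        omega
      · omega
      · exact hp.2.1.1 d hd
    have := hmem (i',j) (i,j) (mem_cellsOf.2 h2) (mem_cellsOf.2 h1) (Or.inl hlt) e hk
    have := col_mono hs hP h2 hlt
    simp only at *
    omega
  set C := s.image Prod.snd with hC
  have m1 : ∀ c ∈ s.filter (fun c => f c < k), c.2 ∈ C := fun c hc =>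
    Finset.mem_image_of_mem _ (Finset.mem_filter.1 hc).1
  have m2 : ∀ c ∈ tgt s P k v, c.2 ∈ C := fun c hc =>
    Finset.mem_image_of_mem _ (Finset.mem_filter.1 hc).1
  rw [Finset.card_eq_sum_card_fiberwise m1, Finset.card_eq_sum_card_fiberwise m2]
  refine Finset.sum_le_sum fun j _ => ?_
  by_cases hrow : ∃ i, k ≤ i ∧ (i,j) ∈ s ∧ f (i,j) < k
  · obtain ⟨i, hki, hij, hfi⟩ := hrow
    have u1 : ((s.filter (fun c => f c < k)).filter (fun c => c.2 = j)).card ≤ k := by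
      refine (Finset.card_le_card_of_injOn (t := Finset.range k) f ?_ ?_).trans_eq (Finset.card_range k)
      · intro c hc
        simp only [Finset.coe_filter, Finset.mem_filter, Set.mem_ofPred_eq] at hc
        simpa using hc.1.2
      · rintro ⟨a, b⟩ hc ⟨a', b'⟩ hd e
        simp only [Finset.coe_filter, Finset.mem_filter, Set.mem_ofPred_eq] at hc hd
        obtain ⟨⟨hc1, hc2⟩, rfl⟩ := hc
        obtain ⟨⟨hd1, hd2⟩, rfl⟩ := hd
        rcases lt_trichotomy a a' with hlt | rfl | hlt
        · exact absurd e.symm (hcol _ _ _ hc1 hd1 hlt hd2)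
        · rfl
        · exact absurd e (hcol _ _ _ hd1 hc1 hlt hc2)
    refine u1.trans ?_
    have : (Finset.range k).image (fun a => (a,j)) ⊆ (tgt s P k v).filter (fun c => c.2 = j) := by
      intro c hc
      obtain ⟨a, ha, rfl⟩ := Finset.mem_image.1 hc
      rw [Finset.mem_range] at ha
      have ha' : (a,j) ∈ s := hs _ _ _ _ hij (by omega) le_rfl
      have := col_mono hs hP hij (by omega : a < i)
      have := hv _ hij hfi
      simp only [tgt, Finset.mem_filter, ha', true_and, and_true, ha]
      omega
    calc k = ((Finset.range k).image (fun a => (a,j))).card := by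
            rw [Finset.card_image_of_injective _ (fun a b h => (Prod.ext_iff.1 h).1), Finset.card_range]
      _ ≤ _ := Finset.card_le_card this
  · push Not at hrow
    refine Finset.card_le_card ?_
    rintro ⟨a, b⟩ hc
    simp only [Finset.mem_filter, tgt] at hc ⊢
    obtain ⟨⟨h1, h2⟩, rfl⟩ := hc
    refine ⟨⟨h1, ?_, hv _ h1 h2⟩, rfl⟩
    by_contra hk
    have := hrow a (by omega) h1
    omega

theorem tgt_succ (s : Finset Cell) (P : Cell → ℕ) (k v : ℕ) :
    (tgt s P (k+1) v).card = (tgt s P k v).card + (s.filter (fun c => c.1 = k ∧ P c ≤ v)).card := by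
  rw [← Finset.card_union_of_disjoint]
  · congr 1
    ext c
    simp only [tgt, Finset.mem_union, Finset.mem_filter]
    constructor
    · rintro ⟨h, h1, h2⟩
      rcases Nat.lt_succ_iff_lt_or_eq.1 h1 with h1 | h1
      · exact Or.inl ⟨h, h1, h2⟩
      · exact Or.inr ⟨h, h1, h2⟩
    · rintro (⟨h, h1, h2⟩ | ⟨h, h1, h2⟩)
      · exact ⟨h, by omega, h2⟩
      · exact ⟨h, by omega, h2⟩
  · rw [Finset.disjoint_left]
    intro c h1 h2
    simp only [tgt, Finset.mem_filter] at h1 h2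
    omega

/-- `NN s T i v` number of cells of row `i` with entry at most `v` -/
def NN (s : Finset Cell) (T : Cell → ℕ) (i v : ℕ) : ℕ := (s.filter (fun c => c.1 = i ∧ T c ≤ v)).card

theorem NN_spec {s : Finset Cell} {T : Cell → ℕ} (hs : IsPartitionShape s)
    (hT : ∀ i j, (i,j+1) ∈ s → T (i,j) ≤ T (i,j+1)) {i j v : ℕ} : (i,j) ∈ s ∧ T (i,j) ≤ v ↔ j < NN s T i v := by
  obtain ⟨M, _, hM⟩ := exists_cut (fun j => (i,j) ∈ s ∧ T (i,j) ≤ v) (s.sup Prod.snd + 1)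
    (fun j h => Nat.lt_succ_of_le (Finset.le_sup (f := Prod.snd) h.1))
    (fun j h => ⟨hs _ _ _ _ h.1 le_rfl (by omega), (hT _ _ h.1).trans h.2⟩)
  have : NN s T i v = M := by
    unfold NN
    have : s.filter (fun c => c.1 = i ∧ T c ≤ v) = (Finset.range M).image (fun j => (i,j)) := by
      ext ⟨a, b⟩
      simp only [Finset.mem_filter, Finset.mem_image, Finset.mem_range, Prod.mk.injEq]
      constructor
      · rintro ⟨h1, rfl, h2⟩; exact ⟨b, (hM b).1 ⟨h1, h2⟩, rfl, rfl⟩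
      · rintro ⟨b, h, rfl, rfl⟩; have := (hM b).2 h; exact ⟨this.1, rfl, this.2⟩
    rw [this, Finset.card_image_of_injective _ (fun a b h => (Prod.ext_iff.1 h).2), Finset.card_range]
  rw [this]; exact hM j

theorem ssyt_rowmono {s : Finset Cell} {P : Cell → ℕ} (hs : IsPartitionShape s) (hP : IsSSYTOn s P) :
    ∀ i j, (i,j+1) ∈ s → P (i,j) ≤ P (i,j+1) := fun i j h =>
  hP.2.2.1 i j (hs _ _ _ _ h le_rfl (by omega)) h

theorem ssyt_unique {s s' : Finset Cell} {P P' : Cell → ℕ} (hs : IsPartitionShape s) (hP : IsSSYTOn s P)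
    (hs' : IsPartitionShape s') (hP' : IsSSYTOn s' P')
    (h : KnuthEquiv (readingWordOn s P) (readingWordOn s' P')) : s = s' ∧ P = P' := by
  have h1 : ∀ k v, (tgt s P k v).card = (tgt s' P' k v).card := by
    intro k v
    apply le_antisymm
    · exact gre_upper hs' hP' k v _ ((h.gre k v _).1 (gre_attain hs hP k v))
    · exact gre_upper hs hP k v _ ((h.gre k v _).2 (gre_attain hs' hP' k v))
  have h2 : ∀ k v, NN s P k v = NN s' P' k v := by
    intro k v
    have := tgt_succ s P k v
    have := tgt_succ s' P' k v
    have := h1 k v; have := h1 (k+1) v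
    unfold NN; omega
  have h3 : ∀ i j v, (i,j) ∈ s ∧ P (i,j) ≤ v ↔ (i,j) ∈ s' ∧ P' (i,j) ≤ v := by
    intro i j v
    rw [NN_spec hs (ssyt_rowmono hs hP), NN_spec hs' (ssyt_rowmono hs' hP'), h2]
  have h4 : s = s' := by
    ext ⟨i, j⟩
    exact ⟨fun h => ((h3 i j _).1 ⟨h, le_rfl⟩).1, fun h => ((h3 i j _).2 ⟨h, le_rfl⟩).1⟩
  refine ⟨h4, ?_⟩
  subst h4
  funext ⟨i, j⟩
  by_cases hc : (i,j) ∈ s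
  · exact le_antisymm ((h3 i j _).2 ⟨hc, le_rfl⟩).2 ((h3 i j _).1 ⟨hc, le_rfl⟩).2
  · rw [hP.2.1 _ hc, hP'.2.1 _ hc]

/-! RPP words -/
def kept (s : Finset Cell) (R : Cell → ℕ) (i : ℕ) : List ℕ :=
  ((rowList s i).filter (fun j => decide ((i + 1, j) ∉ s ∨ R (i + 1, j) ≠ R (i, j)))).map (fun j => R (i, j))

def circ (s : Finset Cell) (R : Cell → ℕ) (i : ℕ) : List ℕ :=
  ((rowList s i).filter (fun j => decide (rppCircled s R (i, j)))).map (fun j => R (i, j))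

theorem kept_nil {s : Finset Cell} {R} {n i : ℕ} (h : AtMostRows s n) (hi : n ≤ i) : kept s R i = [] := by
  unfold kept; rw [rowList_nil h hi]; rfl
theorem rowWord_eq {s : Finset Cell} {R} {n : ℕ} (h : AtMostRows s n) : rppRowWord s R = RW n (kept s R) := by
  have : rppRowWord s R = RW (s.sup Prod.fst + 1) (kept s R) := by
    unfold rppRowWord RW kept; congr!
  rw [this]
  exact RW_eq _ (fun i hi => kept_nil h hi) (fun i hi => kept_nil (amr_sup s) hi)

theorem heights_eq {s : Finset Cell} {R} {n : ℕ} (h : AtMostRows s n) :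
    rppHeights s R = RW n (fun i => List.replicate (kept s R i).length (i+1)) := by
  have : rppHeights s R = RW (s.sup Prod.fst + 1) (fun i => List.replicate (kept s R i).length (i+1)) := by
    unfold rppHeights RW kept
    simp only [List.length_map, List.map_const']
    congr!
  rw [this]
  exact RW_eq _ (fun i hi => by rw [kept_nil h hi]; rfl) (fun i hi => by rw [kept_nil (amr_sup s) hi]; rfl)

theorem circWord_eq {s : Finset Cell} {R} : rppReadingWord s R = RW (s.sup Prod.fst + 1) (circ s R) := by
  unfold rppReadingWord RW circ; congr!

theorem range_split {a b : ℕ} (h : a ≤ b) : List.range b = List.range a ++ (List.range (b-a)).map (a + ·) := by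
  rw [← List.range_add]; congr 1; omega

theorem two_rows_rpp {s : Finset Cell} {R : Cell → ℕ} (hs : IsPartitionShape s) (hR : IsRPPOn s R) (i : ℕ) :
    KnuthEquiv (rowWordOn s R (i+1) ++ kept s R i) (circ s R (i+1) ++ rowWordOn s R i) := by
  obtain ⟨r1, r2, r3, r4⟩ := hR
  set a := rl s (i+1) with ha
  set b := rl s i with hb
  have hab : a ≤ b := rl_anti hs (by omega)
  set ps := (List.range a).map (fun j => (R (i,j), R (i+1,j))) with hps
  have e1 : rowWordOn s R (i+1) = ps.map Prod.snd := by
    unfold rowWordOn; rw [rowList_part hs, hps, List.map_map]; rfl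
  have e2 : rowWordOn s R i = ps.map Prod.fst ++ ((List.range (b-a)).map (a + ·)).map (fun j => R (i,j)) := by
    unfold rowWordOn; rw [rowList_part hs, ← hb, range_split hab, hps, List.map_map, List.map_append]; rfl
  have e3 : kept s R i = (ps.filter (fun p => decide (p.2 ≠ p.1))).map Prod.fst ++
      ((List.range (b-a)).map (a + ·)).map (fun j => R (i,j)) := by
    unfold kept
    rw [rowList_part hs, ← hb, range_split hab, hps, List.filter_map, List.map_map, List.filter_append, List.map_append]
    congr 1
    · have : ∀ j ∈ List.range a, decide ((i + 1, j) ∉ s ∨ R (i + 1, j) ≠ R (i, j)) =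
          ((fun p : ℕ × ℕ => decide (p.2 ≠ p.1)) ∘ fun j => (R (i,j), R (i+1,j))) j := by
        intro j hj
        have : (i+1,j) ∈ s := (mem_part hs).2 (List.mem_range.1 hj)
        simp [this]
      rw [List.filter_congr this]; rfl
    · congr 1
      rw [List.filter_eq_self]
      intro j hj
      obtain ⟨k, _, rfl⟩ := List.mem_map.1 hj
      have : (i+1,a+k) ∉ s := by rw [mem_part hs]; omega
      simp [this]
  have e4 : circ s R (i+1) = (ps.filter (fun p => decide (p.1 ≠ p.2))).map Prod.snd := by
    unfold circ
    rw [rowList_part hs, hps, List.filter_map, List.map_map]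
    have : ∀ j ∈ List.range a, decide (rppCircled s R (i+1,j)) =
          ((fun p : ℕ × ℕ => decide (p.1 ≠ p.2)) ∘ fun j => (R (i,j), R (i+1,j))) j := by
        intro j hj
        have h1 : (i+1,j) ∈ s := (mem_part hs).2 (List.mem_range.1 hj)
        have h2 : (i,j) ∈ s := hs _ _ _ _ h1 (by omega) le_rfl
        simp [rppCircled, h1, h2]
    rw [← ha, List.filter_congr this]; rfl
  have hsort : ∀ i', (rowWordOn s R i').Pairwise (· ≤ ·) := by
    intro i'
    unfold rowWordOn
    rw [List.pairwise_map]
    refine List.Pairwise.imp_of_mem ?_ (rowList_sorted s i')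
    intro x y hx hy hxy
    exact row_mono r3 (part_conv hs) (mem_rowList.1 hx) (mem_rowList.1 hy) hxy.le
  have key := two_row ps [] ?_ ?_ ?_
  · have := key.append_right (((List.range (b-a)).map (a + ·)).map (fun j => R (i,j)))
    rw [e1, e2, e3, e4]
    simpa using this
  · intro p hp
    obtain ⟨j, hj, rfl⟩ := List.mem_map.1 hp
    have h1 : (i+1,j) ∈ s := (mem_part hs).2 (List.mem_range.1 hj)
    exact r4 _ _ (hs _ _ _ _ h1 (by omega) le_rfl) h1
  · have := hsort i
    rw [e2] at this
    simpa using (List.pairwise_append.1 this).1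
  · rw [← e1]; exact hsort _

theorem circ_kept {s : Finset Cell} {R : Cell → ℕ} (hs : IsPartitionShape s) (hR : IsRPPOn s R) :
    KnuthEquiv (rppReadingWord s R) (rppRowWord s R) := by
  have h1 : ∀ m, KnuthEquiv (rowWordOn s R m ++ RW m (kept s R)) (RW (m+1) (circ s R)) := by
    intro m
    induction m with
    | zero =>
      rw [RW_zero, RW_succ, RW_zero]
      have : rowWordOn s R 0 = circ s R 0 := by
        unfold rowWordOn circ
        rw [List.filter_eq_self.2]
        intro j hj
        have := mem_rowList.1 hj
        simp [rppCircled, this]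
      rw [this]; exact KnuthEquiv.refl _
    | succ m ih =>
      rw [RW_succ, RW_succ (m+1), ← List.append_assoc]
      refine ((two_rows_rpp hs hR m).append_right _).trans ?_
      rw [List.append_assoc]
      exact ih.append_left _
  rw [circWord_eq, rowWord_eq (amr_sup s)]
  refine (h1 _).symm.trans ?_
  rw [RW_succ]
  have : rowWordOn s R (s.sup Prod.fst) = kept s R (s.sup Prod.fst) := by
    unfold rowWordOn kept
    rw [List.filter_eq_self.2]
    intro j hj
    have : (s.sup Prod.fst + 1, j) ∉ s := fun h => by have := amr_sup s _ h; simp at this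
    simp [this]
  rw [this]; exact KnuthEquiv.refl _
end Part5

section Part6
attribute [-instance] Classical.propDecidable
attribute [local instance 10] Classical.propDecidable

def mkRow (n : ℕ) (f : ℕ → ℕ) : List ℕ := (List.range n).flatMap (fun i => List.replicate (f i) (i+1))

theorem mkRow_succ (n : ℕ) (f : ℕ → ℕ) : mkRow (n+1) f = mkRow n f ++ List.replicate (f n) (n+1) := by
  simp [mkRow, List.range_succ]

theorem mem_mkRow {n : ℕ} {f : ℕ → ℕ} {a : ℕ} (h : a ∈ mkRow n f) : 1 ≤ a ∧ a ≤ n := by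
  simp only [mkRow, List.mem_flatMap, List.mem_range, List.mem_replicate] at h
  obtain ⟨i, hi, _, rfl⟩ := h; omega

theorem mkRow_sorted (n : ℕ) (f : ℕ → ℕ) : (mkRow n f).Pairwise (· ≤ ·) := by
  induction n with
  | zero => exact List.Pairwise.nil
  | succ n ih =>
    rw [mkRow_succ, List.pairwise_append]
    refine ⟨ih, List.pairwise_replicate.2 (Or.inr le_rfl), ?_⟩
    intro a ha b hb
    have := mem_mkRow ha
    have := (List.mem_replicate.1 hb).2
    omega

theorem mkRow_count (n : ℕ) (f : ℕ → ℕ) (i : ℕ) : (mkRow n f).count (i+1) = if i < n then f i else 0 := by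
  induction n with
  | zero => simp [mkRow]
  | succ n ih =>
    rw [mkRow_succ, List.count_append, ih, List.count_replicate]
    simp only [beq_iff_eq, Nat.add_right_cancel_iff]
    rcases lt_trichotomy i n with h | rfl | h
    · rw [if_pos h, if_neg (by omega), if_pos (by omega)]; rfl
    · rw [if_neg (by omega), if_pos rfl, if_pos (by omega), Nat.zero_add]
    · rw [if_neg (by omega), if_neg (by omega), if_neg (by omega)]

theorem sorted_mkRow {n : ℕ} {l : List ℕ} (hs : l.Pairwise (· ≤ ·)) (hl : ∀ a ∈ l, 1 ≤ a ∧ a ≤ n) :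
    mkRow n (fun i => l.count (i+1)) = l := by
  refine List.Perm.eq_of_pairwise (le := (· ≤ ·)) (fun a b _ _ h1 h2 => le_antisymm h1 h2) (mkRow_sorted _ _) hs ?_
  rw [List.perm_iff_count]
  intro a
  cases a with
  | zero =>
    rw [List.count_eq_zero.2, List.count_eq_zero.2]
    · intro h; have := hl _ h; omega
    · intro h; have := mem_mkRow h; omega
  | succ a =>
    rw [mkRow_count]
    split_ifs with h
    · rfl
    · symm; rw [List.count_eq_zero]; intro h'; have := hl _ h'; omega

/-! the row-state action -/
def dA (l : ℕ) (F : ℕ → ℕ) (u : ℕ) : ℕ := if u < l then max (F u) (F (l-1) + 1) else F u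

theorem dA_anti {F : ℕ → ℕ} (hF : Antitone F) (l : ℕ) : Antitone (dA l F) := by
  intro a b hab
  have h1 := hF hab
  unfold dA
  split_ifs with h2 h3 h4
  · omega
  · omega
  · omega
  · exact h1

theorem dA_fold_anti {F : ℕ → ℕ} (hF : Antitone F) (w : List ℕ) : Antitone (w.foldr dA F) := by
  induction w with
  | nil => exact hF
  | cons a w ih => exact dA_anti ih a

theorem dA_step1 {F : ℕ → ℕ} (hF : Antitone F) {x y z : ℕ} (h1 : x ≤ y) (h2 : y < z) :
    dA x (dA z (dA y F)) = dA z (dA x (dA y F)) := by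
  funext u
  rcases Nat.eq_zero_or_pos x with rfl | hx
  · simp [dA]
  have a1 := hF (show x - 1 ≤ y - 1 by omega)
  have a2 := hF (show y - 1 ≤ z - 1 by omega)
  have b1 : u < x → F (x-1) ≤ F u := fun h => hF (by omega)
  have b2 : u < y → F (y-1) ≤ F u := fun h => hF (by omega)
  have b3 : u < z → F (z-1) ≤ F u := fun h => hF (by omega)
  have c1 : x - 1 < z := by omega
  have c2 : x - 1 < y := by omega
  have c3 : ¬ (z - 1 < x) := by omega
  have c4 : ¬ (z - 1 < y) := by omega
  simp only [dA, c1, c2, c3, c4, if_true, if_false]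
  by_cases hu1 : u < x <;> by_cases hu2 : u < y <;> by_cases hu3 : u < z <;>
    simp only [hu1, hu2, hu3, if_true, if_false] <;> omega

theorem dA_step2 {F : ℕ → ℕ} (hF : Antitone F) {x y z : ℕ} (h1 : x < y) (h2 : y ≤ z) :
    dA y (dA x (dA z F)) = dA y (dA z (dA x F)) := by
  funext u
  rcases Nat.eq_zero_or_pos x with rfl | hx
  · simp [dA]
  have a1 := hF (show x - 1 ≤ y - 1 by omega)
  have a2 := hF (show y - 1 ≤ z - 1 by omega)
  have b1 : u < x → F (x-1) ≤ F u := fun h => hF (by omega)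
  have b2 : u < y → F (y-1) ≤ F u := fun h => hF (by omega)
  have b3 : u < z → F (z-1) ≤ F u := fun h => hF (by omega)
  have c1 : x - 1 < z := by omega
  have c2 : ¬ (y - 1 < x) := by omega
  have c3 : ¬ (z - 1 < x) := by omega
  have c4 : y - 1 < z := by omega
  simp only [dA, c1, c2, c3, c4, if_true, if_false]
  by_cases hu1 : u < x <;> by_cases hu2 : u < y <;> by_cases hu3 : u < z <;>
    simp only [hu1, hu2, hu3, if_true, if_false] <;> omega

theorem KnuthEquiv.dA {F : ℕ → ℕ} (hF : Antitone F) {u v : List ℕ} (h : KnuthEquiv u v) :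
    u.foldr dA F = v.foldr SkewG.dA F := by
  refine KnuthEquiv.inv (fun u => u.foldr SkewG.dA F) ?_ h
  intro u v h
  cases h with
  | kxzy u w x y z h1 h2 =>
    simp only [List.foldr_append, List.foldr_cons]
    rw [dA_step1 (dA_fold_anti hF w) h1 h2]
  | kyxz u w x y z h1 h2 =>
    simp only [List.foldr_append, List.foldr_cons]
    rw [dA_step2 (dA_fold_anti hF w) h1 h2]

theorem dA_replicate {F : ℕ → ℕ} (hF : Antitone F) (n k u : ℕ) :
    (List.replicate k (n+1)).foldr dA F u = if u ≤ n then max (F u) (F n + k) else F u := by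
  induction k generalizing u with
  | zero =>
    simp only [List.replicate_zero, List.foldr_nil]
    split_ifs with h
    · have := hF h; omega
    · rfl
  | succ k ih =>
    rw [List.replicate_succ, List.foldr_cons]
    change (if u < n + 1 then max ((List.replicate k (n+1)).foldr dA F u)
      ((List.replicate k (n+1)).foldr dA F (n+1-1) + 1) else (List.replicate k (n+1)).foldr dA F u) = _
    rw [Nat.add_sub_cancel, ih, ih]
    split_ifs <;> omega

theorem dA_mkRow {F : ℕ → ℕ} (hF : Antitone F) (n : ℕ) (f : ℕ → ℕ) :
    (∀ u, u < n → (mkRow n f).foldr dA F u = max (F u) ((mkRow n f).foldr dA F (u+1)) + f u) ∧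
    (∀ u, n ≤ u → (mkRow n f).foldr dA F u = F u) := by
  induction n generalizing F with
  | zero => exact ⟨fun u h => absurd h (by omega), fun u _ => rfl⟩
  | succ n ih =>
    rw [mkRow_succ, List.foldr_append]
    set F' := (List.replicate (f n) (n+1)).foldr dA F with hF'
    have hA : Antitone F' := dA_fold_anti hF _
    have hv := dA_replicate hF n (f n)
    rw [← hF'] at hv
    obtain ⟨i1, i2⟩ := ih hA
    have hG := dA_fold_anti hA (mkRow n f)
    constructor
    · intro u hu
      rcases Nat.lt_succ_iff_lt_or_eq.1 hu with hu | rfl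
      · rw [i1 u hu, hv u, if_pos (by omega)]
        have e1 := hG (show u + 1 ≤ n by omega)
        rw [i2 n le_rfl, hv n, if_pos le_rfl] at e1
        omega
      · rw [i2 u le_rfl, i2 (u+1) (by omega), hv, hv, if_pos le_rfl, if_neg (by omega)]
        have := hF (show u ≤ u+1 by omega)
        omega
    · intro u hu
      rw [i2 u (by omega), hv, if_neg (by omega)]

theorem dA_unique {F : ℕ → ℕ} (hF : Antitone F) (n : ℕ) (f : ℕ → ℕ) (G : ℕ → ℕ)
    (h1 : ∀ u, u < n → G u = max (F u) (G (u+1)) + f u) (h2 : ∀ u, n ≤ u → G u = F u) :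
    (mkRow n f).foldr dA F = G := by
  obtain ⟨i1, i2⟩ := dA_mkRow hF n f
  have : ∀ k u, u + k = n → (mkRow n f).foldr dA F u = G u := by
    intro k
    induction k with
    | zero => intro u hu; rw [i2 u (by omega), h2 u (by omega)]
    | succ k ih => intro u hu; rw [i1 u (by omega), h1 u (by omega), ih (u+1) (by omega)]
  funext u
  by_cases hu : u < n
  · exact this (n-u) u (by omega)
  · rw [i2 u (by omega), h2 u (by omega)]

/-! the value-state action -/
def dB (F : ℕ → ℕ) (v : ℕ) (u : ℕ) : ℕ := if v ≤ u then max (F u) (F v + 1) else F u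

theorem dB_mono {F : ℕ → ℕ} (hF : Monotone F) (l : ℕ) : Monotone (dB F l) := by
  intro a b hab
  have h1 := hF hab
  unfold dB
  split_ifs with h2 h3 h4
  · omega
  · omega
  · omega
  · exact h1

theorem dB_fold_mono {F : ℕ → ℕ} (hF : Monotone F) (w : List ℕ) : Monotone (w.foldl dB F) := by
  induction w generalizing F with
  | nil => exact hF
  | cons a w ih => exact ih (dB_mono hF a)

theorem dB_step1 {F : ℕ → ℕ} (hF : Monotone F) {x y z : ℕ} (h1 : x ≤ y) (h2 : y < z) :
    dB (dB (dB F x) z) y = dB (dB (dB F z) x) y := by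
  funext u
  have a1 := hF h1
  have a2 := hF h2.le
  have b1 : x ≤ u → F x ≤ F u := fun h => hF h
  have b2 : y ≤ u → F y ≤ F u := fun h => hF h
  have b3 : z ≤ u → F z ≤ F u := fun h => hF h
  have c1 : ¬ z ≤ x := by omega
  have c2 : ¬ z ≤ y := by omega
  have c3 : x ≤ z := by omega
  simp only [dB, c1, c2, c3, h1, if_true, if_false]
  by_cases hu1 : x ≤ u <;> by_cases hu2 : y ≤ u <;> by_cases hu3 : z ≤ u <;>
    simp only [hu1, hu2, hu3, if_true, if_false] <;> omega

theorem dB_step2 {F : ℕ → ℕ} (hF : Monotone F) {x y z : ℕ} (h1 : x < y) (h2 : y ≤ z) :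
    dB (dB (dB F y) x) z = dB (dB (dB F y) z) x := by
  funext u
  have a1 := hF h1.le
  have a2 := hF h2
  have b1 : x ≤ u → F x ≤ F u := fun h => hF h
  have b2 : y ≤ u → F y ≤ F u := fun h => hF h
  have b3 : z ≤ u → F z ≤ F u := fun h => hF h
  have c1 : ¬ z ≤ x := by omega
  have c2 : ¬ y ≤ x := by omega
  have c3 : x ≤ z := by omega
  simp only [dB, c1, c2, c3, h2, if_true, if_false]
  by_cases hu1 : x ≤ u <;> by_cases hu2 : y ≤ u <;> by_cases hu3 : z ≤ u <;>
    simp only [hu1, hu2, hu3, if_true, if_false] <;> omega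

theorem KnuthEquiv.dB {F : ℕ → ℕ} (hF : Monotone F) {u v : List ℕ} (h : KnuthEquiv u v) :
    u.foldl dB F = v.foldl SkewG.dB F := by
  refine KnuthEquiv.inv (fun u => u.foldl SkewG.dB F) ?_ h
  intro u v h
  cases h with
  | kxzy u w x y z h1 h2 =>
    simp only [List.foldl_append, List.foldl_cons]
    rw [dB_step1 (dB_fold_mono hF u) h1 h2]
  | kyxz u w x y z h1 h2 =>
    simp only [List.foldl_append, List.foldl_cons]
    rw [dB_step2 (dB_fold_mono hF u) h1 h2]

theorem dB_replicate {F : ℕ → ℕ} (hF : Monotone F) (n k u : ℕ) :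
    (List.replicate k n).foldl dB F u = if n ≤ u then max (F u) (F n + k) else F u := by
  induction k generalizing u F with
  | zero =>
    simp only [List.replicate_zero, List.foldl_nil]
    split_ifs with h
    · have := hF h; omega
    · rfl
  | succ k ih =>
    rw [List.replicate_succ, List.foldl_cons, ih (dB_mono hF n)]
    simp only [dB, le_refl, if_true]
    split_ifs <;> omega

theorem dB_mkRow {F : ℕ → ℕ} (hF : Monotone F) (n : ℕ) (f : ℕ → ℕ) :
    (mkRow n f).foldl dB F 0 = F 0 ∧
    (∀ u, u < n → (mkRow n f).foldl dB F (u+1) = max ((mkRow n f).foldl dB F u) (F (u+1)) + f u) ∧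
    (∀ u, n ≤ u → (mkRow n f).foldl dB F u = max (F u) ((mkRow n f).foldl dB F n)) := by
  induction n with
  | zero =>
    refine ⟨rfl, fun u h => absurd h (by omega), fun u _ => ?_⟩
    have : F 0 ≤ F u := hF (by omega)
    simp only [mkRow, List.range_zero, List.flatMap_nil, List.foldl_nil]; omega
  | succ n ih =>
    rw [mkRow_succ, List.foldl_append]
    obtain ⟨i0, i1, i2⟩ := ih
    set F' := (mkRow n f).foldl dB F with hF'
    have hA : Monotone F' := dB_fold_mono hF _
    have hv := dB_replicate hA (n+1) (f n)
    have m1 : F' n ≤ F' (n+1) := hA (by omega)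
    have m2 : F n ≤ F (n+1) := hF (by omega)
    have e2 := i2 (n+1) (by omega)
    refine ⟨?_, ?_, ?_⟩
    · rw [hv, if_neg (by omega), i0]
    · intro u hu
      rw [hv, hv]
      rcases Nat.lt_succ_iff_lt_or_eq.1 hu with hu | rfl
      · rw [if_neg (by omega), if_neg (by omega), i1 u hu]
      · rw [if_pos le_rfl, if_neg (by omega)]
        omega
    · intro u hu
      rw [hv, hv, if_pos hu, if_pos le_rfl]
      have := i2 u (by omega)
      have : F (n+1) ≤ F u := hF hu
      omega

theorem dB_unique {F : ℕ → ℕ} (hF : Monotone F) (n : ℕ) (f : ℕ → ℕ) (G : ℕ → ℕ)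
    (h0 : G 0 = F 0) (h1 : ∀ u, u < n → G (u+1) = max (G u) (F (u+1)) + f u) :
    ∀ u, u ≤ n → (mkRow n f).foldl dB F u = G u := by
  obtain ⟨i0, i1, _⟩ := dB_mkRow hF n f
  intro u
  induction u with
  | zero => intro _; rw [i0, h0]
  | succ u ih => intro hu; rw [i1 u hu, h1 u hu, ih (by omega)]

theorem dB_congr {F F' : ℕ → ℕ} (n : ℕ) (w : List ℕ) (hw : ∀ a ∈ w, a ≤ n) (h : ∀ u, u ≤ n → F u = F' u) :
    ∀ u, u ≤ n → w.foldl dB F u = w.foldl dB F' u := by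
  induction w generalizing F F' with
  | nil => exact h
  | cons a w ih =>
    rw [List.foldl_cons, List.foldl_cons]
    refine ih (fun b hb => hw b (List.mem_cons_of_mem _ hb)) ?_
    intro u hu
    have := hw a (by simp)
    simp only [dB, h u hu, h a this]
end Part6

section Part7
attribute [-instance] Classical.propDecidable
attribute [local instance 10] Classical.propDecidable

section Skew
variable {lam mu s : Finset Cell} {T : Cell → ℕ}

theorem sk_row (hl : IsPartitionShape lam) (hm : IsPartitionShape mu) (hs : ∀ c, c ∈ s ↔ c ∈ lam ∧ c ∉ mu)
    (hT : IsRPPOn s T) : ∀ i j, (i,j+1) ∈ lam → T (i,j) ≤ T (i,j+1) := by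
  intro i j h
  have h0 : (i,j) ∈ lam := hl _ _ _ _ h le_rfl (by omega)
  by_cases h1 : (i,j) ∈ s
  · have h2 : (i,j+1) ∈ s := (hs _).2 ⟨h, fun h' => ((hs _).1 h1).2 (hm _ _ _ _ h' le_rfl (by omega))⟩
    exact hT.2.2.1 _ _ h1 h2
  · rw [hT.2.1 _ h1]; omega

theorem sk_col1 (hl : IsPartitionShape lam) (hm : IsPartitionShape mu) (hs : ∀ c, c ∈ s ↔ c ∈ lam ∧ c ∉ mu)
    (hT : IsRPPOn s T) : ∀ i j, (i+1,j) ∈ lam → T (i,j) ≤ T (i+1,j) := by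
  intro i j h
  by_cases h1 : (i,j) ∈ s
  · have h2 : (i+1,j) ∈ s := (hs _).2 ⟨h, fun h' => ((hs _).1 h1).2 (hm _ _ _ _ h' (by omega) le_rfl)⟩
    exact hT.2.2.2 _ _ h1 h2
  · rw [hT.2.1 _ h1]; omega

theorem sk_col (hl : IsPartitionShape lam) (hm : IsPartitionShape mu) (hs : ∀ c, c ∈ s ↔ c ∈ lam ∧ c ∉ mu)
    (hT : IsRPPOn s T) (i j k : ℕ) (h : (i+k,j) ∈ lam) : T (i,j) ≤ T (i+k,j) := by
  induction k with
  | zero => exact le_rfl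
  | succ k ih =>
    exact (ih (hl _ _ _ _ h (by omega) le_rfl)).trans (sk_col1 hl hm hs hT (i+k) j h)

theorem NN_zero (hl : IsPartitionShape lam) (hm : IsPartitionShape mu) (hsub : mu ⊆ lam)
    (hs : ∀ c, c ∈ s ↔ c ∈ lam ∧ c ∉ mu) (hT : IsRPPOn s T) (i : ℕ) : NN lam T i 0 = rl mu i := by
  have : ∀ j, j < NN lam T i 0 ↔ j < rl mu i := by
    intro j
    rw [← NN_spec hl (sk_row hl hm hs hT), ← mem_part hm]
    constructor
    · rintro ⟨h1, h2⟩
      by_contra h3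
      have := hT.1 _ ((hs _).2 ⟨h1, h3⟩); omega
    · intro h
      exact ⟨hsub h, (hT.2.1 _ (fun h' => ((hs _).1 h').2 h)).le⟩
  exact le_antisymm (Nat.le_of_not_lt fun h => absurd ((this _).1 h) (by omega))
    (Nat.le_of_not_lt fun h => absurd ((this _).2 h) (by omega))

theorem NN_top (hl : IsPartitionShape lam) (hm : IsPartitionShape mu)
    (hs : ∀ c, c ∈ s ↔ c ∈ lam ∧ c ∉ mu) (hT : IsRPPOn s T) {V : ℕ} (hV : ∀ c ∈ s, T c ≤ V) (i : ℕ) :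
    NN lam T i V = rl lam i := by
  have : ∀ j, j < NN lam T i V ↔ j < rl lam i := by
    intro j
    rw [← NN_spec hl (sk_row hl hm hs hT), ← mem_part hl]
    constructor
    · exact fun h => h.1
    · intro h
      refine ⟨h, ?_⟩
      by_cases h1 : (i,j) ∈ s
      · exact hV _ h1
      · rw [hT.2.1 _ h1]; omega
  exact le_antisymm (Nat.le_of_not_lt fun h => absurd ((this _).1 h) (by omega))
    (Nat.le_of_not_lt fun h => absurd ((this _).2 h) (by omega))

theorem NN_mono (s : Finset Cell) (T : Cell → ℕ) (i : ℕ) : Monotone (NN s T i) := by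
  intro a b h
  refine Finset.card_le_card ?_
  intro c hc
  simp only [Finset.mem_filter] at hc ⊢
  exact ⟨hc.1, hc.2.1, hc.2.2.trans h⟩

theorem NN_anti (hl : IsPartitionShape lam) (hm : IsPartitionShape mu)
    (hs : ∀ c, c ∈ s ↔ c ∈ lam ∧ c ∉ mu) (hT : IsRPPOn s T) (v : ℕ) : Antitone (fun i => NN lam T i v) := by
  refine antitone_nat_of_succ_le ?_
  intro i
  refine Nat.le_of_not_lt fun h => ?_
  have h1 := (NN_spec hl (sk_row hl hm hs hT)).2 h
  have h2 : (i, NN lam T i v) ∈ lam ∧ T (i, NN lam T i v) ≤ v :=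
    ⟨hl _ _ _ _ h1.1 (by omega) le_rfl, (sk_col1 hl hm hs hT _ _ h1.1).trans h1.2⟩
  have := (NN_spec hl (sk_row hl hm hs hT)).1 h2
  omega

theorem NN_out {n : ℕ} (h : AtMostRows lam n) (T : Cell → ℕ) {i : ℕ} (hi : n ≤ i) (v : ℕ) : NN lam T i v = 0 := by
  unfold NN
  rw [Finset.card_eq_zero, Finset.filter_eq_empty_iff]
  intro c hc h'
  have := h c hc; omega

theorem countP_row (s : Finset Cell) (i : ℕ) (p : ℕ → Bool) (J : Finset ℕ)
    (hJ : ∀ j, j ∈ J ↔ (i,j) ∈ s ∧ p j = true) : (rowList s i).countP p = J.card := by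
  have hn : ((rowList s i).filter p).Nodup := by
    refine List.Nodup.filter _ ?_
    exact (rowList_sorted s i).imp (fun h => ne_of_lt h)
  rw [List.countP_eq_length_filter, ← List.toFinset_card_of_nodup hn]
  congr 1
  ext j
  rw [List.mem_toFinset, List.mem_filter, mem_rowList, hJ]

theorem kept_count (s : Finset Cell) (T : Cell → ℕ) (i a : ℕ) (J : Finset ℕ)
    (hJ : ∀ j, j ∈ J ↔ (i,j) ∈ s ∧ T (i,j) = a ∧ ((i + 1, j) ∉ s ∨ T (i + 1, j) ≠ T (i, j))) :
    (kept s T i).count a = J.card := by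
  unfold kept
  rw [List.count_eq_countP, List.countP_map, List.countP_filter]
  refine countP_row s i _ J ?_
  intro j
  rw [hJ]
  simp only [Function.comp, Bool.and_eq_true, beq_iff_eq, decide_eq_true_eq]

theorem NN_rec (hl : IsPartitionShape lam) (hm : IsPartitionShape mu)
    (hs : ∀ c, c ∈ s ↔ c ∈ lam ∧ c ∉ mu) (hT : IsRPPOn s T) (i v : ℕ) :
    NN lam T i (v+1) = max (NN lam T i v) (NN lam T (i+1) (v+1)) + (kept s T i).count (v+1) := by
  have hsp := @NN_spec lam T hl (sk_row hl hm hs hT)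
  rw [kept_count s T i (v+1) (Finset.Ico (max (NN lam T i v) (NN lam T (i+1) (v+1))) (NN lam T i (v+1)))]
  · rw [Nat.card_Ico]
    have h1 := NN_mono lam T i (show v ≤ v+1 by omega)
    have h2 := NN_anti hl hm hs hT (v+1) (show i ≤ i+1 by omega)
    simp only at h2
    omega
  · intro j
    rw [Finset.mem_Ico, max_le_iff, ← not_lt, ← not_lt, ← hsp, ← hsp, ← hsp]
    constructor
    · rintro ⟨⟨h1, h2⟩, h3, h4⟩
      have h5 : T (i,j) = v+1 := by
        by_contra h; exact h1 ⟨h3, by omega⟩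
      have h6 : (i,j) ∈ s := by by_contra h; rw [hT.2.1 _ h] at h5; omega
      refine ⟨h6, h5, ?_⟩
      by_contra h
      push Not at h
      exact h2 ⟨((hs _).1 h.1).1, by omega⟩
    · rintro ⟨h1, h2, h3⟩
      refine ⟨⟨fun h => by omega, fun h => ?_⟩, ((hs _).1 h1).1, by omega⟩
      have h4 : T (i+1,j) = T (i,j) := by
        have := sk_col1 hl hm hs hT i j h.1; omega
      have h5 : (i+1,j) ∈ s := by by_contra h; rw [hT.2.1 _ h] at h4; omega
      rcases h3 with h3 | h3
      · exact h3 h5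
      · exact h3 h4

theorem NN_inj (hl : IsPartitionShape lam) (hm : IsPartitionShape mu)
    (hs : ∀ c, c ∈ s ↔ c ∈ lam ∧ c ∉ mu) (hT : IsRPPOn s T) {T' : Cell → ℕ} (hT' : IsRPPOn s T') {V : ℕ}
    (hV : ∀ c ∈ s, T c ≤ V) (hV' : ∀ c ∈ s, T' c ≤ V)
    (h : ∀ i v, v ≤ V → NN lam T i v = NN lam T' i v) : T = T' := by
  funext c
  by_cases hc : c ∈ s
  · obtain ⟨i, j⟩ := c
    have hcl := ((hs _).1 hc).1
    refine le_antisymm ?_ ?_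
    · have := (NN_spec hl (sk_row hl hm hs hT')).1 ⟨hcl, le_refl (T' (i,j))⟩
      rw [← h _ _ (hV' _ hc)] at this
      exact ((NN_spec hl (sk_row hl hm hs hT)).2 this).2
    · have := (NN_spec hl (sk_row hl hm hs hT)).1 ⟨hcl, le_refl (T (i,j))⟩
      rw [h _ _ (hV _ hc)] at this
      exact ((NN_spec hl (sk_row hl hm hs hT')).2 this).2
  · rw [hT.2.1 _ hc, hT'.2.1 _ hc]

theorem NN_surj (hl : IsPartitionShape lam) (hm : IsPartitionShape mu)
    (hs : ∀ c, c ∈ s ↔ c ∈ lam ∧ c ∉ mu) (N : ℕ → ℕ → ℕ) (V : ℕ) (h0 : ∀ i, N i 0 = rl mu i)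
    (hV : ∀ i, N i V = rl lam i) (hmono : ∀ i, Monotone (N i)) (hanti : ∀ i v, N (i+1) v ≤ N i v) :
    ∃ T, IsRPPOn s T ∧ (∀ c ∈ s, T c ≤ V) ∧ ∀ i v, v ≤ V → NN lam T i v = N i v := by
  set T : Cell → ℕ := fun c => if c ∈ s then sInf {v | c.2 < N c.1 v} else 0 with hTd
  have key : ∀ i j v, (i,j) ∈ s → (T (i,j) ≤ v ↔ j < N i v) := by
    intro i j v hc
    have e : T (i,j) = sInf {v | j < N i v} := by simp only [hTd]; rw [if_pos hc]
    have hne : {v | j < N i v}.Nonempty := ⟨V, by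
      have := (mem_part hl).1 ((hs _).1 hc).1
      rw [← hV] at this; exact this⟩
    rw [e]
    constructor
    · intro h
      have := Nat.sInf_mem hne
      exact lt_of_lt_of_le this (hmono i h)
    · intro h; exact Nat.sInf_le h
  have h2 : IsRPPOn s T := by
    refine ⟨?_, fun c hc => if_neg hc, ?_, ?_⟩
    · rintro ⟨i, j⟩ hc
      by_contra h
      have := (key i j 0 hc).1 (by omega)
      rw [h0] at this
      exact ((hs _).1 hc).2 ((mem_part hm).2 this)
    · intro i j h h'
      rw [key _ _ _ h]
      have := (key _ _ _ h').1 le_rfl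
      omega
    · intro i j h h'
      rw [key _ _ _ h]
      have := (key _ _ _ h').1 le_rfl
      exact this.trans_le (hanti _ _)
  refine ⟨T, h2, ?_, ?_⟩
  · rintro ⟨i, j⟩ hc
    rw [key _ _ _ hc, hV, ← mem_part hl]
    exact ((hs _).1 hc).1
  · intro i v hv
    have : ∀ j, j < NN lam T i v ↔ j < N i v := by
      intro j
      rw [← NN_spec hl (sk_row hl hm hs h2)]
      constructor
      · rintro ⟨h3, h4⟩
        by_cases hc : (i,j) ∈ s
        · exact (key _ _ _ hc).1 h4
        · have h5 : (i,j) ∈ mu := by by_contra h; exact hc ((hs _).2 ⟨h3, h⟩)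
          have h6 := (mem_part hm).1 h5
          rw [← h0] at h6
          exact h6.trans_le (hmono i (by omega))
      · intro h
        have h3 : (i,j) ∈ lam := by
          rw [mem_part hl, ← hV]; exact h.trans_le (hmono i hv)
        refine ⟨h3, ?_⟩
        by_cases hc : (i,j) ∈ s
        · exact (key _ _ _ hc).2 h
        · rw [h2.2.1 _ hc]; omega
    exact le_antisymm (Nat.le_of_not_lt fun h => absurd ((this _).1 h) (by omega))
      (Nat.le_of_not_lt fun h => absurd ((this _).2 h) (by omega))

theorem mem_kept {s : Finset Cell} {T : Cell → ℕ} {i a : ℕ} (h : a ∈ kept s T i) : ∃ j, (i,j) ∈ s ∧ T (i,j) = a := by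
  unfold kept at h
  obtain ⟨j, hj, rfl⟩ := List.mem_map.1 h
  exact ⟨j, mem_rowList.1 (List.mem_filter.1 hj).1, rfl⟩

theorem kept_letters (hT : IsRPPOn s T) {V : ℕ} (hV : ∀ c ∈ s, T c ≤ V) {i a : ℕ} (h : a ∈ kept s T i) :
    1 ≤ a ∧ a ≤ V := by
  obtain ⟨j, hj, rfl⟩ := mem_kept h
  exact ⟨hT.1 _ hj, hV _ hj⟩

theorem row_le (hl : IsPartitionShape lam) (hm : IsPartitionShape mu) (hs : ∀ c, c ∈ s ↔ c ∈ lam ∧ c ∉ mu)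
    (hT : IsRPPOn s T) {i j j' : ℕ} (h : (i,j') ∈ lam) (hj : j ≤ j') : T (i,j) ≤ T (i,j') := by
  induction j', hj using Nat.le_induction with
  | base => exact le_rfl
  | succ k hk ih => exact (ih (hl _ _ _ _ h le_rfl (by omega))).trans (sk_row hl hm hs hT _ _ h)

theorem kept_sorted (hl : IsPartitionShape lam) (hm : IsPartitionShape mu) (hs : ∀ c, c ∈ s ↔ c ∈ lam ∧ c ∉ mu)
    (hT : IsRPPOn s T) (i : ℕ) : (kept s T i).Pairwise (· ≤ ·) := by
  unfold kept
  rw [List.pairwise_map]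
  have h1 := (rowList_sorted s i).filter (fun j => decide ((i + 1, j) ∉ s ∨ T (i + 1, j) ≠ T (i, j)))
  refine h1.imp_of_mem ?_
  intro a b ha hb hab
  have := mem_rowList.1 (List.mem_filter.1 hb).1
  exact row_le hl hm hs hT ((hs _).1 this).1 hab.le

theorem kept_mkRow (hl : IsPartitionShape lam) (hm : IsPartitionShape mu) (hs : ∀ c, c ∈ s ↔ c ∈ lam ∧ c ∉ mu)
    (hT : IsRPPOn s T) {V : ℕ} (hV : ∀ c ∈ s, T c ≤ V) (i : ℕ) :
    mkRow V (fun v => (kept s T i).count (v+1)) = kept s T i :=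
  sorted_mkRow (kept_sorted hl hm hs hT i) (fun _ h => kept_letters hT hV h)

theorem ceq_kept (s : Finset Cell) (T : Cell → ℕ) (i : ℕ) : ceqOn s T i + (kept s T i).length = rl s i := by
  have h1 : (kept s T i).length = (rowList s i).countP (fun j => decide ((i + 1, j) ∉ s ∨ T (i + 1, j) ≠ T (i, j))) := by
    unfold kept; rw [List.length_map, List.countP_eq_length_filter]
  have h2 : ceqOn s T i = (rowList s i).countP (fun j => decide (¬ decide ((i + 1, j) ∉ s ∨ T (i + 1, j) ≠ T (i, j)) = true)) := by
    rw [countP_row s i _ ((s.filter (fun c => c.1 = i ∧ (c.1 + 1, c.2) ∈ s ∧ T c = T (c.1 + 1, c.2))).image Prod.snd)]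
    · rw [Finset.card_image_of_injOn]
      · unfold ceqOn; congr!
      · rintro ⟨a, b⟩ h ⟨a', b'⟩ h' e
        simp only [Finset.coe_filter, Set.mem_ofPred_eq] at h h'
        simp only at e
        rw [Prod.mk.injEq]; exact ⟨h.2.1.trans h'.2.1.symm, e⟩
    · intro j
      simp only [Finset.mem_image, Finset.mem_filter, decide_eq_true_eq]
      constructor
      · rintro ⟨⟨a, b⟩, ⟨g1, h2, h3, h4⟩, h5⟩
        simp only at h2 h3 h4 h5
        subst h2; subst h5
        refine ⟨g1, ?_⟩
        push Not
        exact ⟨h3, h4.symm⟩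
      · rintro ⟨h1, h2⟩
        push Not at h2
        exact ⟨(i,j), ⟨h1, rfl, h2.1, h2.2.symm⟩, rfl⟩
  rw [h1, h2]
  have := List.length_eq_countP_add_countP (l := rowList s i) (fun j => decide ((i + 1, j) ∉ s ∨ T (i + 1, j) ≠ T (i, j)))
  unfold rl
  omega

theorem wt_kept (hl : IsPartitionShape lam) (hm : IsPartitionShape mu) (hs : ∀ c, c ∈ s ↔ c ∈ lam ∧ c ∉ mu)
    (hT : IsRPPOn s T) {n : ℕ} (hn : AtMostRows lam n) (v : ℕ) :
    wtRPP s T v = ∑ i ∈ Finset.range n, (kept s T i).count v := by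
  set A := s.filter (fun c => T c = v ∧ ((c.1+1,c.2) ∉ s ∨ T (c.1+1,c.2) ≠ T c)) with hA
  have h1 : ∀ i, (kept s T i).count v = (A.filter (fun c => c.1 = i)).card := by
    intro i
    rw [kept_count s T i v ((A.filter (fun c => c.1 = i)).image Prod.snd), Finset.card_image_of_injOn]
    · rintro ⟨a, b⟩ h ⟨a', b'⟩ h' e
      simp only [Finset.coe_filter, Set.mem_ofPred_eq] at h h'
      simp only at e
      rw [Prod.mk.injEq]; exact ⟨h.2.trans h'.2.symm, e⟩
    · intro j
      simp only [hA, Finset.mem_image, Finset.mem_filter]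
      constructor
      · rintro ⟨⟨a, b⟩, ⟨⟨h1, h2, h3⟩, h4⟩, h5⟩
        simp only at h2 h3 h4 h5
        subst h4; subst h5
        exact ⟨h1, h2, h3⟩
      · rintro ⟨h1, h2, h3⟩
        exact ⟨(i,j), ⟨⟨h1, h2, h3⟩, rfl⟩, rfl⟩
  simp only [h1]
  rw [← Finset.card_eq_sum_card_fiberwise (f := Prod.fst) (s := A) (t := Finset.range n)]
  · unfold wtRPP
    symm
    refine Finset.card_bij (fun c _ => c.2) ?_ ?_ ?_
    · rintro ⟨i, j⟩ h
      rw [hA, Finset.mem_filter] at h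
      rw [Finset.mem_filter, Finset.mem_range]
      exact ⟨Nat.lt_succ_of_le (Finset.le_sup (f := Prod.snd) h.1), i, h.1, h.2.1⟩
    · have aux : ∀ i k j, (i,j) ∈ A → (i+(k+1),j) ∈ A → False := by
        intro i k j h h'
        simp only [hA, Finset.mem_filter] at h h'
        have l1 : (i+(k+1),j) ∈ lam := ((hs _).1 h'.1).1
        have l2 : (i+1,j) ∈ lam := hl _ _ _ _ l1 (by omega) le_rfl
        have e1 := sk_col1 hl hm hs hT i j l2
        have e2 := sk_col hl hm hs hT (i+1) j k (by rw [show i+1+k = i+(k+1) by omega]; exact l1)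
        rw [show i+1+k = i+(k+1) by omega] at e2
        have e3 : T (i+1,j) = T (i,j) := by omega
        have e4 : (i+1,j) ∈ s := by
          by_contra hc
          have := hT.2.1 _ hc
          have := hT.1 _ h.1
          omega
        rcases h.2.2 with h5 | h5
        · exact h5 e4
        · exact h5 e3
      rintro ⟨i, j⟩ h ⟨i', j'⟩ h' e
      simp only at e
      subst e
      rcases lt_trichotomy i i' with hlt | rfl | hlt
      · obtain ⟨k, rfl⟩ := Nat.exists_eq_add_of_lt hlt
        exact (aux _ _ _ h (by rw [← add_assoc]; exact h')).elim
      · rfl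
      · obtain ⟨k, rfl⟩ := Nat.exists_eq_add_of_lt hlt
        exact (aux _ _ _ h' (by rw [← add_assoc]; exact h)).elim
    · intro j hj
      rw [Finset.mem_filter] at hj
      obtain ⟨_, i0, hi0⟩ := hj
      have hb : ∀ i, (i,j) ∈ s ∧ T (i,j) = v → i ≤ n := fun i h => (hn _ ((hs _).1 h.1).1).le
      have hP := Nat.findGreatest_spec (P := fun i => (i,j) ∈ s ∧ T (i,j) = v) (hb _ hi0) hi0
      set i := Nat.findGreatest (fun i => (i,j) ∈ s ∧ T (i,j) = v) n with hi
      refine ⟨(i,j), ?_, rfl⟩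
      rw [hA, Finset.mem_filter]
      refine ⟨hP.1, hP.2, ?_⟩
      by_contra hc
      push Not at hc
      have h3 : (i+1,j) ∈ s ∧ T (i+1,j) = v := ⟨hc.1, hc.2.trans hP.2⟩
      have := Nat.le_findGreatest (P := fun i => (i,j) ∈ s ∧ T (i,j) = v) (hb _ h3) h3
      omega
  · intro c hc
    simp only [hA, Finset.coe_filter, Set.mem_ofPred_eq] at hc
    simp only [Finset.coe_range, Set.mem_Iio]
    exact hn _ ((hs _).1 hc.1).1

end Skew
end Part7

section Part8
set_option linter.unusedVariables false
attribute [-instance] Classical.propDecidable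
attribute [local instance 10] Classical.propDecidable

theorem mkRow_congr {n : ℕ} {f g : ℕ → ℕ} (h : ∀ i < n, f i = g i) : mkRow n f = mkRow n g := by
  induction n with
  | zero => rfl
  | succ n ih => rw [mkRow_succ, mkRow_succ, ih (fun i hi => h i (by omega)), h n (by omega)]

theorem mkRow_length (n : ℕ) (f : ℕ → ℕ) : (mkRow n f).length = ∑ i ∈ Finset.range n, f i := by
  induction n with
  | zero => rfl
  | succ n ih => rw [mkRow_succ, List.length_append, ih, List.length_replicate, Finset.sum_range_succ]

theorem xl_finite (V K : ℕ) : {l : List ℕ | l.Pairwise (· ≤ ·) ∧ (∀ a ∈ l, 1 ≤ a ∧ a ≤ V) ∧ l.length ≤ K}.Finite := by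
  refine Set.Finite.subset ((Set.finite_range (fun f : Fin V → Fin (K+1) =>
    mkRow V (fun i => if h : i < V then (f ⟨i, h⟩ : ℕ) else 0)))) ?_
  rintro l ⟨h1, h2, h3⟩
  refine ⟨fun i => ⟨l.count ((i:ℕ)+1), Nat.lt_succ_of_le (List.count_le_length.trans h3)⟩, ?_⟩
  conv_rhs => rw [← sorted_mkRow h1 h2]
  refine mkRow_congr ?_
  intro i hi
  simp only [hi, dif_pos]

def XL (V K : ℕ) : Finset (List ℕ) := (xl_finite V K).toFinset

theorem mem_XL {V K : ℕ} {l : List ℕ} :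
    l ∈ XL V K ↔ l.Pairwise (· ≤ ·) ∧ (∀ a ∈ l, 1 ≤ a ∧ a ≤ V) ∧ l.length ≤ K := by
  unfold XL; rw [Set.Finite.mem_toFinset]; rfl

def extL (n : ℕ) (ws : Fin n → List ℕ) (i : ℕ) : List ℕ := if h : i < n then ws ⟨i, h⟩ else []

theorem extL_fin {n : ℕ} (ws : Fin n → List ℕ) (i : Fin n) : extL n ws i = ws i := by simp [extL]
theorem extL_succ {n : ℕ} (ws : Fin (n+1) → List ℕ) (i : ℕ) :
    extL (n+1) ws (i+1) = extL n (fun k => ws k.succ) i := by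
  unfold extL
  by_cases h : i < n
  · rw [dif_pos h, dif_pos (by omega)]; rfl
  · rw [dif_neg h, dif_neg (by omega)]

def W (n : ℕ) (ws : Fin n → List ℕ) : List ℕ := RW n (extL n ws)

theorem W_succ (n : ℕ) (ws : Fin (n+1) → List ℕ) : W (n+1) ws = W n (fun k => ws k.succ) ++ ws 0 := by
  unfold W
  rw [RW_shift]
  congr 1
  exact RW_congr (fun i _ => extL_succ ws i)

def WS (n V K : ℕ) : Finset (Fin n → List ℕ) := Fintype.piFinset (fun _ => XL V K)

theorem mem_WS {n V K : ℕ} {ws : Fin n → List ℕ} : ws ∈ WS n V K ↔ ∀ i, ws i ∈ XL V K := Fintype.mem_piFinset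

theorem WS_row {n V K : ℕ} {ws : Fin n → List ℕ} (h : ws ∈ WS n V K) (i : ℕ) : extL n ws i ∈ XL V K := by
  unfold extL
  split_ifs with h'
  · exact mem_WS.1 h _
  · rw [mem_XL]; simp

theorem XL_mkRow {V K : ℕ} {l : List ℕ} (h : l ∈ XL V K) : mkRow V (fun i => l.count (i+1)) = l :=
  sorted_mkRow (mem_XL.1 h).1 (mem_XL.1 h).2.1

theorem W_letters {n V K : ℕ} {ws : Fin n → List ℕ} (h : ws ∈ WS n V K) {a : ℕ} (ha : a ∈ W n ws) : 1 ≤ a ∧ a ≤ V := by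
  obtain ⟨i, _, hi⟩ := mem_RW.1 ha
  exact (mem_XL.1 (WS_row h i)).2.1 a hi

theorem W_length (n : ℕ) (ws : Fin n → List ℕ) : (W n ws).length = ∑ i, (ws i).length := by
  unfold W
  rw [RW_length, Finset.sum_range]
  simp only [extL_fin]

/-! ### columns arrays -/
def csOf (n : ℕ) (s : Finset Cell) (T : Cell → ℕ) : Fin n → List ℕ :=
  fun v => mkRow n (fun i => (kept s T i).count ((v:ℕ)+1))

theorem dA_fold_ge (F : ℕ → ℕ) (w : List ℕ) (u : ℕ) : F u ≤ w.foldr dA F u := by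
  induction w with
  | nil => exact le_rfl
  | cons a w ih =>
    refine ih.trans ?_
    change _ ≤ dA a (w.foldr dA F) u
    generalize w.foldr dA F = G
    unfold dA
    split_ifs
    · exact le_max_left _ _
    · exact le_rfl

section Skew
variable {lam mu s : Finset Cell} {T : Cell → ℕ} {n : ℕ}

theorem cs_fold (hl : IsPartitionShape lam) (hm : IsPartitionShape mu) (hsub : mu ⊆ lam)
    (hs : ∀ c, c ∈ s ↔ c ∈ lam ∧ c ∉ mu) (hn : AtMostRows lam n) (hT : IsRPPOn s T) (v : ℕ) (hv : v ≤ n) :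
    (RW v (extL n (csOf n s T))).foldr dA (rl mu) = fun i => NN lam T i v := by
  induction v with
  | zero => funext i; exact (NN_zero hl hm hsub hs hT i).symm
  | succ v ih =>
    rw [RW_succ, List.foldr_append, ih (by omega)]
    have : extL n (csOf n s T) v = mkRow n (fun i => (kept s T i).count (v+1)) := by
      unfold extL; rw [dif_pos (by omega)]; rfl
    rw [this]
    refine dA_unique (NN_anti hl hm hs hT v) n _ _ ?_ ?_
    · intro u _; exact NN_rec hl hm hs hT u v
    · intro u hu; simp only [NN_out hn T hu]

theorem cs_W (hl : IsPartitionShape lam) (hm : IsPartitionShape mu) (hsub : mu ⊆ lam)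
    (hs : ∀ c, c ∈ s ↔ c ∈ lam ∧ c ∉ mu) (hn : AtMostRows lam n) (hT : IsRPPOn s T) (hV : ∀ c ∈ s, T c ≤ n) :
    (W n (csOf n s T)).foldr dA (rl mu) = rl lam := by
  unfold W
  rw [cs_fold hl hm hsub hs hn hT n le_rfl]
  funext i; exact NN_top hl hm hs hT hV i

theorem cs_inj (hl : IsPartitionShape lam) (hm : IsPartitionShape mu) (hsub : mu ⊆ lam)
    (hs : ∀ c, c ∈ s ↔ c ∈ lam ∧ c ∉ mu) (hn : AtMostRows lam n) (hT : IsRPPOn s T) (hV : ∀ c ∈ s, T c ≤ n)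
    {T' : Cell → ℕ} (hT' : IsRPPOn s T') (hV' : ∀ c ∈ s, T' c ≤ n) (h : csOf n s T = csOf n s T') : T = T' := by
  refine NN_inj hl hm hs hT hT' hV hV' ?_
  intro i v hv
  have h1 := cs_fold hl hm hsub hs hn hT v hv
  rw [h, cs_fold hl hm hsub hs hn hT' v hv] at h1
  exact (congrFun h1 i).symm

theorem cs_surj (hl : IsPartitionShape lam) (hm : IsPartitionShape mu)
    (hs : ∀ c, c ∈ s ↔ c ∈ lam ∧ c ∉ mu) {K : ℕ} {cs : Fin n → List ℕ}
    (hcs : cs ∈ WS n n K) (hW : (W n cs).foldr dA (rl mu) = rl lam) :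
    ∃ T, IsRPPOn s T ∧ (∀ c ∈ s, T c ≤ n) ∧ csOf n s T = cs := by
  have hanti : ∀ v, Antitone ((RW v (extL n cs)).foldr dA (rl mu)) := fun v => dA_fold_anti (rl_anti hm) _
  obtain ⟨T, h1, h2, h3⟩ := NN_surj hl hm hs (fun i v => (RW v (extL n cs)).foldr dA (rl mu) i) n
    (fun i => rfl) (fun i => congrFun hW i)
    (fun i => monotone_nat_of_le_succ (fun v => by
      rw [RW_succ, List.foldr_append]; exact dA_fold_ge _ _ _))
    (fun i v => hanti v (by omega))
  refine ⟨T, h1, h2, ?_⟩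
  funext v
  have hr := XL_mkRow (mem_WS.1 hcs v)
  unfold csOf
  rw [← hr]
  refine mkRow_congr ?_
  intro i hi
  have e1 := NN_rec hl hm hs h1 i v
  rw [h3 _ _ (by omega), h3 _ _ (by omega), h3 _ _ (by omega)] at e1
  have e2 := (dA_mkRow (hanti v) n (fun i => (cs v).count (i+1))).1 i hi
  rw [hr] at e2
  rw [RW_succ, List.foldr_append, extL_fin cs v] at e1
  omega

theorem cs_len (hl : IsPartitionShape lam) (hm : IsPartitionShape mu)
    (hs : ∀ c, c ∈ s ↔ c ∈ lam ∧ c ∉ mu) (hn : AtMostRows lam n) (hT : IsRPPOn s T) (v : Fin n) :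
    (csOf n s T v).length = wtRPP s T (v+1) := by
  rw [wt_kept hl hm hs hT hn]; unfold csOf; rw [mkRow_length]

theorem cs_count (hl : IsPartitionShape lam) (hm : IsPartitionShape mu)
    (hs : ∀ c, c ∈ s ↔ c ∈ lam ∧ c ∉ mu) (hT : IsRPPOn s T) (hV : ∀ c ∈ s, T c ≤ n) (i : Fin n) :
    ceqOn s T i = rl s i - (W n (csOf n s T)).count ((i:ℕ)+1) := by
  have h1 := ceq_kept s T i
  have h2 : (W n (csOf n s T)).count ((i:ℕ)+1) = (kept s T i).length := by
    unfold W
    rw [RW_count, ← kept_mkRow hl hm hs hT hV, mkRow_length]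
    refine Finset.sum_congr rfl ?_
    intro v hv
    have hv := Finset.mem_range.1 hv
    have : extL n (csOf n s T) v = mkRow n (fun i => (kept s T i).count (v+1)) := by
      unfold extL; rw [dif_pos (by omega)]; rfl
    rw [this, mkRow_count, if_pos i.2]
  omega

theorem cs_mem (hl : IsPartitionShape lam) (hm : IsPartitionShape mu)
    (hs : ∀ c, c ∈ s ↔ c ∈ lam ∧ c ∉ mu) (hn : AtMostRows lam n) (hT : IsRPPOn s T) {K : ℕ}
    (hK : ∑ i ∈ Finset.range n, rl s i ≤ K) : csOf n s T ∈ WS n n K := by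
  rw [mem_WS]
  intro v
  rw [mem_XL]
  refine ⟨mkRow_sorted _ _, fun a ha => mem_mkRow ha, ?_⟩
  refine le_trans ?_ hK
  unfold csOf
  rw [mkRow_length]
  refine Finset.sum_le_sum fun i _ => ?_
  have := ceq_kept s T i
  have : (kept s T i).count ((v:ℕ)+1) ≤ (kept s T i).length := List.count_le_length
  omega
end Skew

/-! ### row arrays -/
def lis (V : ℕ) (w : List ℕ) : ℕ := w.foldl dB (fun _ => 0) V

theorem KnuthEquiv.lis {V : ℕ} {u v : List ℕ} (h : KnuthEquiv u v) : lis V u = SkewG.lis V v := by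
  unfold SkewG.lis; rw [KnuthEquiv.dB (fun _ _ _ => le_rfl) h]

def tw (n : ℕ) (ws : Fin n → List ℕ) (i : ℕ) : List ℕ := RW (n-i) (fun k => extL n ws (k+i))

def lamOf (V n : ℕ) (ws : Fin n → List ℕ) (i : Fin n) : ℕ := lis V (tw n ws i)

theorem tw_zero (n : ℕ) (ws : Fin n → List ℕ) : tw n ws 0 = W n ws := rfl
theorem tw_ge {n : ℕ} (ws : Fin n → List ℕ) {i : ℕ} (h : n ≤ i) : tw n ws i = [] := by
  unfold tw; rw [Nat.sub_eq_zero_of_le h]; rfl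
theorem tw_lt {n : ℕ} (ws : Fin n → List ℕ) {i : ℕ} (h : i < n) : tw n ws i = tw n ws (i+1) ++ extL n ws i := by
  unfold tw
  rw [show n - i = (n-(i+1))+1 by omega, RW_shift, Nat.zero_add]
  congr 1
  exact RW_congr fun k _ => by rw [show k + 1 + i = k + (i+1) by omega]

theorem lamOf_zero (V n : ℕ) (ws : Fin (n+1) → List ℕ) : lamOf V (n+1) ws 0 = lis V (W (n+1) ws) := rfl
theorem lamOf_succ (V n : ℕ) (ws : Fin (n+1) → List ℕ) :
    (fun i : Fin n => lamOf V (n+1) ws i.succ) = lamOf V n (fun k => ws k.succ) := by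
  funext i
  unfold lamOf tw
  rw [Fin.val_succ, Nat.add_sub_add_right]
  congr 1
  refine RW_congr fun k _ => ?_
  rw [← add_assoc]; exact extL_succ ws _

theorem part_empty : IsPartitionShape ∅ := fun _ _ _ _ h => absurd h (Finset.notMem_empty _)
theorem rl_empty (i : ℕ) : rl ∅ i = 0 := rl_zero (n := 0) (fun c h => absurd h (Finset.notMem_empty _)) (Nat.zero_le _)

section Rows
variable {s : Finset Cell} {R : Cell → ℕ} {n V : ℕ}

def wsOf (n : ℕ) (s : Finset Cell) (R : Cell → ℕ) : Fin n → List ℕ := fun i => kept s R i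

theorem wsOf_ext (hn : AtMostRows s n) (i : ℕ) : extL n (wsOf n s R) i = kept s R i := by
  unfold extL
  split_ifs with h
  · rfl
  · rw [kept_nil hn (by omega)]

theorem ws_W (hn : AtMostRows s n) : W n (wsOf n s R) = rppRowWord s R := by
  rw [rowWord_eq hn]; exact RW_congr (fun i _ => wsOf_ext hn i)

theorem ws_fold (hs : IsPartitionShape s) (hR : IsRPPOn s R) (hn : AtMostRows s n) (hV : ∀ c ∈ s, R c ≤ V) (k i : ℕ)
    (hk : i + k = n) : ∀ v ≤ V, (tw n (wsOf n s R) i).foldl dB (fun _ => 0) v = NN s R i v := by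
  have h' : ∀ c, c ∈ s ↔ c ∈ s ∧ c ∉ (∅ : Finset Cell) := by simp
  induction k generalizing i with
  | zero =>
    intro v _
    rw [tw_ge _ (by omega), NN_out hn R (by omega)]; rfl
  | succ k ih =>
    intro v hv
    rw [tw_lt _ (by omega), List.foldl_append, wsOf_ext hn]
    rw [dB_congr V (kept s R i) (fun a ha => (kept_letters hR hV ha).2) (ih (i+1) (by omega)) v hv]
    rw [← kept_mkRow hs part_empty h' hR hV]
    refine dB_unique (NN_mono s R (i+1)) V _ (NN s R i) ?_ (fun u _ => NN_rec hs part_empty h' hR i u) v hv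
    rw [NN_zero hs part_empty (by simp) h' hR, NN_zero hs part_empty (by simp) h' hR, rl_empty, rl_empty]

theorem ws_shape (hs : IsPartitionShape s) (hR : IsRPPOn s R) (hn : AtMostRows s n) (hV : ∀ c ∈ s, R c ≤ V) :
    shp n (lamOf V n (wsOf n s R)) = s := by
  have h' : ∀ c, c ∈ s ↔ c ∈ s ∧ c ∉ (∅ : Finset Cell) := by simp
  rw [← shp_rl hs hn]
  congr 1
  funext i
  unfold lamOf lis
  have := ws_fold hs hR hn hV (n-i) i (by omega) V le_rfl
  rw [shp_rl hs hn]
  rw [this, NN_top hs part_empty h' hR hV]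

theorem ws_inj (hs : IsPartitionShape s) (hR : IsRPPOn s R) (hn : AtMostRows s n) (hV : ∀ c ∈ s, R c ≤ V)
    {s' : Finset Cell} {R' : Cell → ℕ}
    (hs' : IsPartitionShape s') (hR' : IsRPPOn s' R') (hn' : AtMostRows s' n) (hV' : ∀ c ∈ s', R' c ≤ V)
    (h : wsOf n s R = wsOf n s' R') : s = s' ∧ R = R' := by
  have e : s = s' := by rw [← ws_shape hs hR hn hV, ← ws_shape hs' hR' hn' hV', h]
  subst e
  refine ⟨rfl, NN_inj hs part_empty (by simp) hR hR' hV hV' ?_⟩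
  intro i v hv
  by_cases hi : i < n
  · have h1 := ws_fold hs hR hn hV (n-i) i (by omega) v hv
    rw [h, ws_fold hs hR' hn hV' (n-i) i (by omega) v hv] at h1
    exact h1.symm
  · rw [NN_out hn _ (by omega), NN_out hn _ (by omega)]

theorem tw_mono (ws : Fin n → List ℕ) (i : ℕ) : Monotone ((tw n ws i).foldl dB (fun _ => 0)) :=
  dB_fold_mono (fun _ _ _ => le_rfl) _

theorem tw_rec {K : ℕ} {ws : Fin n → List ℕ} (hws : ws ∈ WS n V K) (i : ℕ) (hi : i < n) :
    (tw n ws i).foldl dB (fun _ => 0) 0 = (tw n ws (i+1)).foldl dB (fun _ => 0) 0 ∧ ∀ u < V,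
    (tw n ws i).foldl dB (fun _ => 0) (u+1) = max ((tw n ws i).foldl dB (fun _ => 0) u)
      ((tw n ws (i+1)).foldl dB (fun _ => 0) (u+1)) + (extL n ws i).count (u+1) := by
  have h := dB_mkRow (tw_mono ws (i+1)) V (fun u => (extL n ws i).count (u+1))
  rw [XL_mkRow (WS_row hws i)] at h
  rw [tw_lt _ hi, List.foldl_append]
  exact ⟨h.1, h.2.1⟩

theorem tw_anti {K : ℕ} {ws : Fin n → List ℕ} (hws : ws ∈ WS n V K) (i u : ℕ) (hu : u ≤ V) :
    (tw n ws (i+1)).foldl dB (fun _ => 0) u ≤ (tw n ws i).foldl dB (fun _ => 0) u := by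
  by_cases hi : i < n
  · obtain ⟨h0, h1⟩ := tw_rec hws i hi
    cases u with
    | zero => exact h0.ge
    | succ u => rw [h1 u (by omega)]; omega
  · rw [tw_ge _ (by omega : n ≤ i), tw_ge _ (by omega : n ≤ i+1)]

theorem tw_bot {K : ℕ} {ws : Fin n → List ℕ} (hws : ws ∈ WS n V K) (k i : ℕ) (hk : i + k = n) :
    (tw n ws i).foldl dB (fun _ => 0) 0 = 0 := by
  induction k generalizing i with
  | zero => rw [tw_ge _ (by omega)]; rfl
  | succ k ih => rw [(tw_rec hws i (by omega)).1, ih _ (by omega)]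

theorem lamOf_anti {K : ℕ} {ws : Fin n → List ℕ} (hws : ws ∈ WS n V K) : Antitone (lamOf V n ws) := by
  have : Antitone (fun i => (tw n ws i).foldl dB (fun _ => 0) V) :=
    antitone_nat_of_succ_le (fun i => tw_anti hws i V le_rfl)
  intro a b h
  exact this h

theorem ws_surj {K : ℕ} {ws : Fin n → List ℕ} (hws : ws ∈ WS n V K) :
    ∃ R, IsRPPOn (shp n (lamOf V n ws)) R ∧ (∀ c ∈ shp n (lamOf V n ws), R c ≤ V) ∧
      wsOf n (shp n (lamOf V n ws)) R = ws := by
  have hp := part_shp (lamOf_anti hws)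
  have hn := amr_shp (lamOf V n ws)
  set s := shp n (lamOf V n ws) with hsd
  have h' : ∀ c, c ∈ s ↔ c ∈ s ∧ c ∉ (∅ : Finset Cell) := by simp
  have hrl : ∀ i, rl s i = (tw n ws i).foldl dB (fun _ => 0) V := by
    intro i
    by_cases hi : i < n
    · have e1 : ∀ j, j < rl s i ↔ j < lamOf V n ws ⟨i, hi⟩ := by
        intro j
        rw [← mem_part hp, hsd, mem_shp]
        have := extendf_fin (lamOf V n ws) ⟨i, hi⟩
        simp only at this
        rw [this]
      have : rl s i = lamOf V n ws ⟨i, hi⟩ :=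
        le_antisymm (Nat.le_of_not_lt fun h => absurd ((e1 _).1 h) (by omega))
          (Nat.le_of_not_lt fun h => absurd ((e1 _).2 h) (by omega))
      rw [this]; rfl
    · rw [rl_zero hn (by omega), tw_ge _ (by omega)]; rfl
  obtain ⟨R, h1, h2, h3⟩ := NN_surj hp part_empty h'
    (fun i v => (tw n ws i).foldl dB (fun _ => 0) (min v V)) V
    (fun i => by
      simp only [Nat.zero_min]
      rw [rl_empty]
      by_cases hi : i < n
      · exact tw_bot hws (n-i) i (by omega)
      · rw [tw_ge _ (by omega)]; rfl)
    (fun i => by simp only [min_self]; exact (hrl i).symm)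
    (fun i a b h => tw_mono ws i (by omega))
    (fun i v => tw_anti hws i _ (by omega))
  refine ⟨R, h1, h2, ?_⟩
  funext i
  unfold wsOf
  rw [← kept_mkRow hp part_empty h' h1 h2, ← XL_mkRow (mem_WS.1 hws i)]
  refine mkRow_congr ?_
  intro v hv
  have e1 := NN_rec hp part_empty h' h1 i v
  rw [h3 _ _ (by omega), h3 _ _ (by omega), h3 _ _ (by omega)] at e1
  have e2 := (tw_rec hws i i.2).2 v hv
  rw [min_eq_left (by omega), min_eq_left (by omega)] at e1
  rw [extL_fin] at e2
  omega

theorem kept_ssyt (hs : IsPartitionShape s) (hR : IsSSYTOn s R) (i : ℕ) : kept s R i = rowWordOn s R i := by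
  unfold kept rowWordOn
  rw [List.filter_eq_self.2]
  intro j hj
  rw [decide_eq_true_eq]
  by_cases h : (i+1,j) ∈ s
  · right
    have := hR.2.2.2 i j (mem_rowList.1 hj) h
    omega
  · exact Or.inl h

theorem ssyt_rpp (hR : IsSSYTOn s R) : IsRPPOn s R :=
  ⟨hR.1, hR.2.1, hR.2.2.1, fun i j h h' => (hR.2.2.2 i j h h').le⟩

theorem lis_ssyt (hs : IsPartitionShape s) (hR : IsSSYTOn s R) (hV : ∀ c ∈ s, R c ≤ V) :
    lis V (readingWordOn s R) = rl s 0 := by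
  have h' : ∀ c, c ∈ s ↔ c ∈ s ∧ c ∉ (∅ : Finset Cell) := by simp
  have hn := amr_sup s
  have := ws_fold hs (ssyt_rpp hR) hn hV _ 0 (Nat.zero_add _) V le_rfl
  rw [tw_zero, NN_top hs part_empty h' (ssyt_rpp hR) hV] at this
  rw [← this]
  unfold lis W
  rw [reading_eq s R hn, RW_congr (fun i _ => (wsOf_ext hn i).trans (kept_ssyt hs hR i))]
end Rows
end Part8

section Part9
set_option linter.unusedVariables false
attribute [-instance] Classical.propDecidable
attribute [local instance 10] Classical.propDecidable

def bl (n : ℕ) (F : ℕ → List ℕ) : List (ℕ × ℕ) := RW n (fun i => (F i).map (fun a => (i+1, a)))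
def topW (n : ℕ) (F : ℕ → List ℕ) : List ℕ := RW n (fun i => List.replicate (F i).length (i+1))

theorem bl_fst (n : ℕ) (F : ℕ → List ℕ) : (bl n F).map Prod.fst = topW n F := by
  unfold bl topW
  rw [RW_map]
  refine RW_congr fun i _ => ?_
  rw [List.map_map]; exact List.map_const'
theorem bl_snd (n : ℕ) (F : ℕ → List ℕ) : (bl n F).map Prod.snd = RW n F := by
  unfold bl
  rw [RW_map]
  refine RW_congr fun i _ => ?_
  rw [List.map_map]; exact List.map_id _

def br (a b : ℕ × ℕ) : Prop := b.1 < a.1 ∨ (b.1 = a.1 ∧ a.2 ≤ b.2)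

instance br_trans : Trans br br br := ⟨fun {a b c} h1 h2 => by unfold br at *; omega⟩

theorem biword_iff (L : List (ℕ × ℕ)) : IsBiword (L.map Prod.fst) (L.map Prod.snd) ↔
    (∀ p ∈ L, 1 ≤ p.1) ∧ (∀ p ∈ L, 1 ≤ p.2) ∧ L.Pairwise br := by
  rw [← List.isChain_iff_pairwise, List.isChain_iff_getElem]
  unfold IsBiword
  have h1 : (∀ x ∈ L.map Prod.fst, 1 ≤ x) ↔ ∀ p ∈ L, 1 ≤ p.1 := by simp [List.forall_mem_map]
  have h2 : (∀ x ∈ L.map Prod.snd, 1 ≤ x) ↔ ∀ p ∈ L, 1 ≤ p.2 := by simp only [List.forall_mem_map]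
  rw [h1, h2]
  refine ⟨fun h => ⟨h.2.1, h.2.2.1, fun p hp => ?_⟩, fun h => ⟨by simp, h.1, h.2.1, fun p hp => ?_⟩⟩
  · have := h.2.2.2 p (by rw [List.length_map]; exact hp)
    rw [List.getD_eq_getElem _ _ (by rw [List.length_map]; omega), List.getD_eq_getElem _ _ (by rw [List.length_map]; omega),
      List.getD_eq_getElem _ _ (by rw [List.length_map]; omega), List.getD_eq_getElem _ _ (by rw [List.length_map]; omega)] at this
    simp only [List.getElem_map] at this
    unfold br; omega
  · rw [List.length_map] at hp
    have := h.2.2 p hp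
    rw [List.getD_eq_getElem _ _ (by rw [List.length_map]; omega), List.getD_eq_getElem _ _ (by rw [List.length_map]; omega),
      List.getD_eq_getElem _ _ (by rw [List.length_map]; omega), List.getD_eq_getElem _ _ (by rw [List.length_map]; omega)]
    simp only [List.getElem_map]
    unfold br at this; omega

theorem biword_rows (n : ℕ) (F : ℕ → List ℕ) (h1 : ∀ i, (F i).Pairwise (· ≤ ·)) (h2 : ∀ i, ∀ a ∈ F i, 1 ≤ a) :
    IsBiword (topW n F) (RW n F) := by
  rw [← bl_fst, ← bl_snd, biword_iff]
  refine ⟨?_, ?_, ?_⟩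
  · intro p hp
    obtain ⟨i, _, hi⟩ := mem_RW.1 hp
    obtain ⟨a, _, rfl⟩ := List.mem_map.1 hi
    simp
  · intro p hp
    obtain ⟨i, _, hi⟩ := mem_RW.1 hp
    obtain ⟨a, ha, rfl⟩ := List.mem_map.1 hi
    exact h2 i a ha
  · refine RW_pairwise _ _ _ ?_ ?_
    · intro i _
      rw [List.pairwise_map]
      exact (h1 i).imp (fun h => Or.inr ⟨rfl, h⟩)
    · intro i j hij a ha b hb
      obtain ⟨a, ha, rfl⟩ := List.mem_map.1 ha
      obtain ⟨b, hb, rfl⟩ := List.mem_map.1 hb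
      left; simp only; omega

theorem filter_RW {α : Type*} (p : α → Bool) (n : ℕ) (F : ℕ → List α) :
    (RW n F).filter p = RW n (fun i => (F i).filter p) := by
  induction n with
  | zero => rfl
  | succ n ih => rw [RW_succ, RW_succ, List.filter_append, ih]

theorem RW_single {α : Type*} {n i : ℕ} (F : ℕ → List α) (hi : i < n) (h : ∀ k, k ≠ i → F k = []) : RW n F = F i := by
  induction n with
  | zero => omega
  | succ n ih =>
    rw [RW_succ]
    by_cases hn : i = n
    · subst hn
      have h0 : ∀ m, RW m (fun _ => ([] : List α)) = [] := fun m => by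
        induction m with
        | zero => rfl
        | succ m ih => rw [RW_succ, ih]; rfl
      have h1 : RW i F = RW i (fun _ => ([] : List α)) := RW_congr fun k hk => h k (by omega)
      rw [h1, h0, List.append_nil]
    · rw [h n (Ne.symm hn), ih (by omega)]; rfl

theorem bl_filter (n : ℕ) (F : ℕ → List ℕ) {i : ℕ} (hi : i < n) :
    ((bl n F).filter (fun p => p.1 == i+1)).map Prod.snd = F i := by
  unfold bl
  rw [filter_RW, RW_map, RW_single (i := i) _ hi]
  · rw [List.filter_eq_self.2, List.map_map]
    · exact List.map_id _
    · intro a ha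
      obtain ⟨b, _, rfl⟩ := List.mem_map.1 ha
      simp
  · intro k hk
    rw [List.filter_eq_nil_iff.2]
    · rfl
    · intro a ha
      obtain ⟨b, _, rfl⟩ := List.mem_map.1 ha
      simp [hk]

theorem bl_inj {n : ℕ} {F G : ℕ → List ℕ} (h1 : topW n F = topW n G) (h2 : RW n F = RW n G) (i : ℕ) (hi : i < n) :
    F i = G i := by
  rw [← bl_filter n F hi, ← bl_filter n G hi]
  congr 2
  rw [← bl_fst, ← bl_fst] at h1
  rw [← bl_snd, ← bl_snd] at h2
  have hz : ∀ L : List (ℕ × ℕ), (L.map Prod.fst).zip (L.map Prod.snd) = L := fun L => by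
    rw [← List.unzip_fst, ← List.unzip_snd, List.zip_unzip]
  rw [← hz (bl n F), h1, h2, hz]

theorem bl_surj (n : ℕ) (L : List (ℕ × ℕ)) (hL : L.Pairwise br) (h : ∀ p ∈ L, 1 ≤ p.1 ∧ p.1 ≤ n) :
    RW n (fun i => L.filter (fun p => p.1 == i+1)) = L := by
  induction n generalizing L with
  | zero =>
    cases L with
    | nil => rfl
    | cons a L => have := h a (by simp); omega
  | succ n ih =>
    rw [RW_succ]
    have h1 := ih (L.filter (fun p => decide (p.1 ≤ n))) (hL.filter _) (fun p hp => by
      have h2 := List.mem_filter.1 hp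
      have := h p h2.1
      exact ⟨this.1, by simpa using h2.2⟩)
    have h2 : RW n (fun i => L.filter (fun p => p.1 == i+1)) = L.filter (fun p => decide (p.1 ≤ n)) := by
      rw [← h1]
      refine RW_congr fun i hi => ?_
      rw [List.filter_filter]
      refine List.filter_congr fun p _ => ?_
      by_cases hp : p.1 = i+1
      · simp [hp]; omega
      · simp [hp]
    rw [h2]
    have h3 : L.filter (fun p => decide (p.1 ≤ n)) = L.filter (fun p => !(p.1 == n+1)) := by
      refine List.filter_congr fun p hp => ?_
      have := h p hp
      rw [Bool.eq_iff_iff, decide_eq_true_iff]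
      have e : ((!(p.1 == n+1)) = true) ↔ p.1 ≠ n+1 := by simp
      rw [e]; omega
    rw [h3]
    refine List.Perm.eq_of_pairwise (le := br) ?_ ?_ hL (List.filter_append_perm _ _)
    · intro a b _ _ h1 h2
      unfold br at h1 h2
      rw [Prod.ext_iff]; omega
    · rw [List.pairwise_append]
      refine ⟨hL.filter _, hL.filter _, ?_⟩
      intro a ha b hb
      have h4 := (List.mem_filter.1 ha).2
      have h5 := (List.mem_filter.1 hb)
      have := h b h5.1
      have h6 := h5.2
      have h7 : a.1 = n+1 := by simpa using h4
      have h8 : b.1 ≠ n+1 := by simpa using h6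
      unfold br; omega

theorem biword_decomp {n V K : ℕ} {top bot : List ℕ} (h : IsBiword top bot) (ht : ∀ a ∈ top, a ≤ n) (hb : ∀ a ∈ bot, a ≤ V)
    (hK : bot.length ≤ K) : ∃ ws ∈ WS n V K, topW n (extL n ws) = top ∧ W n ws = bot := by
  set L := top.zip bot with hL
  have e1 : L.map Prod.fst = top := List.map_fst_zip h.1.le
  have e2 : L.map Prod.snd = bot := List.map_snd_zip h.1.ge
  have h' := h
  rw [← e1, ← e2, biword_iff] at h'
  obtain ⟨h1, h2, h3⟩ := h'
  have hm1 : ∀ p ∈ L, p.1 ≤ n := fun p hp => ht _ (by rw [← e1]; exact List.mem_map_of_mem hp)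
  have hm2 : ∀ p ∈ L, p.2 ≤ V := fun p hp => hb _ (by rw [← e2]; exact List.mem_map_of_mem hp)
  have h4 := bl_surj n L h3 (fun p hp => ⟨h1 p hp, hm1 p hp⟩)
  have h5 : bl n (extL n (fun i : Fin n => (L.filter (fun p => p.1 == (i:ℕ)+1)).map Prod.snd)) = L := by
    refine Eq.trans ?_ h4
    unfold bl
    refine RW_congr fun i hi => ?_
    unfold extL
    rw [dif_pos hi, List.map_map]
    conv_rhs => rw [← List.map_id (L.filter (fun p => p.1 == i+1))]
    refine List.map_congr_left fun p hp => ?_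
    have := (List.mem_filter.1 hp).2
    simp at this
    simp [← this]
  refine ⟨fun i => (L.filter (fun p => p.1 == (i:ℕ)+1)).map Prod.snd, ?_, ?_, ?_⟩
  · rw [mem_WS]
    intro i
    rw [mem_XL]
    refine ⟨?_, ?_, ?_⟩
    · rw [List.pairwise_map]
      refine (h3.filter _).imp_of_mem ?_
      intro a b ha hb hab
      have := (List.mem_filter.1 ha).2
      have := (List.mem_filter.1 hb).2
      simp at *
      unfold br at hab
      omega
    · intro a ha
      obtain ⟨p, hp, rfl⟩ := List.mem_map.1 ha
      have := (List.mem_filter.1 hp).1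
      exact ⟨h2 p this, hm2 p this⟩
    · rw [List.length_map]
      refine (List.length_filter_le _ _).trans ?_
      rw [← e2, List.length_map] at hK
      exact hK
  · rw [← bl_fst, h5, e1]
  · unfold W; rw [← bl_snd, h5, e2]

theorem topW_count (n : ℕ) (ws : Fin n → List ℕ) (i : Fin n) : (topW n (extL n ws)).count ((i:ℕ)+1) = (ws i).length := by
  unfold topW
  rw [RW_count, Finset.sum_eq_single (i:ℕ)]
  · rw [List.count_replicate, extL_fin]; simp
  · intro b _ hb
    rw [List.count_replicate]; simp [hb]
  · intro h; exact absurd (Finset.mem_range.2 i.2) h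

theorem mem_topW {n : ℕ} {F : ℕ → List ℕ} {a : ℕ} (h : a ∈ topW n F) : 1 ≤ a ∧ a ≤ n := by
  obtain ⟨i, hi, h⟩ := mem_RW.1 h
  have := (List.mem_replicate.1 h).2; omega

theorem ws_biword {n V K : ℕ} {ws : Fin n → List ℕ} (h : ws ∈ WS n V K) : IsBiword (topW n (extL n ws)) (W n ws) :=
  biword_rows _ _ (fun i => (mem_XL.1 (WS_row h i)).1) (fun i a ha => ((mem_XL.1 (WS_row h i)).2.1 a ha).1)

theorem mem_reading {s : Finset Cell} {T : Cell → ℕ} {a : ℕ} : a ∈ readingWordOn s T ↔ ∃ c ∈ s, T c = a := by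
  rw [reading_cells, List.mem_map]
  simp only [mem_cellsOf]
theorem reading_length (s : Finset Cell) (T : Cell → ℕ) : (readingWordOn s T).length = s.card := by
  rw [reading_cells, List.length_map, ← List.toFinset_card_of_nodup (cells_nodup s), cells_toFinset]

theorem wtS_pos {s : Finset Cell} {T : Cell → ℕ} {c : Cell} (hc : c ∈ s) : 0 < wtS s T (T c) := by
  rw [wtS_card]; exact Finset.card_pos.2 ⟨c, Finset.mem_filter.2 ⟨hc, rfl⟩⟩

theorem BurgeData.cQ (B : BurgeData) {top bot : List ℕ} (h : IsBiword top bot) (v : ℕ) :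
    wtS (B.out top bot).sh (B.out top bot).Q v = top.count v := by
  rw [B.contentQ _ _ h]; exact count_inst _ _ _ _
theorem BurgeData.cP (B : BurgeData) {top bot : List ℕ} (h : IsBiword top bot) (v : ℕ) :
    wtS (B.out top bot).sh (B.out top bot).P v = bot.count v := by
  rw [B.contentP _ _ h]; exact count_inst _ _ _ _

theorem Q_le (B : BurgeData) {n : ℕ} {top bot : List ℕ} (h : IsBiword top bot) (ht : ∀ a ∈ top, a ≤ n) :
    ∀ c ∈ (B.out top bot).sh, (B.out top bot).Q c ≤ n := by
  intro c hc
  have := wtS_pos (T := (B.out top bot).Q) hc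
  rw [B.cQ h] at this
  exact ht _ (List.count_pos_iff.1 this)

theorem amr_of_le {s : Finset Cell} {Q : Cell → ℕ} (hs : IsPartitionShape s) (hQ : IsSSYTOn s Q) {n : ℕ}
    (h : ∀ c ∈ s, Q c ≤ n) : AtMostRows s n := by
  rintro ⟨i, j⟩ hc
  have := ssyt_ge hs hQ hc
  have := h _ hc
  simp only; omega

theorem class_rep (B : BurgeData) {n V K : ℕ} {ws : Fin n → List ℕ} (h : ws ∈ WS n V K) :
    ∃ sh Q, IsPartitionShape sh ∧ IsSSYTOn sh Q ∧ (∀ c ∈ sh, Q c ≤ V) ∧ AtMostRows sh n ∧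
      sh.card = (W n ws).length ∧ KnuthEquiv (W n ws) (readingWordOn sh Q) := by
  have hb := ws_biword h
  have hk := (B.knuthP _ _ hb).symm
  refine ⟨_, _, B.shape_part _ _ hb, B.ssytP _ _ hb, ?_,
    amr_of_le (B.shape_part _ _ hb) (B.ssytQ _ _ hb) (Q_le B hb (fun a ha => (mem_topW ha).2)), ?_, hk⟩
  · intro c hc
    exact (W_letters h (hk.perm.mem_iff.2 (mem_reading.2 ⟨c, hc, rfl⟩))).2
  · rw [hk.perm.length_eq, reading_length]

theorem mem_svtOf {U : Cell → ℕ} {c : Cell} {x : ℕ} : x ∈ svtOf U c ↔ x = U c ∧ U c ≠ 0 := by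
  unfold svtOf
  split_ifs with h <;> simp [h]

theorem svtOf_inj {U U' : Cell → ℕ} (h : svtOf U = svtOf U') : U = U' := by
  funext c
  by_cases h1 : U c = 0
  · by_cases h2 : U' c = 0
    · rw [h1, h2]
    · have : U' c ∈ svtOf U c := by rw [h]; exact mem_svtOf.2 ⟨rfl, h2⟩
      exact (mem_svtOf.1 this).1.symm
  · have : U c ∈ svtOf U' c := by rw [← h]; exact mem_svtOf.2 ⟨rfl, h1⟩
    exact (mem_svtOf.1 this).1

theorem svtOf_svt {n : ℕ} {s : Finset Cell} {U : Cell → ℕ} (h : IsSSYTOn s U) (hn : ∀ c ∈ s, U c ≤ n) :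
    IsSVTOn n s (svtOf U) ∧ exTotal s (svtOf U) = 0 ∧ ∀ v, wtOn s (svtOf U) (v+1) = wtS s U (v+1) := by
  refine ⟨⟨?_, ?_, ?_, ?_, ?_⟩, ?_, ?_⟩
  · intro c hc; exact ⟨U c, mem_svtOf.2 ⟨rfl, by have := h.1 c hc; omega⟩⟩
  · intro c hc
    rw [Finset.eq_empty_iff_forall_notMem]
    intro x hx
    exact (mem_svtOf.1 hx).2 (h.2.1 c hc)
  · intro c x hx
    obtain ⟨rfl, h2⟩ := mem_svtOf.1 hx
    by_cases hc : c ∈ s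
    · exact ⟨h.1 c hc, hn c hc⟩
    · exact absurd (h.2.1 c hc) h2
  · intro i j h1 h2 x hx y hy
    rw [(mem_svtOf.1 hx).1, (mem_svtOf.1 hy).1]; exact h.2.2.1 i j h1 h2
  · intro i j h1 h2 x hx y hy
    rw [(mem_svtOf.1 hx).1, (mem_svtOf.1 hy).1]; exact h.2.2.2 i j h1 h2
  · unfold exTotal
    rw [Finset.sum_congr rfl (g := fun _ => 1)]
    · simp
    · intro c hc
      rw [Finset.card_eq_one]
      refine ⟨U c, ?_⟩
      ext x
      rw [mem_svtOf, Finset.mem_singleton]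
      have := h.1 c hc
      constructor
      · exact fun h => h.1
      · exact fun h => ⟨h, by omega⟩
  · intro v
    rw [wtOn_card, wtS_card]
    congr 1
    refine Finset.filter_congr fun c hc => ?_
    rw [mem_svtOf]
    constructor
    · exact fun h => h.1.symm
    · exact fun h => ⟨h.symm, by omega⟩

theorem svt_zero {n : ℕ} {s : Finset Cell} {T : Cell → Finset ℕ} (h : IsSVTOn n s T) (h0 : exTotal s T = 0) :
    ∃ U, IsSSYTOn s U ∧ (∀ c ∈ s, U c ≤ n) ∧ T = svtOf U := by
  have hc1 : ∀ c ∈ s, (T c).card = 1 := by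
    have h1 : ∀ c ∈ s, 1 ≤ (T c).card := fun c hc => Finset.card_pos.2 (h.1 c hc)
    have h2 : ∑ c ∈ s, 1 = ∑ c ∈ s, (T c).card := by
      refine le_antisymm (Finset.sum_le_sum h1) ?_
      unfold exTotal at h0
      simp; omega
    exact fun c hc => ((Finset.sum_eq_sum_iff_of_le h1).1 h2 c hc).symm
  have hU : ∀ c ∈ s, T c = {(T c).sup id} := by
    intro c hc
    obtain ⟨a, ha⟩ := Finset.card_eq_one.1 (hc1 c hc)
    rw [ha]; simp
  have hm : ∀ c ∈ s, (T c).sup id ∈ T c := fun c hc => by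
    obtain ⟨a, ha⟩ := Finset.card_eq_one.1 (hc1 c hc)
    rw [ha]; simp
  refine ⟨fun c => (T c).sup id, ⟨?_, ?_, ?_, ?_⟩, ?_, ?_⟩
  · intro c hc; exact (h.2.2.1 c _ (hm c hc)).1
  · intro c hc; simp only; rw [h.2.1 c hc]; rfl
  · intro i j h1 h2; exact h.2.2.2.1 i j h1 h2 _ (hm _ h1) _ (hm _ h2)
  · intro i j h1 h2; exact h.2.2.2.2 i j h1 h2 _ (hm _ h1) _ (hm _ h2)
  · intro c hc; exact (h.2.2.1 c _ (hm c hc)).2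
  · funext c
    ext x
    rw [mem_svtOf]
    by_cases hc : c ∈ s
    · constructor
      · intro hx
        have e : x = (T c).sup id := by rw [hU c hc] at hx; exact Finset.mem_singleton.1 hx
        have := (h.2.2.1 c x hx).1
        exact ⟨e, by omega⟩
      · rintro ⟨rfl, _⟩; exact hm c hc
    · rw [h.2.1 c hc]; simp

theorem fiber {A : Type*} [CommRing A] (B : BurgeData) {n V K : ℕ} {sh : Finset Cell} {Q0 : Cell → ℕ}
    (hs : IsPartitionShape sh) (hQ : IsSSYTOn sh Q0) (hV : ∀ c ∈ sh, Q0 c ≤ V) (hK : sh.card ≤ K) (y : Fin n → A) :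
    ∑ ws ∈ (WS n V K).filter (fun ws => KnuthEquiv (W n ws) (readingWordOn sh Q0)), ∏ i, y i ^ (ws i).length
      = Gsum 0 n sh y := by
  have key : ∀ ws ∈ (WS n V K).filter (fun ws => KnuthEquiv (W n ws) (readingWordOn sh Q0)),
      (B.out (topW n (extL n ws)) (W n ws)).sh = sh ∧ (B.out (topW n (extL n ws)) (W n ws)).P = Q0 := by
    intro ws hw
    obtain ⟨h1, h2⟩ := Finset.mem_filter.1 hw
    have hb := ws_biword h1
    exact ssyt_unique (B.shape_part _ _ hb) (B.ssytP _ _ hb) hs hQ ((B.knuthP _ _ hb).trans h2)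
  have key2 : ∀ ws ∈ (WS n V K).filter (fun ws => KnuthEquiv (W n ws) (readingWordOn sh Q0)),
      IsSVTOn n sh (svtOf (B.out (topW n (extL n ws)) (W n ws)).Q) ∧
      exTotal sh (svtOf (B.out (topW n (extL n ws)) (W n ws)).Q) = 0 ∧
      ∀ v, wtOn sh (svtOf (B.out (topW n (extL n ws)) (W n ws)).Q) (v+1) = (topW n (extL n ws)).count (v+1) := by
    intro ws hw
    have hb := ws_biword (Finset.mem_filter.1 hw).1
    have h1 := B.ssytQ _ _ hb
    have h2 := Q_le B hb (fun a ha => (mem_topW ha).2)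
    have h3 := B.cQ hb
    rw [(key ws hw).1] at h1 h2
    have h4 := svtOf_svt h1 h2
    refine ⟨h4.1, h4.2.1, fun v => ?_⟩
    rw [h4.2.2, ← h3, (key ws hw).1]
  have val : ∀ ws ∈ (WS n V K).filter (fun ws => KnuthEquiv (W n ws) (readingWordOn sh Q0)),
      ∏ i, y i ^ (ws i).length = (-0)^exTotal sh (svtOf (B.out (topW n (extL n ws)) (W n ws)).Q) *
        ∏ i : Fin n, y i ^ wtOn sh (svtOf (B.out (topW n (extL n ws)) (W n ws)).Q) ((i:ℕ)+1) := by
    intro ws hw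
    obtain ⟨_, h1, h2⟩ := key2 ws hw
    rw [h1, pow_zero, one_mul]
    refine Finset.prod_congr rfl fun i _ => ?_
    rw [h2, topW_count]
  unfold Gsum
  refine Finset.sum_bij_ne_zero (fun ws _ _ => svtOf (B.out (topW n (extL n ws)) (W n ws)).Q) ?_ ?_ ?_ ?_
  · intro ws hw _
    exact mem_svtF.2 (key2 ws hw).1
  · intro ws hw _ ws' hw' _ e
    have e1 := svtOf_inj e
    have b1 := ws_biword (Finset.mem_filter.1 hw).1
    have b2 := ws_biword (Finset.mem_filter.1 hw').1
    obtain ⟨k1, k2⟩ := key ws hw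
    obtain ⟨k3, k4⟩ := key ws' hw'
    have : B.out (topW n (extL n ws)) (W n ws) = B.out (topW n (extL n ws')) (W n ws') := by
      generalize B.out (topW n (extL n ws)) (W n ws) = o at *
      generalize B.out (topW n (extL n ws')) (W n ws') = o' at *
      cases o; cases o'; simp only at *; subst k1 k2 k3 k4 e1; rfl
    obtain ⟨t1, t2⟩ := B.inj _ _ _ _ b1 b2 this
    funext i
    rw [← extL_fin ws i, ← extL_fin ws' i]
    exact bl_inj t1 t2 i i.2
  · intro T hT hne
    have hT := mem_svtF.1 hT
    have h0 : exTotal sh T = 0 := by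
      by_contra h
      rw [neg_zero, zero_pow h, zero_mul] at hne
      exact hne rfl
    obtain ⟨U, u1, u2, rfl⟩ := svt_zero hT h0
    obtain ⟨top, bot, b1, b2⟩ := B.surj sh Q0 U hs hQ u1
    have hk := B.knuthP _ _ b1
    have hc := B.cQ b1
    rw [b2] at hk hc
    simp only at hk hc
    have ht : ∀ a ∈ top, a ≤ n := by
      intro a ha
      have := List.count_pos_iff.2 ha
      rw [← hc, wtS_card] at this
      obtain ⟨c, hcc⟩ := Finset.card_pos.1 this
      obtain ⟨c1, rfl⟩ := Finset.mem_filter.1 hcc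
      exact u2 c c1
    obtain ⟨ws, w1, w2, w3⟩ := biword_decomp (n := n) (V := V) (K := K) b1 ht (fun a ha => by
      obtain ⟨c, c1, rfl⟩ := mem_reading.1 (hk.perm.mem_iff.2 ha)
      exact hV c c1) (by rw [← hk.perm.length_eq, reading_length]; exact hK)
    have hmem : ws ∈ (WS n V K).filter (fun ws => KnuthEquiv (W n ws) (readingWordOn sh Q0)) :=
      Finset.mem_filter.2 ⟨w1, by rw [w3]; exact hk.symm⟩
    have hQe : (B.out (topW n (extL n ws)) (W n ws)).Q = U := by rw [w2, w3, b2]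
    refine ⟨ws, hmem, ?_, ?_⟩
    · rw [val ws hmem, hQe]; exact hne
    · rw [hQe]
  · intro ws hw _
    exact val ws hw
end Part9

section Part10
set_option linter.unusedVariables false
attribute [-instance] Classical.propDecidable
attribute [local instance 10] Classical.propDecidable

theorem sum_WS_succ {A : Type*} [AddCommMonoid A] (n V K : ℕ) (f : (Fin (n+1) → List ℕ) → A) :
    ∑ ws ∈ WS (n+1) V K, f ws = ∑ a ∈ XL V K, ∑ ws ∈ WS n V K, f (Fin.cons a ws) := by
  rw [← Finset.sum_product']
  refine Finset.sum_nbij' (fun ws => (ws 0, fun k => ws k.succ)) (fun p => Fin.cons p.1 p.2) ?_ ?_ ?_ ?_ ?_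
  · intro ws h
    rw [mem_WS] at h
    exact Finset.mem_product.2 ⟨h 0, mem_WS.2 fun k => h k.succ⟩
  · intro p h
    obtain ⟨h1, h2⟩ := Finset.mem_product.1 h
    rw [mem_WS] at h2
    rw [mem_WS]
    intro i
    refine Fin.cases ?_ (fun k => ?_) i
    · exact h1
    · exact h2 k
  · intro ws h
    exact Fin.cons_self_tail ws
  · intro p h
    rfl
  · intro ws h
    exact congrArg f (Fin.cons_self_tail ws).symm

theorem class_sum {A : Type*} [CommRing A] (B : BurgeData) (n V K : ℕ) (c : List ℕ → A)
    (hc : ∀ u v, KnuthEquiv u v → c u = c v) (hK : ∀ w : List ℕ, K < w.length → c w = 0)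
    (G g : (Fin n → List ℕ) → A)
    (h : ∀ sh Q, IsPartitionShape sh → IsSSYTOn sh Q → (∀ c ∈ sh, Q c ≤ V) → AtMostRows sh n → sh.card ≤ K →
      ∑ ws ∈ (WS n V K).filter (fun ws => KnuthEquiv (W n ws) (readingWordOn sh Q)), G ws =
      ∑ ws ∈ (WS n V K).filter (fun ws => KnuthEquiv (W n ws) (readingWordOn sh Q)), g ws) :
    ∑ ws ∈ WS n V K, c (W n ws) * G ws = ∑ ws ∈ WS n V K, c (W n ws) * g ws := by
  rw [← sub_eq_zero, ← Finset.sum_sub_distrib]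
  let S : Setoid (Fin n → List ℕ) := ⟨fun a b => KnuthEquiv (W n a) (W n b),
    ⟨fun a => KnuthEquiv.refl _, fun h => h.symm, fun h h' => h.trans h'⟩⟩
  refine Finset.sum_cancels_of_partition_cancels S fun ws hws => ?_
  have e1 : ∀ ws' ∈ (WS n V K).filter (fun a => S a ws), c (W n ws') * G ws' - c (W n ws') * g ws' =
      c (W n ws) * (G ws' - g ws') := by
    intro ws' hw
    rw [hc _ _ (Finset.mem_filter.1 hw).2]; ring
  rw [Finset.sum_congr rfl e1, ← Finset.mul_sum]
  by_cases hl : K < (W n ws).length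
  · rw [hK _ hl, zero_mul]
  · obtain ⟨sh, Q, h1, h2, h3, h4, h5, h6⟩ := class_rep B hws
    have e2 : (WS n V K).filter (fun a => S a ws) =
        (WS n V K).filter (fun ws => KnuthEquiv (W n ws) (readingWordOn sh Q)) := by
      refine Finset.filter_congr fun a _ => ?_
      exact ⟨fun h => h.trans h6, fun h => h.trans h6.symm⟩
    rw [e2, Finset.sum_sub_distrib, h sh Q h1 h2 h3 h4 (by omega), sub_self, mul_zero]

theorem peel {A : Type*} [CommRing A] [IsDomain A] (B : BurgeData) (n V K : ℕ) (c : List ℕ → A)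
    (hc : ∀ u v, KnuthEquiv u v → c u = c v) (hK : ∀ w : List ℕ, K < w.length → c w = 0) (x : Fin n → A) :
    ∑ ws ∈ WS n V K, c (W n ws) * DD 1 n (lamOf V n ws) x =
    ∑ ws ∈ WS n V K, c (W n ws) * (VV n x * ∏ i, x i ^ (ws i).length) := by
  induction n generalizing c with
  | zero =>
    refine Finset.sum_congr rfl fun ws _ => ?_
    rw [DD_zero, VV_zero]; simp
  | succ n ih =>
    have step1 : ∑ ws ∈ WS (n+1) V K, c (W (n+1) ws) * DD 1 (n+1) (lamOf V (n+1) ws) x =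
        ∑ ws ∈ WS (n+1) V K, c (W (n+1) ws) * ∑ j : Fin (n+1), (-1)^(j:ℕ) * x j ^ (lis V (W (n+1) ws) + n) *
          (VV (n+1) (Fin.cons 1 (fun k => x (j.succAbove k))) *
            ∏ i, (Fin.cons 1 (fun k => x (j.succAbove k)) : Fin (n+1) → A) i ^ (ws i).length) := by
      rw [sum_WS_succ, sum_WS_succ]
      refine Finset.sum_congr rfl fun a _ => ?_
      simp only [DD_laplace, lamOf_zero, lamOf_succ, W_succ, Fin.cons_zero, Fin.cons_succ, Fin.prod_univ_succ,
        one_pow, one_mul, VV_cons]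
      simp only [Finset.mul_sum]
      rw [Finset.sum_comm, Finset.sum_comm (s := WS n V K)]
      refine Finset.sum_congr rfl fun j _ => ?_
      have := ih (fun w => c (w ++ a) * x j ^ lis V (w ++ a)) (fun u v h => by
          have h' := KnuthEquiv.append_right a h
          simp only [hc _ _ h', h'.lis]) (fun w hw => by
          rw [hK _ (by rw [List.length_append]; omega), zero_mul]) (fun k => x (j.succAbove k))
      have e := congrArg (fun z => (-1)^(j:ℕ) * x j ^ n * (∏ k : Fin n, (1 - x (j.succAbove k))) * z) this
      simp only [Finset.mul_sum] at e
      refine Eq.trans (Finset.sum_congr rfl fun ws _ => ?_) (e.trans (Finset.sum_congr rfl fun ws _ => ?_))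
      · rw [pow_add]; ring
      · rw [pow_add]; ring
    rw [step1]
    refine class_sum B (n+1) V K c hc hK _ _ ?_
    intro sh Q h1 h2 h3 h4 h5
    have hl : Antitone (fun i : Fin (n+1) => rl sh i) := fun a b h => rl_anti h1 h
    have hb : ∀ y : Fin (n+1) → A, VV (n+1) y * Gsum 0 (n+1) sh y = DD 0 (n+1) (fun i => rl sh i) y := by
      intro y
      have := bialternant (0:A) (n+1) (fun i => rl sh i) hl y (fun i => by simp)
      rwa [shp_rl h1 h4] at this
    rw [← Finset.mul_sum, fiber B h1 h2 h3 h5, hb, ← DD_one_cons, Finset.sum_comm]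
    refine Finset.sum_congr rfl fun j _ => ?_
    rw [← hb, ← fiber B h1 h2 h3 h5, Finset.mul_sum, Finset.mul_sum]
    refine Finset.sum_congr rfl fun ws hw => ?_
    rw [(Finset.mem_filter.1 hw).2.lis, lis_ssyt h1 h2 h3]
    rfl

theorem one_sub_X_ne {n : ℕ} (i : Fin n) : (1 : XPoly n) - 1 * MvPolynomial.X i ≠ 0 := by
  intro h
  have := congrArg (MvPolynomial.eval (fun _ => (0:ℤ))) h
  simp at this

/-- Schur function into the RG functions. -/
theorem schur_RG (B : BurgeData) {n V K : ℕ} {sh : Finset Cell} {Q : Cell → ℕ} (hs : IsPartitionShape sh)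
    (hQ : IsSSYTOn sh Q) (hV : ∀ c ∈ sh, Q c ≤ V) (hK : sh.card ≤ K) :
    ∑ ws ∈ (WS n V K).filter (fun ws => KnuthEquiv (W n ws) (readingWordOn sh Q)), RGone n (shp n (lamOf V n ws))
      = Gsum 0 n sh (fun i => MvPolynomial.X i : Fin n → XPoly n) := by
  have hp := peel B n V K (fun w => if KnuthEquiv w (readingWordOn sh Q) then (1 : XPoly n) else 0)
    (fun u v h => by
      have : KnuthEquiv u (readingWordOn sh Q) ↔ KnuthEquiv v (readingWordOn sh Q) :=
        ⟨fun h' => h.symm.trans h', fun h' => h.trans h'⟩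
      simp only [this])
    (fun w hw => by
      rw [if_neg]
      intro h
      have := h.perm.length_eq
      rw [reading_length] at this; omega) (fun i => MvPolynomial.X i)
  simp only [ite_mul, one_mul, zero_mul] at hp
  rw [← Finset.sum_filter, ← Finset.sum_filter, ← Finset.mul_sum, fiber B hs hQ hV hK] at hp
  refine mul_left_cancel₀ (VV_ne_zero n (fun i => (MvPolynomial.X i : XPoly n)) (MvPolynomial.X_injective)) ?_
  rw [← hp, Finset.mul_sum]
  refine Finset.sum_congr rfl fun ws hw => ?_
  rw [RGone_eq, bialternant _ _ _ (lamOf_anti (Finset.mem_filter.1 hw).1) _ one_sub_X_ne]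
end Part10

section Part11
set_option linter.unusedVariables false
attribute [-instance] Classical.propDecidable
attribute [local instance 10] Classical.propDecidable

theorem yam_rep (k v : ℕ) (w : List ℕ) : IsYamanouchi (List.replicate k (v+2) ++ w) ↔
    IsYamanouchi w ∧ k + w.count (v+2) ≤ w.count (v+1) := by
  induction k with
  | zero =>
    simp only [List.replicate_zero, List.nil_append, Nat.zero_add]
    exact ⟨fun h => ⟨h, yam_suffix h (List.suffix_refl w) v⟩, fun h => h.1⟩
  | succ k ih =>
    rw [List.replicate_succ, List.cons_append, yam_cons, ih]
    have hc : ∀ u, ((v+2) :: (List.replicate k (v+2) ++ w)).count u = (if v+2 = u then k+1 else 0) + w.count u := by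
      intro u
      rw [List.count_cons, List.count_append, List.count_replicate]
      by_cases h : v+2 = u
      · simp [h]; omega
      · simp [h]
    constructor
    · rintro ⟨h1, h2, h3⟩
      have := h1 v
      rw [hc, hc] at this
      simp at this
      exact ⟨h2, by omega⟩
    · rintro ⟨h1, h2⟩
      refine ⟨fun u => ?_, h1, by omega⟩
      have h3 := yam_suffix h1 (List.suffix_refl w) u
      rw [hc, hc]
      by_cases hu : u = v
      · subst hu; simp; omega
      · rw [if_neg (by omega)]
        split_ifs <;> omega

theorem yam_rep1 (k : ℕ) (w : List ℕ) : IsYamanouchi (List.replicate k 1 ++ w) ↔ IsYamanouchi w := by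
  induction k with
  | zero => rfl
  | succ k ih =>
    rw [List.replicate_succ, List.cons_append, yam_cons, ih]
    refine ⟨fun h => h.2, fun h => ⟨fun u => ?_, h⟩⟩
    have h3 := yam_suffix (ih.2 h) (List.suffix_refl _) u
    rw [List.count_cons, List.count_cons]
    have : (1 == u + 2) = false := by simp
    rw [this]; simp only [Bool.false_eq_true, if_false]; omega

theorem yam_mk (n : ℕ) (f : ℕ → ℕ) (w : List ℕ) : IsYamanouchi (mkRow n f ++ w) ↔
    IsYamanouchi w ∧ ∀ v, v+1 < n → f (v+1) + w.count (v+2) ≤ w.count (v+1) := by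
  induction n generalizing w with
  | zero => exact ⟨fun h => ⟨h, fun v hv => by omega⟩, fun h => h.1⟩
  | succ n ih =>
    rw [mkRow_succ, List.append_assoc, ih]
    have hc : ∀ u, u ≠ n+1 → (List.replicate (f n) (n+1) ++ w).count u = w.count u := by
      intro u hu
      rw [List.count_append, List.count_replicate]
      have : (n+1 == u) = false := by simp; omega
      rw [this]; simp
    have h2 : (∀ v, v+1 < n → f (v+1) + (List.replicate (f n) (n+1) ++ w).count (v+2) ≤ (List.replicate (f n) (n+1) ++ w).count (v+1)) ↔
        (∀ v, v+1 < n → f (v+1) + w.count (v+2) ≤ w.count (v+1)) := by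
      refine forall_congr' fun v => imp_congr_right fun hv => ?_
      rw [hc _ (by omega), hc _ (by omega)]
    rw [h2]
    cases n with
    | zero => rw [yam_rep1]; exact ⟨fun h => ⟨h.1, fun v hv => by omega⟩, fun h => ⟨h.1, fun v hv => by omega⟩⟩
    | succ n =>
      rw [yam_rep]
      constructor
      · rintro ⟨⟨h1, h2⟩, h3⟩
        refine ⟨h1, fun v hv => ?_⟩
        by_cases h : v = n
        · subst h; exact h2
        · exact h3 v (by omega)
      · rintro ⟨h1, h2⟩
        exact ⟨⟨h1, h2 n (by omega)⟩, fun v hv => h2 v (by omega)⟩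

theorem yam_RW (n k : ℕ) (m : ℕ → ℕ → ℕ) : IsYamanouchi (RW k (fun i => mkRow n (m i))) ↔
    ∀ i < k, ∀ v, v+1 < n → ∑ i' ∈ Finset.range (i+1), m i' (v+1) ≤ ∑ i' ∈ Finset.range i, m i' v := by
  induction k with
  | zero => exact ⟨fun h i hi => by omega, fun h => yam_nil⟩
  | succ k ih =>
    rw [RW_succ, yam_mk, ih]
    have hc : ∀ v, v < n → (RW k (fun i => mkRow n (m i))).count (v+1) = ∑ i' ∈ Finset.range k, m i' v := by
      intro v hv
      rw [RW_count]
      refine Finset.sum_congr rfl fun i _ => ?_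
      rw [mkRow_count, if_pos hv]
    constructor
    · rintro ⟨h1, h2⟩ i hi v hv
      by_cases h : i = k
      · subst h
        have := h2 v hv
        rw [hc _ hv, hc _ (by omega)] at this
        rw [Finset.sum_range_succ]; omega
      · exact h1 i (by omega) v hv
    · intro h
      refine ⟨fun i hi => h i (by omega), fun v hv => ?_⟩
      have := h k (by omega) v hv
      rw [hc _ hv, hc _ (by omega)]
      rw [Finset.sum_range_succ] at this; omega

theorem mk_le (n : ℕ) (f : ℕ → ℕ) {i j : ℕ} (hi : i ≤ n) (hj : j < (mkRow n f).length) :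
    (mkRow n f).getD j 0 ≤ i ↔ j < ∑ i' ∈ Finset.range i, f i' := by
  induction n, hi using Nat.le_induction with
  | base =>
    have h1 : (mkRow i f).getD j 0 ∈ mkRow i f := by
      rw [List.getD_eq_getElem _ _ hj]; exact List.getElem_mem _
    rw [mkRow_length] at hj
    exact iff_of_true (mem_mkRow h1).2 hj
  | succ n hn ih =>
    rw [mkRow_succ] at hj ⊢
    by_cases h : j < (mkRow n f).length
    · rw [List.getD_append _ _ _ _ h]; exact ih h
    · rw [List.getD_append_right _ _ _ _ (by omega)]
      have h2 : j - (mkRow n f).length < (List.replicate (f n) (n+1)).length := by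
        rw [List.length_append] at hj; omega
      rw [List.getD_eq_getElem _ _ h2, List.getElem_replicate]
      have : ∑ i' ∈ Finset.range i, f i' ≤ ∑ i' ∈ Finset.range n, f i' :=
        Finset.sum_le_sum_of_subset (by intro x; simp; omega)
      rw [mkRow_length] at h
      exact iff_of_false (by omega) (by omega)

theorem rl_shp {n : ℕ} {l : Fin n → ℕ} (hl : Antitone l) (v : ℕ) : rl (shp n l) v = extendf n l v := by
  have : ∀ j, j < rl (shp n l) v ↔ j < extendf n l v := fun j => by
    rw [← mem_part (part_shp hl), mem_shp]
  have h1 := this (rl (shp n l) v)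
  have h2 := this (extendf n l v)
  omega

theorem tab_of (n : ℕ) (m : ℕ → ℕ → ℕ)
    (hY : ∀ i < n, ∀ v, v+1 < n → ∑ i' ∈ Finset.range (i+1), m i' (v+1) ≤ ∑ i' ∈ Finset.range i, m i' v) :
    ∃ sh P, IsPartitionShape sh ∧ IsSSYTOn sh P ∧ AtMostRows sh n ∧ (∀ c ∈ sh, P c ≤ n) ∧
      ∀ v < n, rowWordOn sh P v = mkRow n (fun i => m i v) := by
  set l : Fin n → ℕ := fun v => (mkRow n (fun i => m i v)).length with hl
  have hanti : Antitone l := by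
    have h1 : ∀ v w : ℕ, v ≤ w → w < n → ∑ i' ∈ Finset.range n, m i' w ≤ ∑ i' ∈ Finset.range n, m i' v := by
      intro v w hvw
      induction w, hvw using Nat.le_induction with
      | base => intro _; exact le_rfl
      | succ w hvw ih =>
        intro hw
        have := hY (n-1) (by omega) w hw
        rw [show n - 1 + 1 = n by omega] at this
        have h2 : ∑ i' ∈ Finset.range (n-1), m i' w ≤ ∑ i' ∈ Finset.range n, m i' w :=
          Finset.sum_le_sum_of_subset (by intro x; simp; omega)
        have := ih (by omega)
        omega
    intro v w hvw
    simp only [hl, mkRow_length]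
    exact h1 v w hvw w.2
  set P : Cell → ℕ := fun c => if c.1 < n then (mkRow n (fun i => m i c.1)).getD c.2 0 else 0 with hP
  have hmem : ∀ i j, (i,j) ∈ shp n l ↔ i < n ∧ j < (mkRow n (fun i' => m i' i)).length := by
    intro i j
    rw [mem_shp]
    by_cases h : i < n
    · have := extendf_fin l ⟨i, h⟩
      simp only at this ⊢
      rw [this]; simp [h, hl]
    · simp only
      rw [extendf_ge _ (by omega)]; simp [h]
  have hval : ∀ i j, i < n → P (i,j) = (mkRow n (fun i' => m i' i)).getD j 0 := fun i j h => by simp [hP, h]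
  have hin : ∀ i j, (i,j) ∈ shp n l → 1 ≤ P (i,j) ∧ P (i,j) ≤ n := by
    intro i j h
    obtain ⟨h1, h2⟩ := (hmem i j).1 h
    rw [hval _ _ h1, List.getD_eq_getElem _ _ h2]
    exact mem_mkRow (List.getElem_mem h2)
  refine ⟨shp n l, P, part_shp hanti, ⟨fun c hc => (hin c.1 c.2 hc).1, ?_, ?_, ?_⟩, amr_shp l, fun c hc => (hin c.1 c.2 hc).2, ?_⟩
  · rintro ⟨i, j⟩ hc
    rw [hmem] at hc
    by_cases h : i < n
    · rw [hval _ _ h, List.getD_eq_default]; by_contra h2; exact hc ⟨h, by omega⟩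
    · simp [hP, h]
  · intro i j h1 h2
    obtain ⟨a1, a2⟩ := (hmem _ _).1 h1
    obtain ⟨_, a3⟩ := (hmem _ _).1 h2
    rw [hval _ _ a1, hval _ _ a1, List.getD_eq_getElem _ _ a2, List.getD_eq_getElem _ _ a3]
    exact List.pairwise_iff_getElem.1 (mkRow_sorted n _) j (j+1) a2 a3 (by omega)
  · intro i j h1 h2
    obtain ⟨a1, a2⟩ := (hmem _ _).1 h1
    obtain ⟨a3, a4⟩ := (hmem _ _).1 h2
    obtain ⟨b1, b2⟩ := hin _ _ h2
    obtain ⟨k, hk⟩ : ∃ k, P (i+1,j) = k+1 := ⟨P (i+1,j) - 1, by omega⟩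
    have e1 := (mk_le n (fun i' => m i' (i+1)) (i := k+1) (by omega) a4).1 (by rw [← hval _ _ a3, hk])
    have e2 := (mk_le n (fun i' => m i' i) (i := k) (by omega) a2).2 (lt_of_lt_of_le e1 (hY k (by omega) i a3))
    rw [← hval _ _ a1] at e2
    omega
  · intro v hv
    unfold rowWordOn
    rw [rowList_part (part_shp hanti), rl_shp hanti]
    have := extendf_fin l ⟨v, hv⟩
    simp only at this
    rw [this]
    refine List.ext_getElem (by simp [hl]) fun j h1 h2 => ?_
    rw [List.getElem_map, List.getElem_range, hval _ _ hv, List.getD_eq_getElem _ _ h2]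

theorem tab_ineq {n : ℕ} {sh : Finset Cell} {P : Cell → ℕ} (hs : IsPartitionShape sh) (hP : IsSSYTOn sh P)
    (hV : ∀ c ∈ sh, P c ≤ n) (m : ℕ → ℕ → ℕ) (h : ∀ v < n, rowWordOn sh P v = mkRow n (fun i => m i v)) :
    ∀ i < n, ∀ v, v+1 < n → ∑ i' ∈ Finset.range (i+1), m i' (v+1) ≤ ∑ i' ∈ Finset.range i, m i' v := by
  have hlen : ∀ v < n, (mkRow n (fun i => m i v)).length = rl sh v := fun v hv => by
    rw [← h v hv]; unfold rowWordOn rl; rw [List.length_map]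
  have hval : ∀ v < n, ∀ j, (v,j) ∈ sh → (mkRow n (fun i => m i v)).getD j 0 = P (v,j) := by
    intro v hv j hj
    rw [mem_part hs] at hj
    have e : rowWordOn sh P v = (List.range (rl sh v)).map (fun j => P (v,j)) := by
      unfold rowWordOn; rw [rowList_part hs]
    rw [← h v hv, e, List.getD_eq_getElem _ _ (by simpa using hj), List.getElem_map, List.getElem_range]
  intro i hi v hv
  obtain h0 | ⟨j, hj⟩ : ∑ i' ∈ Finset.range (i+1), m i' (v+1) = 0 ∨ ∃ j, ∑ i' ∈ Finset.range (i+1), m i' (v+1) = j+1 := by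
    cases ∑ i' ∈ Finset.range (i+1), m i' (v+1) with
    | zero => left; rfl
    | succ j => right; exact ⟨j, rfl⟩
  · omega
  have hjl : j < (mkRow n (fun i => m i (v+1))).length := by
    rw [mkRow_length]
    have : ∑ i' ∈ Finset.range (i+1), m i' (v+1) ≤ ∑ i' ∈ Finset.range n, m i' (v+1) :=
      Finset.sum_le_sum_of_subset (by intro x; simp; omega)
    omega
  have c1 : (v+1,j) ∈ sh := by rw [mem_part hs, ← hlen _ hv]; exact hjl
  have c2 : (v,j) ∈ sh := hs _ _ _ _ c1 (by omega) le_rfl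
  have e1 := (mk_le n (fun i' => m i' (v+1)) (i := i+1) (by omega) hjl).2 (by omega)
  rw [hval _ hv _ c1] at e1
  have e2 := hP.2.2.2 _ _ c2 c1
  have e3 := (mk_le n (fun i' => m i' v) (i := i) (by omega) (by rw [hlen _ (by omega)]; exact (mem_part hs).1 c2)).1
    (by rw [hval _ (by omega) _ c2]; omega)
  omega
end Part11

section Part12
set_option linter.unusedVariables false
attribute [-instance] Classical.propDecidable
attribute [local instance 10] Classical.propDecidable

theorem finsum_bij {α β M : Type*} [AddCommMonoid M] (f : α → M) (g : β → M) (D : Finset β) (ψ : α → β)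
    (h1 : ∀ a, f a ≠ 0 → ψ a ∈ D ∧ g (ψ a) = f a)
    (h2 : ∀ a b, f a ≠ 0 → f b ≠ 0 → ψ a = ψ b → a = b)
    (h3 : ∀ b ∈ D, g b ≠ 0 → ∃ a, ψ a = b ∧ f a = g b) : ∑ᶠ a, f a = ∑ b ∈ D, g b := by
  have hfin : (Function.support f).Finite :=
    Set.Finite.of_injOn (f := ψ) (t := (D : Set β)) (fun a ha => (h1 a ha).1) (fun a ha b hb h => h2 a b ha hb h)
      D.finite_toSet
  rw [finsum_eq_sum f hfin]
  refine Finset.sum_bij_ne_zero (fun a _ _ => ψ a) ?_ ?_ ?_ ?_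
  · intro a _ ha; exact (h1 a ha).1
  · intro a _ ha b _ hb h; exact h2 a b ha hb h
  · intro b hb hg
    obtain ⟨a, e1, e2⟩ := h3 b hb hg
    exact ⟨a, hfin.mem_toFinset.2 (by rw [Function.mem_support, e2]; exact hg), by rw [e2]; exact hg, e1⟩
  · intro a _ ha; exact (h1 a ha).2.symm

theorem tMono_congr {n : ℕ} {a b : ℕ → ℕ} (h : ∀ i : Fin n, a i = b i) : tMono n a = tMono n b := by
  unfold tMono
  congr 1
  exact Finset.prod_congr rfl fun i _ => by rw [h]

theorem liftX_Gsum (n : ℕ) (sh : Finset Cell) :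
    liftX n (Gsum 0 n sh (fun i => MvPolynomial.X i)) = Gsum 0 n sh (fun i => (MvPolynomial.X i : XTPoly n)) := by
  unfold liftX Gsum
  rw [map_sum]
  refine Finset.sum_congr rfl fun T _ => ?_
  rw [map_mul, map_pow, map_prod, neg_zero, neg_zero, map_zero]
  congr 1
  refine Finset.prod_congr rfl fun i _ => ?_
  rw [map_pow, MvPolynomial.map_X]

theorem val_kept {s : Finset Cell} {R : Cell → ℕ} {n : ℕ} (hn : AtMostRows s n) :
    ∀ k i j, (i,j) ∈ s → n ≤ i + k → ∃ i', R (i,j) ∈ kept s R i' := by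
  intro k
  induction k with
  | zero => intro i j h hk; have := hn _ h; simp only at this; omega
  | succ k ih =>
    intro i j h hk
    by_cases hc : (i+1,j) ∉ s ∨ R (i+1,j) ≠ R (i,j)
    · refine ⟨i, ?_⟩
      unfold kept
      exact List.mem_map.2 ⟨j, List.mem_filter.2 ⟨mem_rowList.2 h, decide_eq_true hc⟩, rfl⟩
    · push Not at hc
      rw [← hc.2]
      exact ih _ _ hc.1 (by omega)

section Main
variable {lam mu s : Finset Cell} {T : Cell → ℕ} {n : ℕ}

theorem amr_sk (hs : ∀ c, c ∈ s ↔ c ∈ lam ∧ c ∉ mu) (hn : AtMostRows lam n) : AtMostRows s n :=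
  fun c hc => hn c ((hs c).1 hc).1

theorem yam_tab (hl : IsPartitionShape lam) (hm : IsPartitionShape mu)
    (hs : ∀ c, c ∈ s ↔ c ∈ lam ∧ c ∉ mu) (hn : AtMostRows lam n) (hT : IsRPPOn s T) (hV : ∀ c ∈ s, T c ≤ n) :
    IsYamanouchi (rppRowWord s T) ↔ ∃ sh P, IsPartitionShape sh ∧ IsSSYTOn sh P ∧ AtMostRows sh n ∧ (∀ c ∈ sh, P c ≤ n) ∧
      ∀ v : Fin n, rowWordOn sh P v = csOf n s T v := by
  have e : rppRowWord s T = RW n (fun i => mkRow n ((fun i v => (kept s T i).count (v+1)) i)) := by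
    rw [rowWord_eq (amr_sk hs hn)]
    exact RW_congr fun i _ => (kept_mkRow hl hm hs hT hV i).symm
  rw [e, yam_RW]
  constructor
  · intro h
    obtain ⟨sh, P, h1, h2, h3, h4, h5⟩ := tab_of n (fun i v => (kept s T i).count (v+1)) h
    exact ⟨sh, P, h1, h2, h3, h4, fun v => h5 v v.2⟩
  · rintro ⟨sh, P, h1, h2, h3, h4, h5⟩
    exact tab_ineq h1 h2 h4 (fun i v => (kept s T i).count (v+1)) (fun v hv => h5 ⟨v, hv⟩)

theorem W_tab {sh : Finset Cell} {P : Cell → ℕ} (h : AtMostRows sh n) {cs : Fin n → List ℕ}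
    (hc : ∀ v : Fin n, rowWordOn sh P v = cs v) : W n cs = readingWordOn sh P := by
  rw [reading_eq sh P h]
  unfold W
  refine RW_congr fun i hi => ?_
  have := extL_fin cs ⟨i, hi⟩
  simp only at this
  rw [this, ← hc]

theorem W_cs_len (hl : IsPartitionShape lam) (hm : IsPartitionShape mu)
    (hs : ∀ c, c ∈ s ↔ c ∈ lam ∧ c ∉ mu) (hT : IsRPPOn s T) (hV : ∀ c ∈ s, T c ≤ n) :
    (W n (csOf n s T)).length ≤ ∑ i ∈ Finset.range n, rl s i := by
  rw [W_length]
  have : ∑ v : Fin n, (csOf n s T v).length = ∑ v ∈ Finset.range n, ∑ i ∈ Finset.range n, (kept s T i).count (v+1) := by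
    rw [Finset.sum_range]
    refine Finset.sum_congr rfl fun v _ => ?_
    unfold csOf; rw [mkRow_length]
  rw [this, Finset.sum_comm]
  refine Finset.sum_le_sum fun i _ => ?_
  rw [← mkRow_length, kept_mkRow hl hm hs hT hV i]
  have := ceq_kept s T i
  omega

theorem word_len (hs : ∀ c, c ∈ s ↔ c ∈ lam ∧ c ∉ mu) (hn : AtMostRows lam n) :
    (rppRowWord s T).length ≤ ∑ i ∈ Finset.range n, rl s i := by
  rw [rowWord_eq (amr_sk hs hn), RW_length]
  refine Finset.sum_le_sum fun i _ => ?_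
  have := ceq_kept s T i
  omega

theorem hr_biword (hl : IsPartitionShape lam) (hm : IsPartitionShape mu)
    (hs : ∀ c, c ∈ s ↔ c ∈ lam ∧ c ∉ mu) (hn : AtMostRows lam n) (hT : IsRPPOn s T) :
    IsBiword (rppHeights s T) (rppRowWord s T) := by
  rw [rowWord_eq (amr_sk hs hn), heights_eq (amr_sk hs hn)]
  refine biword_rows n (kept s T) (kept_sorted hl hm hs hT) fun i a ha => ?_
  obtain ⟨j, hj, rfl⟩ := mem_kept ha
  exact hT.1 _ hj

theorem heights_le (hs : ∀ c, c ∈ s ↔ c ∈ lam ∧ c ∉ mu) (hn : AtMostRows lam n) :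
    ∀ a ∈ rppHeights s T, a ≤ n := by
  rw [heights_eq (amr_sk hs hn)]
  exact fun a ha => (mem_topW ha).2

theorem yam_sh (B : BurgeData) (hl : IsPartitionShape lam) (hm : IsPartitionShape mu)
    (hs : ∀ c, c ∈ s ↔ c ∈ lam ∧ c ∉ mu) (hn : AtMostRows lam n) (hT : IsRPPOn s T) (hV : ∀ c ∈ s, T c ≤ n)
    (hY : IsYamanouchi (rppRowWord s T)) {sh : Finset Cell} {P : Cell → ℕ} (h1 : IsPartitionShape sh)
    (h3 : AtMostRows sh n) (h5 : ∀ v : Fin n, rowWordOn sh P v = csOf n s T v) :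
    (B.out (rppHeights s T) (rppRowWord s T)).sh = sh := by
  have hb := hr_biword hl hm hs hn hT
  have p1 := B.shape_part _ _ hb
  have p2 := amr_of_le p1 (B.ssytQ _ _ hb) (Q_le B hb (heights_le hs hn))
  rw [← shp_rl p1 p2, ← shp_rl h1 h3]
  congr 1
  funext v
  have e1 : rl sh v = (csOf n s T v).length := by
    rw [← h5]; unfold rowWordOn rl; rw [List.length_map]
  have e2 := ssyt_yam p1 (B.ssytP _ _ hb) ((B.knuthP _ _ hb).yam.2 hY)
  have e3 := B.cP hb (v+1)
  rw [wtS_card] at e3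
  rw [e1, rl_card]
  have e4 : (csOf n s T v).length = (rppRowWord s T).count ((v:ℕ)+1) := by
    rw [rowWord_eq (amr_sk hs hn), RW_count]
    unfold csOf; rw [mkRow_length]
  rw [e4, ← e3]
  congr 1
  refine Finset.filter_congr fun c hc => ?_
  have := e2 c.1 c.2 hc
  simp only [Prod.mk.eta] at this
  rw [this]; omega

theorem ssyt_supp {sh sh' : Finset Cell} {Q : Cell → ℕ} (h : IsSSYTOn sh Q) (h' : IsSSYTOn sh' Q) : sh = sh' := by
  ext c
  constructor
  · intro hc; by_contra h2; have := h.1 c hc; have := h'.2.1 c h2; omega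
  · intro hc; by_contra h2; have := h'.1 c hc; have := h.2.1 c h2; omega

theorem out_inj (B : BurgeData) (hl : IsPartitionShape lam) (hm : IsPartitionShape mu) (hsub : mu ⊆ lam)
    (hs : ∀ c, c ∈ s ↔ c ∈ lam ∧ c ∉ mu) (hn : AtMostRows lam n) (hT : IsRPPOn s T) (hV : ∀ c ∈ s, T c ≤ n)
    (hY : IsYamanouchi (rppRowWord s T)) {T' : Cell → ℕ} (hT' : IsRPPOn s T') (hV' : ∀ c ∈ s, T' c ≤ n)
    (hY' : IsYamanouchi (rppRowWord s T'))
    (h : (B.out (rppHeights s T) (rppRowWord s T)).Q = (B.out (rppHeights s T') (rppRowWord s T')).Q) : T = T' := by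
  have hb := hr_biword hl hm hs hn hT
  have hb' := hr_biword hl hm hs hn hT'
  have q1 := B.ssytQ _ _ hb
  have q2 := B.ssytQ _ _ hb'
  have r1 := B.ssytP _ _ hb
  have r2 := B.ssytP _ _ hb'
  have e2 := ssyt_yam (B.shape_part _ _ hb) r1 ((B.knuthP _ _ hb).yam.2 hY)
  have e3 := ssyt_yam (B.shape_part _ _ hb') r2 ((B.knuthP _ _ hb').yam.2 hY')
  rw [← h] at q2
  have es := ssyt_supp q1 q2
  have eP : (B.out (rppHeights s T) (rppRowWord s T)).P = (B.out (rppHeights s T') (rppRowWord s T')).P := by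
    funext c
    by_cases hc : c ∈ (B.out (rppHeights s T) (rppRowWord s T)).sh
    · rw [show c = (c.1, c.2) from rfl, e2 c.1 c.2 hc, e3 c.1 c.2 (by rw [← es]; exact hc)]
    · rw [r1.2.1 c hc, r2.2.1 c (by rw [← es]; exact hc)]
  have eo : B.out (rppHeights s T) (rppRowWord s T) = B.out (rppHeights s T') (rppRowWord s T') := by
    generalize B.out (rppHeights s T) (rppRowWord s T) = o at *
    generalize B.out (rppHeights s T') (rppRowWord s T') = o' at *
    cases o; cases o'; simp only at *; subst es eP h; rfl
  obtain ⟨t1, t2⟩ := B.inj _ _ _ _ hb hb' eo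
  rw [heights_eq (amr_sk hs hn), heights_eq (amr_sk hs hn)] at t1
  rw [rowWord_eq (amr_sk hs hn), rowWord_eq (amr_sk hs hn)] at t2
  refine cs_inj hl hm hsub hs hn hT hV hT' hV' ?_
  funext v
  unfold csOf
  refine mkRow_congr fun i hi => ?_
  rw [bl_inj t1 t2 i hi]

theorem compat_iff (B : BurgeData) (hl : IsPartitionShape lam) (hm : IsPartitionShape mu) (hsub : mu ⊆ lam)
    (hs : ∀ c, c ∈ s ↔ c ∈ lam ∧ c ∉ mu) (hn : AtMostRows lam n) (q : BurgeOut) (T : Cell → ℕ) :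
    IsCompatibleRPP n B s (fun _ => n) q T ↔ (IsRPPOn s T ∧ (∀ c ∈ s, T c ≤ n) ∧ IsYamanouchi (rppRowWord s T)) ∧
      B.out (rppHeights s T) (rppRowWord s T) = q := by
  constructor
  · rintro ⟨⟨h1, h2, h3, h4⟩, _⟩
    exact ⟨⟨h1, h2, h3⟩, h4⟩
  · rintro ⟨⟨h1, h2, h3⟩, rfl⟩
    refine ⟨⟨h1, h2, h3, rfl⟩, ?_⟩
    rintro T'' ⟨k1, k2, k3, k4⟩
    exact out_inj B hl hm hsub hs hn k1 k2 k3 h1 h2 h3 k4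

def cOf (n K : ℕ) (lam mu s : Finset Cell) (w : List ℕ) : XTPoly n :=
  if w.length ≤ K ∧ w.foldr dA (rl mu) = rl lam then tMono n (fun i => rl s i - w.count (i+1)) else 0

theorem cOf_knuth (K : ℕ) (hm : IsPartitionShape mu) {u v : List ℕ} (h : KnuthEquiv u v) :
    cOf n K lam mu s u = cOf n K lam mu s v := by
  unfold cOf
  rw [h.perm.length_eq, KnuthEquiv.dA (rl_anti hm) h]
  congr 2
  funext i
  rw [h.perm.count_eq]

theorem cOf_cs (hl : IsPartitionShape lam) (hm : IsPartitionShape mu) (hsub : mu ⊆ lam)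
    (hs : ∀ c, c ∈ s ↔ c ∈ lam ∧ c ∉ mu) (hn : AtMostRows lam n) (hT : IsRPPOn s T) (hV : ∀ c ∈ s, T c ≤ n) :
    cOf n (∑ i ∈ Finset.range n, rl s i) lam mu s (W n (csOf n s T)) = tMono n (ceqOn s T) := by
  unfold cOf
  rw [if_pos ⟨W_cs_len hl hm hs hT hV, cs_W hl hm hsub hs hn hT hV⟩]
  exact tMono_congr fun i => (cs_count hl hm hs hT hV i).symm

theorem cOf_surj (hl : IsPartitionShape lam) (hm : IsPartitionShape mu)
    (hs : ∀ c, c ∈ s ↔ c ∈ lam ∧ c ∉ mu) {K : ℕ} {cs : Fin n → List ℕ}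
    (hcs : cs ∈ WS n n K) (h : cOf n K lam mu s (W n cs) ≠ 0) :
    (∃ T, IsRPPOn s T ∧ (∀ c ∈ s, T c ≤ n) ∧ csOf n s T = cs) ∧ (W n cs).length ≤ K := by
  unfold cOf at h
  by_cases h' : (W n cs).length ≤ K ∧ (W n cs).foldr dA (rl mu) = rl lam
  · exact ⟨cs_surj hl hm hs hcs h'.2, h'.1⟩
  · rw [if_neg h'] at h; exact absurd rfl h

theorem stepA (hl : IsPartitionShape lam) (hm : IsPartitionShape mu) (hsub : mu ⊆ lam)
    (hs : ∀ c, c ∈ s ↔ c ∈ lam ∧ c ∉ mu) (hn : AtMostRows lam n) :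
    gFlagged n s (fun _ => n) = ∑ cs ∈ WS n n (∑ i ∈ Finset.range n, rl s i),
      cOf n (∑ i ∈ Finset.range n, rl s i) lam mu s (W n cs) * ∏ i, (MvPolynomial.X i : XTPoly n) ^ (cs i).length := by
  unfold gFlagged
  have val : ∀ T, IsRPPOn s T → (∀ c ∈ s, T c ≤ n) →
      cOf n (∑ i ∈ Finset.range n, rl s i) lam mu s (W n (csOf n s T)) *
        ∏ i, (MvPolynomial.X i : XTPoly n) ^ (csOf n s T i).length =
      tMono n (ceqOn s T) * ∏ i : Fin n, MvPolynomial.X i ^ wtRPP s T ((i : ℕ) + 1) := by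
    intro T hT hV
    rw [cOf_cs hl hm hsub hs hn hT hV]
    congr 1
    refine Finset.prod_congr rfl fun i _ => ?_
    rw [cs_len hl hm hs hn hT]
  refine finsum_bij _ _ _ (fun a => csOf n s a.1) ?_ ?_ ?_
  · rintro ⟨T, hT, hV⟩ _
    exact ⟨cs_mem hl hm hs hn hT le_rfl, val T hT hV⟩
  · rintro ⟨T, hT, hV⟩ ⟨T', hT', hV'⟩ _ _ h
    exact Subtype.ext (cs_inj hl hm hsub hs hn hT hV hT' hV' h)
  · intro cs hcs hne
    obtain ⟨⟨T, hT, hV, rfl⟩, _⟩ := cOf_surj hl hm hs hcs (left_ne_zero_of_mul hne)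
    exact ⟨⟨T, hT, hV⟩, rfl, (val T hT hV).symm⟩

theorem TF_fin (n : ℕ) (hl : IsPartitionShape lam) (hm : IsPartitionShape mu) (hsub : mu ⊆ lam)
    (hs : ∀ c, c ∈ s ↔ c ∈ lam ∧ c ∉ mu) (hn : AtMostRows lam n) :
    {T | IsRPPOn s T ∧ (∀ c ∈ s, T c ≤ n) ∧ IsYamanouchi (rppRowWord s T)}.Finite :=
  Set.Finite.of_injOn (f := csOf n s) (t := (WS n n (∑ i ∈ Finset.range n, rl s i) : Set (Fin n → List ℕ)))
    (fun T h => cs_mem hl hm hs hn h.1 le_rfl) (fun T h T' h' e => cs_inj hl hm hsub hs hn h.1 h.2.1 h'.1 h'.2.1 e)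
    (Finset.finite_toSet _)

theorem stepB (B : BurgeData) (hl : IsPartitionShape lam) (hm : IsPartitionShape mu) (hsub : mu ⊆ lam)
    (hs : ∀ c, c ∈ s ↔ c ∈ lam ∧ c ∉ mu) (hn : AtMostRows lam n) (TF : Finset (Cell → ℕ))
    (hTF : ∀ T, T ∈ TF ↔ IsRPPOn s T ∧ (∀ c ∈ s, T c ≤ n) ∧ IsYamanouchi (rppRowWord s T)) :
    gFlagged n s (fun _ => n) = ∑ T ∈ TF, tMono n (ceqOn s T) *
      Gsum 0 n (B.out (rppHeights s T) (rppRowWord s T)).sh (fun i => (MvPolynomial.X i : XTPoly n)) := by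
  rw [stepA hl hm hsub hs hn]
  set K := ∑ i ∈ Finset.range n, rl s i with hK
  have e1 : ∀ cs ∈ WS n n K, cOf n K lam mu s (W n cs) * ∏ i, (MvPolynomial.X i : XTPoly n) ^ (cs i).length =
      ∑ T ∈ TF, if KnuthEquiv (W n cs) (W n (csOf n s T)) then
        cOf n K lam mu s (W n (csOf n s T)) * ∏ i, (MvPolynomial.X i : XTPoly n) ^ (cs i).length else 0 := by
    intro cs hcs
    by_cases h0 : cOf n K lam mu s (W n cs) = 0
    · rw [h0, zero_mul, Finset.sum_eq_zero]
      intro T _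
      split_ifs with h
      · rw [← cOf_knuth K hm h, h0, zero_mul]
      · rfl
    · obtain ⟨_, hlen⟩ := cOf_surj hl hm hs hcs h0
      obtain ⟨sh, P, h1, h2, h3, h4, h5, h6⟩ := class_rep B hcs
      have w1 : W n (fun v => rowWordOn sh P v) = readingWordOn sh P := W_tab h4 (fun v => rfl)
      have hcs' : (fun v : Fin n => rowWordOn sh P v) ∈ WS n n K := by
        rw [mem_WS]
        intro v
        rw [mem_XL]
        rw [← kept_ssyt h1 h2]
        refine ⟨kept_sorted h1 part_empty (by simp) (ssyt_rpp h2) v, fun a ha => kept_letters (ssyt_rpp h2) h3 ha, ?_⟩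
        have q1 := congrArg List.length w1
        rw [W_length, reading_length, h5] at q1
        have q2 := Finset.single_le_sum (f := fun v : Fin n => (rowWordOn sh P v).length) (fun _ _ => Nat.zero_le _) (Finset.mem_univ v)
        rw [kept_ssyt h1 h2]
        omega
      obtain ⟨⟨T, hT, hV, hcT⟩, _⟩ := cOf_surj hl hm hs hcs' (by rw [w1, ← cOf_knuth K hm h6]; exact h0)
      have hY : IsYamanouchi (rppRowWord s T) :=
        (yam_tab hl hm hs hn hT hV).2 ⟨sh, P, h1, h2, h4, h3, fun v => by rw [hcT]⟩
      have hkn : KnuthEquiv (W n cs) (W n (csOf n s T)) := by rw [hcT, w1]; exact h6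
      rw [Finset.sum_eq_single T]
      · rw [if_pos hkn, cOf_knuth K hm hkn]
      · intro T' hT' hne
        rw [if_neg]
        intro hkn'
        obtain ⟨t1, t2, t3⟩ := (hTF T').1 hT'
        obtain ⟨sh', P', g1, g2, g3, g4, g5⟩ := (yam_tab hl hm hs hn t1 t2).1 t3
        have : KnuthEquiv (readingWordOn sh' P') (readingWordOn sh P) := by
          rw [← W_tab g3 g5]; exact hkn'.symm.trans h6
        obtain ⟨rfl, rfl⟩ := ssyt_unique g1 g2 h1 h2 this
        exact hne (cs_inj hl hm hsub hs hn t1 t2 hT hV (by rw [hcT]; funext v; exact (g5 v).symm))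
      · intro h; exact absurd ((hTF T).2 ⟨hT, hV, hY⟩) h
  rw [Finset.sum_congr rfl e1, Finset.sum_comm]
  refine Finset.sum_congr rfl fun T hT => ?_
  obtain ⟨t1, t2, t3⟩ := (hTF T).1 hT
  obtain ⟨sh, P, g1, g2, g3, g4, g5⟩ := (yam_tab hl hm hs hn t1 t2).1 t3
  have w := W_tab g3 g5
  rw [← Finset.sum_filter, ← Finset.mul_sum, w, fiber B g1 g2 g4, yam_sh B hl hm hs hn t1 t2 t3 g1 g3 g5, ← w,
    cOf_cs hl hm hsub hs hn t1 t2]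
  rw [← reading_length sh P, ← w]
  exact W_cs_len hl hm hs t1 t2

theorem liftX_zero (n : ℕ) : liftX n 0 = 0 := by unfold liftX; exact map_zero _

theorem amr_ne {n : ℕ} {s' : Finset Cell} (hp : IsPartitionShape s') (h : liftX n (RGone n s') ≠ 0) : AtMostRows s' n := by
  by_contra h'
  exact h (by rw [RGone_zero hp h', liftX_zero])

theorem R_facts {n K : ℕ} {s' sq : Finset Cell} {R Q : Cell → ℕ} (hp : IsPartitionShape s') (hR : IsRPPOn s' R)
    (hn' : AtMostRows s' n) (hk : KnuthEquiv (rppReadingWord s' R) (readingWordOn sq Q)) (hQ : ∀ c ∈ sq, Q c ≤ n)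
    (hc : sq.card ≤ K) :
    (∀ c ∈ s', R c ≤ n) ∧ wsOf n s' R ∈ WS n n K ∧ KnuthEquiv (W n (wsOf n s' R)) (readingWordOn sq Q) := by
  have k3 : KnuthEquiv (W n (wsOf n s' R)) (readingWordOn sq Q) := by
    rw [ws_W hn']; exact (circ_kept hp hR).symm.trans hk
  have k1 : ∀ c ∈ s', R c ≤ n := by
    rintro ⟨i, j⟩ h
    obtain ⟨i', hi⟩ := val_kept (R := R) hn' n i j h (by omega)
    have hi' : i' < n := by
      by_contra h2
      rw [kept_nil hn' (by omega)] at hi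
      exact absurd hi List.not_mem_nil
    have : R (i,j) ∈ W n (wsOf n s' R) := by
      rw [ws_W hn', rowWord_eq hn']; exact mem_RW.2 ⟨i', hi', hi⟩
    obtain ⟨c, c1, c2⟩ := mem_reading.1 (k3.perm.mem_iff.1 this)
    rw [← c2]; exact hQ c c1
  refine ⟨k1, ?_, k3⟩
  rw [mem_WS]
  intro v
  rw [mem_XL]
  refine ⟨kept_sorted hp part_empty (by simp) hR v, fun a ha => kept_letters hR k1 ha, ?_⟩
  have q1 := k3.perm.length_eq
  rw [W_length, reading_length] at q1
  have q2 := Finset.single_le_sum (f := fun v : Fin n => (wsOf n s' R v).length) (fun _ _ => Nat.zero_le _) (Finset.mem_univ v)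
  omega

theorem main_s (B : BurgeData) (hl : IsPartitionShape lam) (hm : IsPartitionShape mu) (hsub : mu ⊆ lam)
    (hs : ∀ c, c ∈ s ↔ c ∈ lam ∧ c ∉ mu) (hn : AtMostRows lam n) :
    gFlagged n s (fun _ => n) =
      ∑ᶠ x : {y : (BurgeOut × (Cell → ℕ)) × (Finset Cell × (Cell → ℕ)) //
               IsCompatibleRPP n B s (fun _ => n) y.1.1 y.1.2 ∧
               IsPartitionShape y.2.1 ∧ IsRPPOn y.2.1 y.2.2 ∧
               KnuthEquiv (rppReadingWord y.2.1 y.2.2)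
                 (readingWordOn y.1.1.sh y.1.1.Q)},
        tMono n (ceqOn s x.1.1.2) * liftX n (RGone n x.1.2.1) := by
  have hfin := TF_fin n hl hm hsub hs hn
  have hTF : ∀ T, T ∈ hfin.toFinset ↔ IsRPPOn s T ∧ (∀ c ∈ s, T c ≤ n) ∧ IsYamanouchi (rppRowWord s T) :=
    fun T => hfin.mem_toFinset
  rw [stepB B hl hm hsub hs hn _ hTF]
  generalize hfin.toFinset = TF at hTF
  set K := ∑ i ∈ Finset.range n, rl s i with hK
  have hQ : ∀ T, IsRPPOn s T → ∀ c ∈ (B.out (rppHeights s T) (rppRowWord s T)).sh,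
      (B.out (rppHeights s T) (rppRowWord s T)).Q c ≤ n := fun T hT =>
    Q_le B (hr_biword hl hm hs hn hT) (heights_le hs hn)
  have hcard : ∀ T, IsRPPOn s T → (B.out (rppHeights s T) (rppRowWord s T)).sh.card ≤ K := by
    intro T hT
    rw [← reading_length _ (B.out (rppHeights s T) (rppRowWord s T)).P,
      (B.knuthP _ _ (hr_biword hl hm hs hn hT)).perm.length_eq]
    exact word_len hs hn
  have e1 : ∀ T ∈ TF, tMono n (ceqOn s T) *
      Gsum 0 n (B.out (rppHeights s T) (rppRowWord s T)).sh (fun i => (MvPolynomial.X i : XTPoly n)) =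
      ∑ ws ∈ WS n n K, if KnuthEquiv (W n ws) (readingWordOn (B.out (rppHeights s T) (rppRowWord s T)).sh
          (B.out (rppHeights s T) (rppRowWord s T)).Q) then
        tMono n (ceqOn s T) * liftX n (RGone n (shp n (lamOf n n ws))) else 0 := by
    intro T hT
    obtain ⟨t1, t2, t3⟩ := (hTF T).1 hT
    have hb := hr_biword hl hm hs hn t1
    rw [← liftX_Gsum, ← schur_RG B (B.shape_part _ _ hb) (B.ssytQ _ _ hb) (hQ T t1) (hcard T t1),
      ← Finset.sum_filter, ← Finset.mul_sum]
    congr 1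
    unfold liftX
    rw [map_sum]
  rw [Finset.sum_congr rfl e1, ← Finset.sum_product']
  symm
  refine finsum_bij _ _ _ (fun x => (x.1.1.2, wsOf n x.1.2.1 x.1.2.2)) ?_ ?_ ?_
  · rintro ⟨⟨⟨q, T⟩, ⟨s', R⟩⟩, hc, hp, hR, hk⟩ hne
    obtain ⟨⟨t1, t2, t3⟩, rfl⟩ := (compat_iff B hl hm hsub hs hn q T).1 hc
    have hn' := amr_ne hp (right_ne_zero_of_mul hne)
    obtain ⟨k1, k2, k3⟩ := R_facts hp hR hn' hk (hQ T t1) (hcard T t1)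
    refine ⟨Finset.mem_product.2 ⟨(hTF T).2 ⟨t1, t2, t3⟩, k2⟩, ?_⟩
    dsimp only
    rw [if_pos k3, ws_shape hp hR hn' k1]
  · rintro ⟨⟨⟨q, T⟩, ⟨s', R⟩⟩, hc, hp, hR, hk⟩ ⟨⟨⟨q', T'⟩, ⟨s'', R'⟩⟩, hc', hp', hR', hk'⟩ hne hne' he
    obtain ⟨⟨t1, t2, t3⟩, rfl⟩ := (compat_iff B hl hm hsub hs hn q T).1 hc
    obtain ⟨⟨t1', t2', t3'⟩, rfl⟩ := (compat_iff B hl hm hsub hs hn q' T').1 hc'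
    have hn1 := amr_ne hp (right_ne_zero_of_mul hne)
    have hn2 := amr_ne hp' (right_ne_zero_of_mul hne')
    have k1 := (R_facts hp hR hn1 hk (hQ T t1) (hcard T t1)).1
    have k2 := (R_facts hp' hR' hn2 hk' (hQ T' t1') (hcard T' t1')).1
    obtain ⟨e1, e2⟩ := Prod.mk.inj he
    dsimp only at e1 e2
    obtain ⟨e3, e4⟩ := ws_inj hp hR hn1 k1 hp' hR' hn2 k2 e2
    subst e1 e3 e4
    rfl
  · rintro ⟨T, ws⟩ hb hne
    obtain ⟨hT, hws⟩ := Finset.mem_product.1 hb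
    dsimp only at hT hws hne
    have hk := (ite_ne_right_iff.1 hne).1
    obtain ⟨R, r1, r2, r3⟩ := ws_surj hws
    have hk' := (circ_kept (part_shp (lamOf_anti hws)) r1).trans (by rw [← ws_W (amr_shp _), r3]; exact hk)
    refine ⟨⟨((B.out (rppHeights s T) (rppRowWord s T), T), (shp n (lamOf n n ws), R)),
      (compat_iff B hl hm hsub hs hn _ T).2 ⟨(hTF T).1 hT, rfl⟩, part_shp (lamOf_anti hws), r1, hk'⟩, ?_, ?_⟩
    · dsimp only; rw [r3]
    · dsimp only; rw [if_pos hk]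
end Main
end Part12

/-- Expansion of the refined dual stable Grothendieck polynomial in
terms of stable Grothendieck polynomials:
`g̃_{λ/μ}(x; t) = Σ_{R ∈ ℝ(λ/μ)} wt_{λ/μ}(R) · RG_{sh(R)}(x; 1)`, where `ℝ(λ/μ)` is
the set of reverse plane partitions of partition shape whose reading word is Knuth
equivalent to an element `Q` of `𝕋(λ/μ)`, and `wt_{λ/μ}(R) = t^{ceq(rect(w(R)))}`
(all but finitely many summands vanish; the sum is a `finsum`). -/
theorem gtilde_RG_expansion
    (n : ℕ) (B : BurgeData)
    (lam mu : Finset Cell)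
    (hlam : IsPartitionShape lam) (hmu : IsPartitionShape mu)
    (hsub : mu ⊆ lam) (hlamn : AtMostRows lam n) (hmun : AtMostRows mu n) :
    gFlagged n (lam \ mu) (fun _ => n) =
      ∑ᶠ x : {y : (BurgeOut × (Cell → ℕ)) × (Finset Cell × (Cell → ℕ)) //
               IsCompatibleRPP n B (lam \ mu) (fun _ => n) y.1.1 y.1.2 ∧
               IsPartitionShape y.2.1 ∧ IsRPPOn y.2.1 y.2.2 ∧
               KnuthEquiv (rppReadingWord y.2.1 y.2.2)
                 (readingWordOn y.1.1.sh y.1.1.Q)},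
        tMono n (ceqOn (lam \ mu) x.1.1.2) * liftX n (RGone n x.1.2.1) := by
  exact main_s B hlam hmu hsub (fun c => Finset.mem_sdiff) hlamn

end SkewG
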